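/- Let q > 1, −n/q ≤ δ < 0 < α < 1, −n/q ≤ β < 0, and define ψ : ℝⁿ × (0,∞) → (0,∞) by ψ(x,r) = r^α if |x| ≤ 2 and 0 < r ≤ 2, ψ(x,r) = r^δ if |x| > 2 and 0 < r ≤ 2, and ψ(x,r) = r^β if r > 2. Then: (i) the modified Riesz transforms R̃_j (j = 1,…,n) are bounded on 𝓛_{q,ψ}(ℝⁿ) and on 𝓛𝓝_{q,ψ}(ℝⁿ), i.e. there is C > 0 with ‖R̃_j f‖_{𝓛_{q,ψ}} ≤ C‖f‖_{𝓛_{q,ψ}} and ‖R̃_j f‖_{𝓛𝓝_{q,ψ}} ≤ C‖f‖_{𝓛𝓝_{q,ψ}}; and (ii) if f ∈ 𝓛𝓝_{q,ψ}(ℝⁿ) with σ(f) = lim_{r→∞} f_{B(0,r)} = 0, then the Riesz transforms R_j f are well defined, σ(R_j f) = 0, and ‖R_j f‖_{𝓛𝓝_{q,ψ}} ≤ C‖f‖_{𝓛𝓝_{q,ψ}} for j = 1,…,n. -/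

import Mathlib

open MeasureTheory Metric Filter
open scoped ENNReal NNReal

noncomputable section

/-- Average of `f` over the ball `B(x,r)`. -/
def ballAvg {n : ℕ} (f : EuclideanSpace ℝ (Fin n) → ℝ) (x : EuclideanSpace ℝ (Fin n))
    (r : ℝ) : ℝ :=
  (volume (ball x r)).toReal⁻¹ * ∫ y in ball x r, f y

/-- Campanato seminorm with variable growth function `φ`. -/
def campSemi {n : ℕ} (p : ℝ) (φ : EuclideanSpace ℝ (Fin n) → ℝ → ℝ)
    (f : EuclideanSpace ℝ (Fin n) → ℝ) : ℝ≥0∞ :=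
  ⨆ (x : EuclideanSpace ℝ (Fin n)) (r : ℝ) (_ : 0 < r),
    ENNReal.ofReal ((φ x r)⁻¹ *
      ((volume (ball x r)).toReal⁻¹ * ∫ y in ball x r, |f y - ballAvg f x r| ^ p) ^ (1 / p))

/-- Campanato norm: seminorm plus `|f_{B(0,1)}|`. -/
def campNorm {n : ℕ} (p : ℝ) (φ : EuclideanSpace ℝ (Fin n) → ℝ → ℝ)
    (f : EuclideanSpace ℝ (Fin n) → ℝ) : ℝ≥0∞ :=
  campSemi p φ f + ENNReal.ofReal |ballAvg f 0 1|

/-- Morrey norm with variable growth function `φ`. -/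
def morreyNorm {n : ℕ} (p : ℝ) (φ : EuclideanSpace ℝ (Fin n) → ℝ → ℝ)
    (f : EuclideanSpace ℝ (Fin n) → ℝ) : ℝ≥0∞ :=
  ⨆ (x : EuclideanSpace ℝ (Fin n)) (r : ℝ) (_ : 0 < r),
    ENNReal.ofReal ((φ x r)⁻¹ *
      ((volume (ball x r)).toReal⁻¹ * ∫ y in ball x r, |f y| ^ p) ^ (1 / p))

/-- Hölder seminorm with variable growth function `φ`. -/
def holderSemi {n : ℕ} (φ : EuclideanSpace ℝ (Fin n) → ℝ → ℝ)
    (f : EuclideanSpace ℝ (Fin n) → ℝ) : ℝ≥0∞ :=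
  ⨆ (x : EuclideanSpace ℝ (Fin n)) (y : EuclideanSpace ℝ (Fin n)) (_ : x ≠ y),
    ENNReal.ofReal (2 * |f x - f y| / (φ x (dist x y) + φ y (dist x y)))

/-- The doubling condition (D) with constant `A`. -/
def DoublingWith {n : ℕ} (A : ℝ) (φ : EuclideanSpace ℝ (Fin n) → ℝ → ℝ) : Prop :=
  ∀ (x : EuclideanSpace ℝ (Fin n)) (r s : ℝ), 0 < r → 0 < s →
    1 / 2 ≤ s / r → s / r ≤ 2 → A⁻¹ ≤ φ x s / φ x r ∧ φ x s / φ x r ≤ A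

/-- The doubling condition (D). -/
def Doubling {n : ℕ} (φ : EuclideanSpace ℝ (Fin n) → ℝ → ℝ) : Prop :=
  ∃ A > 0, DoublingWith A φ

/-- The nearness condition (N). -/
def Nearness {n : ℕ} (φ : EuclideanSpace ℝ (Fin n) → ℝ → ℝ) : Prop :=
  ∃ A > 0, ∀ (x y : EuclideanSpace ℝ (Fin n)) (r : ℝ), 0 < r → dist x y ≤ r →
    A⁻¹ ≤ φ x r / φ y r ∧ φ x r / φ y r ≤ A

/-- The almost increasing condition (I). -/
def AlmostIncreasing {n : ℕ} (φ : EuclideanSpace ℝ (Fin n) → ℝ → ℝ) : Prop :=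
  ∃ A > 0, ∀ (x : EuclideanSpace ℝ (Fin n)) (r s : ℝ), 0 < r → r < s → φ x r ≤ A * φ x s

/-- Positivity of the variable growth function. -/
def GrowthPos {n : ℕ} (φ : EuclideanSpace ℝ (Fin n) → ℝ → ℝ) : Prop :=
  ∀ (x : EuclideanSpace ℝ (Fin n)) (r : ℝ), 0 < r → 0 < φ x r

/-- `f ∈ L^p_loc(ℝⁿ)` (in particular `f ∈ L¹_loc`). -/
def MemLpLoc {n : ℕ} (p : ℝ) (f : EuclideanSpace ℝ (Fin n) → ℝ) : Prop :=
  LocallyIntegrable f volume ∧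
    ∀ (x : EuclideanSpace ℝ (Fin n)) (r : ℝ), 0 < r →
      IntegrableOn (fun y => |f y| ^ p) (ball x r) volume


/-- The constant `c_n = Γ((n+1)/2) π^{−(n+1)/2}` in the definition of the Riesz transforms. -/
def rieszConst (n : ℕ) : ℝ :=
  Real.Gamma (((n : ℝ) + 1) / 2) * Real.pi ^ (-(((n : ℝ) + 1) / 2))

/-- The truncated Riesz transform
`c_n ∫_{|x−y|≥ε} (x_j − y_j)|x−y|^{−(n+1)} f(y) dy`. -/
def rieszTrunc {n : ℕ} (j : Fin n) (ε : ℝ) (f : EuclideanSpace ℝ (Fin n) → ℝ)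
    (x : EuclideanSpace ℝ (Fin n)) : ℝ :=
  rieszConst n * ∫ y in {y : EuclideanSpace ℝ (Fin n) | ε ≤ dist x y},
    (x j - y j) / dist x y ^ ((n : ℝ) + 1) * f y

/-- The specific growth function of Section 6:
`r^a` for `|x| ≤ 2, r ≤ 2`; `r^b` for `|x| > 2, r ≤ 2`; `r^c` for `r > 2`. -/
def phiEx (n : ℕ) (a b c : ℝ) : EuclideanSpace ℝ (Fin n) → ℝ → ℝ :=
  fun x r => if r ≤ 2 then (if ‖x‖ ≤ 2 then r ^ a else r ^ b) else r ^ c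

/-- The truncated modified Riesz transform
`c_n ∫_{|x−y|≥ε} [ (x_j−y_j)|x−y|^{−(n+1)} − (−y_j)(1−χ_{B(0,1)}(y))|y|^{−(n+1)} ] f(y) dy`. -/
def modRieszTrunc {n : ℕ} (j : Fin n) (ε : ℝ) (f : EuclideanSpace ℝ (Fin n) → ℝ)
    (x : EuclideanSpace ℝ (Fin n)) : ℝ :=
  rieszConst n * ∫ y in {y : EuclideanSpace ℝ (Fin n) | ε ≤ dist x y},
    ((x j - y j) / dist x y ^ ((n : ℝ) + 1) -
      (-(y j)) * (1 - Set.indicator (ball (0 : EuclideanSpace ℝ (Fin n)) 1)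
        (fun _ => (1 : ℝ)) y) / ‖y‖ ^ ((n : ℝ) + 1)) * f y

lemma rz_jensen {A : Type*} [MeasurableSpace A] (μ : Measure A) (k g : A → ℝ≥0∞)
    (hk : Measurable k) (hg : Measurable g) (q : ℝ) (hq : 1 < q) :
    (∫⁻ a, k a * g a ∂μ) ^ q ≤ (∫⁻ a, k a ∂μ) ^ (q - 1) * ∫⁻ a, k a * g a ^ q ∂μ := by
  have hq0 : 0 < q := by linarith
  have hc : (q / (q - 1)).HolderConjugate q := by
    have := (Real.HolderConjugate.conjExponent hq).symm
    simpa [Real.conjExponent] using this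
  have h := ENNReal.lintegral_mul_le_Lp_mul_Lq μ hc (f := fun a => k a ^ ((q - 1) / q))
    (g := fun a => k a ^ (1 / q) * g a) (by fun_prop) (by fun_prop)
  have e1 : ∀ a, ((fun a => k a ^ ((q - 1) / q)) * (fun a => k a ^ (1 / q) * g a)) a
      = k a * g a := by
    intro a
    simp only [Pi.mul_apply]
    rw [← mul_assoc, ← ENNReal.rpow_add_of_nonneg _ _ (by apply div_nonneg <;> linarith) (by positivity)]
    have : (q - 1) / q + 1 / q = 1 := by field_simp; ring
    rw [this, ENNReal.rpow_one]
  have hq1 : q - 1 ≠ 0 := by linarith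
  have e2 : ∀ a, (k a ^ ((q - 1) / q)) ^ (q / (q - 1)) = k a := by
    intro a
    rw [← ENNReal.rpow_mul]
    have : (q - 1) / q * (q / (q - 1)) = 1 := by field_simp
    rw [this, ENNReal.rpow_one]
  have e3 : ∀ a, (k a ^ (1 / q) * g a) ^ q = k a * g a ^ q := by
    intro a
    rw [ENNReal.mul_rpow_of_nonneg _ _ hq0.le, ← ENNReal.rpow_mul]
    have : 1 / q * q = 1 := by field_simp
    rw [this, ENNReal.rpow_one]
  simp only [e1, e2, e3] at h
  calc _ ≤ _ := ENNReal.rpow_le_rpow h hq0.le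
    _ = _ := by
      rw [ENNReal.mul_rpow_of_nonneg _ _ hq0.le, ← ENNReal.rpow_mul, ← ENNReal.rpow_mul]
      have h1 : 1 / (q / (q - 1)) * q = q - 1 := by field_simp
      have h2 : 1 / q * q = 1 := by field_simp
      rw [h1, h2, ENNReal.rpow_one]

lemma rz_minkowski {A X : Type*} [MeasurableSpace A] [MeasurableSpace X] (μ : Measure A)
    (ν : Measure X) [SFinite μ] [SFinite ν] (k : A → ℝ≥0∞) (G : A → X → ℝ≥0∞)
    (hk : Measurable k) (hG : Measurable (Function.uncurry G)) (q : ℝ) (hq : 1 < q) :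
    ∫⁻ x, (∫⁻ a, k a * G a x ∂μ) ^ q ∂ν ≤
      (∫⁻ a, k a ∂μ) ^ (q - 1) * ∫⁻ a, k a * ∫⁻ x, G a x ^ q ∂ν ∂μ := by
  calc _ ≤ ∫⁻ x, (∫⁻ a, k a ∂μ) ^ (q - 1) * ∫⁻ a, k a * G a x ^ q ∂μ ∂ν := by
        apply lintegral_mono
        intro x
        exact rz_jensen μ k _ hk (hG.comp (measurable_id.prodMk measurable_const)) q hq
    _ = (∫⁻ a, k a ∂μ) ^ (q - 1) * ∫⁻ x, ∫⁻ a, k a * G a x ^ q ∂μ ∂ν := by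
        rw [lintegral_const_mul]
        apply Measurable.lintegral_prod_right'
          (f := fun p : X × A => k p.2 * G p.2 p.1 ^ q)
        apply Measurable.mul (by fun_prop)
        exact (hG.comp (measurable_snd.prodMk measurable_fst)).pow_const q
    _ = _ := by
        congr 1
        rw [lintegral_lintegral_swap]
        · apply lintegral_congr
          intro a
          rw [lintegral_const_mul]
          exact (hG.comp (measurable_const.prodMk measurable_id)).pow_const q
        · apply Measurable.aemeasurable
          apply Measurable.mul (by fun_prop)
          exact (hG.comp (measurable_snd.prodMk measurable_fst)).pow_const q

lemma rz_pt (q : ℝ) (h1 : 1 < q) (h2 : q ≤ 2) : ∃ A B : ℝ, 0 ≤ A ∧ 0 ≤ B ∧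
    ∀ w : ℂ, 0 < w.re → |w.im| ^ q ≤ A * w.re ^ q - B * (w ^ (q : ℂ)).re := by
  have hpi := Real.pi_pos
  set φ : ℝ := Real.pi / (1 + q) with hφ
  have hφ0 : 0 < φ := by positivity
  have hφ1 : φ < Real.pi / 2 := by
    rw [hφ]; exact div_lt_div_of_pos_left hpi (by norm_num) (by linarith)
  have hφ2 : Real.pi / 2 < q * φ := by
    rw [hφ, mul_div_assoc', div_lt_div_iff₀ (by norm_num) (by linarith)]; nlinarith
  have hφ3 : q * φ ≤ Real.pi := by
    rw [hφ, mul_div_assoc', div_le_iff₀ (by linarith)]; nlinarith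
  have hc : 0 < - Real.cos (q * φ) := by
    have := Real.cos_neg_of_pi_div_two_lt_of_lt hφ2 (by linarith)
    linarith
  have hcφ : 0 < Real.cos φ := Real.cos_pos_of_mem_Ioo ⟨by linarith, hφ1⟩
  set c := - Real.cos (q * φ) with hcd
  refine ⟨(1 + 1 / c) / Real.cos φ ^ q, 1 / c, by positivity, by positivity, ?_⟩
  intro w hw
  have hw0 : w ≠ 0 := by rintro rfl; simp at hw
  have hn : 0 < ‖w‖ := norm_pos_iff.mpr hw0
  have hre : (w ^ (q : ℂ)).re = ‖w‖ ^ q * Real.cos (q * |Complex.arg w|) := by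
    rw [Complex.cpow_ofReal_re, mul_comm q]
    congr 1
    rcases abs_cases (Complex.arg w) with h | h <;> rw [h.1]
    rw [neg_mul, Real.cos_neg]
  have him : |w.im| ^ q ≤ ‖w‖ ^ q :=
    Real.rpow_le_rpow (abs_nonneg _) (Complex.abs_im_le_norm w) (by linarith)
  have hnq : 0 < ‖w‖ ^ q := by positivity
  have harg : |Complex.arg w| ≤ Real.pi / 2 := Complex.abs_arg_le_pi_div_two_iff.mpr hw.le
  rcases le_or_gt φ |Complex.arg w| with h | h
  · have : Real.cos (q * |Complex.arg w|) ≤ Real.cos (q * φ) := by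
      apply Real.cos_le_cos_of_nonneg_of_le_pi (by positivity)
      · nlinarith
      · exact mul_le_mul_of_nonneg_left h (by linarith)
    have h3 : 0 ≤ (1 + 1 / c) / Real.cos φ ^ q * w.re ^ q := by positivity
    have h4 : ‖w‖ ^ q ≤ - (1 / c * (w ^ (q : ℂ)).re) := by
      rw [hre]
      have : c ≤ - Real.cos (q * |Complex.arg w|) := by linarith
      calc ‖w‖ ^ q = (1 / c) * (‖w‖ ^ q * c) := by field_simp
        _ ≤ (1 / c) * (‖w‖ ^ q * (- Real.cos (q * |Complex.arg w|))) := by gcongr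
        _ = _ := by ring
    linarith
  · have h5 : ‖w‖ * Real.cos φ ≤ w.re := by
      rw [← Complex.norm_mul_cos_arg w]
      gcongr
      rw [← Real.cos_abs (Complex.arg w)]
      exact Real.cos_le_cos_of_nonneg_of_le_pi (abs_nonneg _) (by linarith) h.le
    have h6 : ‖w‖ ^ q * Real.cos φ ^ q ≤ w.re ^ q := by
      rw [← Real.mul_rpow hn.le hcφ.le]
      exact Real.rpow_le_rpow (by positivity) h5 (by linarith)
    have h7 : (1 + 1 / c) * ‖w‖ ^ q ≤ (1 + 1 / c) / Real.cos φ ^ q * w.re ^ q := by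
      calc (1 + 1 / c) * ‖w‖ ^ q
          = (1 + 1 / c) / Real.cos φ ^ q * (‖w‖ ^ q * Real.cos φ ^ q) := by field_simp
        _ ≤ _ := by gcongr
    have h8 : 1 / c * (w ^ (q : ℂ)).re ≤ 1 / c * ‖w‖ ^ q := by
      rw [hre]
      have := Real.cos_le_one (q * |Complex.arg w|)
      gcongr
      nlinarith
    linarith

structure RzNice {X : Type*} [NormedAddCommGroup X] [MeasurableSpace X] (f : X → ℝ) : Prop where
  meas : Measurable f
  bdd : ∃ M : ℝ, 0 ≤ M ∧ ∀ x, |f x| ≤ M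
  supp : ∃ R : ℝ, 0 < R ∧ ∀ x, R < ‖x‖ → f x = 0

lemma RzNice.integrable {X : Type*} [NormedAddCommGroup X] [MeasurableSpace X] [BorelSpace X]
    [ProperSpace X] {μ : Measure X} [IsFiniteMeasureOnCompacts μ] {f : X → ℝ} (hf : RzNice f) :
    Integrable f μ := by
  obtain ⟨M, hM0, hM⟩ := hf.bdd
  obtain ⟨R, hR0, hR⟩ := hf.supp
  have h : IntegrableOn f (closedBall 0 R) μ := by
    apply Measure.integrableOn_of_bounded (M := M)
    · exact (isCompact_closedBall 0 R).measure_lt_top.ne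
    · exact hf.meas.aestronglyMeasurable
    · exact Eventually.of_forall (fun x => hM x)
  rw [← integrableOn_univ]
  apply h.of_forall_sdiff_eq_zero MeasurableSet.univ
  intro x hx
  apply hR
  simpa using hx.2

def rzCau (f : ℝ → ℝ) (z : ℂ) : ℂ := ∫ t : ℝ, (f t : ℂ) * (Complex.I / (z - t))

lemma rz_sub_ne {z : ℂ} (hz : 0 < z.im) (t : ℝ) : z - t ≠ 0 := by
  intro h
  have := congrArg Complex.im h
  simp at this
  linarith

lemma rz_im_le {z : ℂ} (t : ℝ) : z.im ≤ ‖z - t‖ := by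
  have := Complex.abs_im_le_norm (z - t)
  simp at this
  exact (le_abs_self _).trans this

lemma rzCau_meas {f : ℝ → ℝ} (hf : Measurable f) (z : ℂ) :
    AEStronglyMeasurable (fun t : ℝ => (f t : ℂ) * (Complex.I / (z - t))) volume := by
  apply Measurable.aestronglyMeasurable
  have : Measurable (fun t : ℝ => (t : ℂ)) := Complex.measurable_ofReal
  have h2 : Measurable (fun t : ℝ => (f t : ℂ)) := Complex.measurable_ofReal.comp hf
  exact h2.mul (measurable_const.div (measurable_const.sub this))

lemma rzCau_int {f : ℝ → ℝ} (hf : RzNice f) {z : ℂ} (hz : 0 < z.im) :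
    Integrable (fun t : ℝ => (f t : ℂ) * (Complex.I / (z - t))) := by
  have hi : Integrable f := hf.integrable
  apply Integrable.mono' (hi.norm.mul_const (1 / z.im)) (rzCau_meas hf.meas z)
  refine Eventually.of_forall fun t => ?_
  rw [norm_mul, norm_div, Complex.norm_I, Complex.norm_real]
  gcongr
  exact rz_im_le t

lemma rzCau_diff {f : ℝ → ℝ} (hf : RzNice f) {z : ℂ} (hz : 0 < z.im) :
    DifferentiableAt ℂ (rzCau f) z := by
  have hi : Integrable f := hf.integrable
  have h := hasDerivAt_integral_of_dominated_loc_of_deriv_le (𝕜 := ℂ) (μ := volume)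
    (F := fun (z : ℂ) (t : ℝ) => (f t : ℂ) * (Complex.I / (z - t)))
    (F' := fun (z : ℂ) (t : ℝ) => (f t : ℂ) * (-Complex.I / (z - t) ^ 2))
    (x₀ := z) (s := {w | z.im / 2 < w.im}) (bound := fun t => |f t| * (1 / (z.im / 2) ^ 2))
    ((isOpen_lt continuous_const Complex.continuous_im).mem_nhds (by simp; linarith))
    (Eventually.of_forall fun w => rzCau_meas hf.meas w) (rzCau_int hf hz) ?_ ?_ ?_ ?_
  · exact h.2.differentiableAt
  · apply Measurable.aestronglyMeasurable
    have : Measurable (fun t : ℝ => (t : ℂ)) := Complex.measurable_ofReal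
    have h2 : Measurable (fun t : ℝ => (f t : ℂ)) := Complex.measurable_ofReal.comp hf.meas
    exact h2.mul (measurable_const.div ((measurable_const.sub this).pow_const 2))
  · refine Eventually.of_forall fun t w hw => ?_
    rw [norm_mul, norm_div, norm_neg, Complex.norm_I, Complex.norm_real, norm_pow]
    have hw' : z.im / 2 < w.im := hw
    have := rz_im_le (z := w) t
    simp only [Real.norm_eq_abs]
    gcongr
    linarith
  · exact hi.abs.mul_const _
  · refine Eventually.of_forall fun t w hw => ?_
    have hw' : z.im / 2 < w.im := hw
    have hne := rz_sub_ne (z := w) (by linarith) t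
    have h1 : HasDerivAt (fun w : ℂ => w - t) 1 w := (hasDerivAt_id w).sub_const _
    have h2 := ((hasDerivAt_const w Complex.I).div h1 hne).const_mul (f t : ℂ)
    have e : (f t : ℂ) * (-Complex.I / (w - t) ^ 2) =
        (f t : ℂ) * ((0 * (w - t) - Complex.I * 1) / (w - t) ^ 2) := by simp
    rw [e]
    exact h2

lemma rz_ker_eq (x t ε : ℝ) (hε : 0 < ε) :
    Complex.I / ((x : ℂ) + ε * Complex.I - t) =
      ((ε / ((x - t) ^ 2 + ε ^ 2) : ℝ) : ℂ) + ((x - t) / ((x - t) ^ 2 + ε ^ 2) : ℝ) * Complex.I := by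
  have hne : (x : ℂ) + ε * Complex.I - t ≠ 0 := rz_sub_ne (by simpa) t
  have h2 : ((x - t) ^ 2 + ε ^ 2 : ℝ) ≠ 0 := by positivity
  have h3 : (((x : ℂ) - t) ^ 2 + (ε : ℂ) ^ 2) ≠ 0 := by exact_mod_cast h2
  push_cast
  rw [div_eq_iff hne]
  field_simp
  ring_nf
  rw [show Complex.I ^ 2 = -1 from Complex.I_sq]
  ring

lemma rz_ker_re (x t ε a : ℝ) (hε : 0 < ε) :
    ((a : ℂ) * (Complex.I / ((x : ℂ) + ε * Complex.I - t))).re = a * (ε / ((x - t) ^ 2 + ε ^ 2)) := by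
  rw [rz_ker_eq x t ε hε, Complex.re_ofReal_mul, Complex.add_re, Complex.ofReal_re,
    Complex.re_ofReal_mul]
  simp

lemma rz_ker_im (x t ε a : ℝ) (hε : 0 < ε) :
    ((a : ℂ) * (Complex.I / ((x : ℂ) + ε * Complex.I - t))).im =
      a * ((x - t) / ((x - t) ^ 2 + ε ^ 2)) := by
  rw [rz_ker_eq x t ε hε, Complex.im_ofReal_mul, Complex.add_im, Complex.ofReal_im,
    Complex.im_ofReal_mul]
  simp

def rzU (f : ℝ → ℝ) (ε x : ℝ) : ℝ := ∫ t, f t * (ε / ((x - t) ^ 2 + ε ^ 2))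
def rzV (f : ℝ → ℝ) (ε x : ℝ) : ℝ := ∫ t, f t * ((x - t) / ((x - t) ^ 2 + ε ^ 2))

lemma rzU_int {f : ℝ → ℝ} (hf : RzNice f) {ε : ℝ} (hε : 0 < ε) (x : ℝ) :
    Integrable (fun t => f t * (ε / ((x - t) ^ 2 + ε ^ 2))) := by
  have hi : Integrable f := hf.integrable
  have := (rzCau_int hf (z := (x : ℂ) + ε * Complex.I) (by simpa)).re
  refine this.congr (Eventually.of_forall fun t => ?_)
  exact rz_ker_re x t ε _ hε

lemma rzV_int {f : ℝ → ℝ} (hf : RzNice f) {ε : ℝ} (hε : 0 < ε) (x : ℝ) :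
    Integrable (fun t => f t * ((x - t) / ((x - t) ^ 2 + ε ^ 2))) := by
  have hi : Integrable f := hf.integrable
  have := (rzCau_int hf (z := (x : ℂ) + ε * Complex.I) (by simpa)).im
  refine this.congr (Eventually.of_forall fun t => ?_)
  exact rz_ker_im x t ε _ hε

lemma rzCau_re {f : ℝ → ℝ} (hf : RzNice f) {ε : ℝ} (hε : 0 < ε) (x : ℝ) :
    (rzCau f (x + ε * Complex.I)).re = rzU f ε x := by
  have h := integral_re (𝕜 := ℂ) (rzCau_int hf (z := (x : ℂ) + ε * Complex.I) (by simpa))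
  simp only [RCLike.re_eq_complex_re] at h
  rw [rzCau, ← h, rzU]
  congr 1; ext t
  exact rz_ker_re x t ε _ hε

lemma rzCau_im {f : ℝ → ℝ} (hf : RzNice f) {ε : ℝ} (hε : 0 < ε) (x : ℝ) :
    (rzCau f (x + ε * Complex.I)).im = rzV f ε x := by
  have h := integral_im (𝕜 := ℂ) (rzCau_int hf (z := (x : ℂ) + ε * Complex.I) (by simpa))
  simp only [RCLike.im_eq_complex_im] at h
  rw [rzCau, ← h, rzV]
  congr 1; ext t
  exact rz_ker_im x t ε _ hε

lemma rzU_pos {f : ℝ → ℝ} (hf : RzNice f) (h0 : ∀ x, 0 ≤ f x) (hne : ¬ f =ᵐ[volume] 0)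
    {ε : ℝ} (hε : 0 < ε) (x : ℝ) : 0 < rzU f ε x := by
  have hnn : ∀ t, 0 ≤ f t * (ε / ((x - t) ^ 2 + ε ^ 2)) := fun t => mul_nonneg (h0 t) (by positivity)
  apply lt_of_le_of_ne (integral_nonneg hnn)
  intro h
  apply hne
  have := (integral_eq_zero_iff_of_nonneg hnn (rzU_int hf hε x)).mp h.symm
  filter_upwards [this] with t ht
  have hp : (ε / ((x - t) ^ 2 + ε ^ 2)) ≠ 0 := by positivity
  simpa [hp] using ht

lemma rzCau_bound {f : ℝ → ℝ} (hf : RzNice f) : ∃ N R0 : ℝ, 0 ≤ N ∧ 0 < R0 ∧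
    ∀ R, R0 ≤ R → ∀ z : ℂ, R ≤ ‖z‖ → ‖rzCau f z‖ ≤ N / R := by
  obtain ⟨R, hR0, hR⟩ := hf.supp
  have hi : Integrable f := hf.integrable
  refine ⟨2 * ∫ t, |f t|, 2 * R, by positivity, by positivity, ?_⟩
  intro S hS z hz
  have hS0 : 0 < S := by linarith
  calc ‖rzCau f z‖ ≤ ∫ t, |f t| * (2 / S) := by
        apply norm_integral_le_of_norm_le (hi.abs.mul_const _)
        refine Eventually.of_forall fun t => ?_
        rw [norm_mul, norm_div, Complex.norm_I, Complex.norm_real, Real.norm_eq_abs]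
        by_cases ht : R < ‖t‖
        · simp [hR t ht]
        · apply mul_le_mul_of_nonneg_left _ (abs_nonneg _)
          rw [div_le_div_iff₀ _ hS0]
          · have h1 := norm_sub_norm_le z (t : ℂ)
            rw [Complex.norm_real] at h1
            linarith
          · have h1 := norm_sub_norm_le z (t : ℂ)
            rw [Complex.norm_real] at h1
            linarith
    _ = _ := by rw [integral_mul_const]; ring

lemma rz_contour {f : ℝ → ℝ} (hf : RzNice f) (h0 : ∀ x, 0 ≤ f x) (hne : ¬ f =ᵐ[volume] 0)
    {ε : ℝ} (hε : 0 < ε) {q : ℝ} (hq : 1 < q) :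
    Tendsto (fun R : ℝ => ∫ x in (-R)..R, (rzCau f (x + ε * Complex.I)) ^ (q : ℂ)) atTop (nhds 0) := by
  obtain ⟨N, R0, hN, hR0, hb⟩ := rzCau_bound hf
  have hlim : Tendsto (fun R : ℝ => 4 * N ^ q * R ^ (-(q - 1))) atTop (nhds 0) := by
    simpa using (tendsto_rpow_neg_atTop (y := q - 1) (by linarith)).const_mul (4 * N ^ q)
  apply squeeze_zero_norm' _ hlim
  filter_upwards [eventually_ge_atTop R0] with R hR
  have hRp : 0 < R := by linarith
  have hdiff : ∀ z : ℂ, 0 < z.im → DifferentiableAt ℂ (fun z => rzCau f z ^ (q : ℂ)) z := by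
    intro z hz
    apply (rzCau_diff hf hz).cpow_const
    left
    have := rzU_pos hf h0 hne hz z.re
    rw [← rzCau_re hf hz] at this
    rwa [Complex.re_add_im] at this
  have hrect := Complex.integral_boundary_rect_eq_zero_of_differentiableOn
    (fun z => rzCau f z ^ (q : ℂ)) (-R + ε * Complex.I) (R + ((ε + R : ℝ) : ℂ) * Complex.I) (by
      intro z hz
      apply (hdiff z _).differentiableWithinAt
      have := hz.2
      simp at this
      rw [Set.uIcc_of_le (by linarith)] at this
      exact hε.trans_le this.1)
  have hbd : ∀ z : ℂ, R ≤ ‖z‖ → ‖rzCau f z ^ (q : ℂ)‖ ≤ (N / R) ^ q := by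
    intro z hz
    rw [Complex.norm_cpow_real]
    exact Real.rpow_le_rpow (norm_nonneg _) (hb R hR z hz) (by linarith)
  simp only [Complex.add_re, Complex.neg_re, Complex.ofReal_re, Complex.mul_re, Complex.I_re,
    mul_zero, Complex.ofReal_im, Complex.I_im, mul_one, sub_self, add_zero, Complex.add_im,
    Complex.neg_im, neg_zero, Complex.mul_im, zero_add] at hrect
  have b1 := intervalIntegral.norm_integral_le_of_norm_le_const (a := -R) (b := R)
    (f := fun x : ℝ => rzCau f (x + ((ε + R : ℝ) : ℂ) * Complex.I) ^ (q : ℂ)) (C := (N / R) ^ q) (by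
      intro x _
      apply hbd
      have := Complex.abs_im_le_norm (x + ((ε + R : ℝ) : ℂ) * Complex.I)
      simp at this
      push_cast
      exact le_trans (by rw [abs_of_pos] <;> linarith) this)
  have b2 := intervalIntegral.norm_integral_le_of_norm_le_const (a := ε) (b := ε + R)
    (f := fun y : ℝ => rzCau f (R + (y : ℂ) * Complex.I) ^ (q : ℂ)) (C := (N / R) ^ q) (by
      intro x _
      apply hbd
      have := Complex.abs_re_le_norm (R + (x : ℂ) * Complex.I)
      simp at this
      exact le_trans (le_abs_self R) this)
  have b3 := intervalIntegral.norm_integral_le_of_norm_le_const (a := ε) (b := ε + R)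
    (f := fun y : ℝ => rzCau f (((-R : ℝ) : ℂ) + (y : ℂ) * Complex.I) ^ (q : ℂ)) (C := (N / R) ^ q) (by
      intro x _
      apply hbd
      have := Complex.abs_re_le_norm (((-R : ℝ) : ℂ) + (x : ℂ) * Complex.I)
      simp at this
      simpa using le_trans (le_abs_self R) this)
  have e1 : |R - -R| = 2 * R := by rw [abs_of_pos] <;> linarith
  have e2 : |ε + R - ε| = R := by rw [abs_of_pos] <;> linarith
  rw [e1] at b1
  rw [e2] at b2 b3
  have e3 : (∫ x in (-R)..R, (rzCau f (x + ε * Complex.I)) ^ (q : ℂ)) =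
     (∫ x in (-R)..R, rzCau f (x + ((ε + R : ℝ) : ℂ) * Complex.I) ^ (q : ℂ)) -
      Complex.I • (∫ y in ε..(ε + R), rzCau f (R + (y : ℂ) * Complex.I) ^ (q : ℂ)) +
      Complex.I • (∫ y in ε..(ε + R), rzCau f (((-R : ℝ) : ℂ) + (y : ℂ) * Complex.I) ^ (q : ℂ)) := by
    linear_combination hrect
  rw [e3]
  have e4 : (N / R) ^ q * R = N ^ q * R ^ (-(q - 1)) := by
    rw [Real.div_rpow hN hRp.le, neg_sub, Real.rpow_sub hRp, Real.rpow_one]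
    ring
  calc _ ≤ (N / R) ^ q * (2 * R) + (N / R) ^ q * R + (N / R) ^ q * R := by
        refine (norm_add_le _ _).trans (add_le_add ((norm_sub_le _ _).trans (add_le_add b1 ?_)) ?_)
        · rw [norm_smul, Complex.norm_I, one_mul]; exact b2
        · rw [norm_smul, Complex.norm_I, one_mul]; exact b3
    _ = 4 * ((N / R) ^ q * R) := by ring
    _ = _ := by rw [e4]; ring

lemma rz_young {X : Type*} [AddCommGroup X] [MeasurableSpace X] [MeasurableAdd₂ X] [MeasurableNeg X]
    [MeasurableSub₂ X]
    (μ : Measure X) [SFinite μ] [μ.IsAddLeftInvariant] (k f : X → ℝ≥0∞)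
    (hk : Measurable k) (hf : Measurable f) (q : ℝ) (hq : 1 < q) :
    ∫⁻ x, (∫⁻ t, k t * f (x - t) ∂μ) ^ q ∂μ ≤ (∫⁻ t, k t ∂μ) ^ q * ∫⁻ x, f x ^ q ∂μ := by
  refine (rz_minkowski μ μ k (fun t x => f (x - t)) hk ?_ q hq).trans ?_
  · exact hf.comp (measurable_snd.sub measurable_fst)
  · have : ∀ a, ∫⁻ x, f (x - a) ^ q ∂μ = ∫⁻ x, f x ^ q ∂μ := fun a =>
      lintegral_sub_right_eq_self (fun x => f x ^ q) a
    simp only [this]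
    rw [lintegral_mul_const _ hk, ← mul_assoc]
    gcongr
    apply le_of_eq
    nth_rewrite 2 [← ENNReal.rpow_one (∫⁻ t, k t ∂μ)]
    rw [← ENNReal.rpow_add_of_nonneg _ _ (by linarith) (by norm_num)]
    congr 1; ring

def rzH (f : ℝ → ℝ) (ε x : ℝ) : ℝ := ∫ t, (if ε ≤ |t| then t⁻¹ else 0) * f (x - t)

lemma rzU_eq (f : ℝ → ℝ) (ε x : ℝ) : rzU f ε x = ∫ t, (ε / (t ^ 2 + ε ^ 2)) * f (x - t) := by
  rw [rzU, ← integral_sub_left_eq_self _ volume x]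
  congr 1; ext t; simp; ring
lemma rzV_eq (f : ℝ → ℝ) (ε x : ℝ) : rzV f ε x = ∫ t, (t / (t ^ 2 + ε ^ 2)) * f (x - t) := by
  rw [rzV, ← integral_sub_left_eq_self _ volume x]
  congr 1; ext t; simp; ring

lemma rzU_int' {f : ℝ → ℝ} (hf : RzNice f) {ε : ℝ} (hε : 0 < ε) (x : ℝ) :
    Integrable (fun t => (ε / (t ^ 2 + ε ^ 2)) * f (x - t)) := by
  have := (rzU_int hf hε x).comp_sub_left x
  refine this.congr (Eventually.of_forall fun t => ?_)
  simp; ring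
lemma rzV_int' {f : ℝ → ℝ} (hf : RzNice f) {ε : ℝ} (hε : 0 < ε) (x : ℝ) :
    Integrable (fun t => (t / (t ^ 2 + ε ^ 2)) * f (x - t)) := by
  have := (rzV_int hf hε x).comp_sub_left x
  refine this.congr (Eventually.of_forall fun t => ?_)
  simp; ring

lemma rzD_le {ε : ℝ} (hε : 0 < ε) (t : ℝ) :
    |(if ε ≤ |t| then t⁻¹ else 0) - t / (t ^ 2 + ε ^ 2)| ≤ ε / (t ^ 2 + ε ^ 2) := by
  have hp : 0 < t ^ 2 + ε ^ 2 := by positivity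
  split_ifs with h
  · have ht : t ≠ 0 := by rintro rfl; simp at h; linarith
    have : t⁻¹ - t / (t ^ 2 + ε ^ 2) = (ε ^ 2 / t) / (t ^ 2 + ε ^ 2) := by field_simp; ring
    rw [this, abs_div, abs_of_pos hp]
    gcongr
    rw [abs_div, abs_of_pos (by positivity), div_le_iff₀ (by positivity)]
    nlinarith
  · rw [zero_sub, abs_neg, abs_div, abs_of_pos hp]
    gcongr
    linarith

lemma rzH_meas (ε : ℝ) : Measurable (fun t : ℝ => (if ε ≤ |t| then t⁻¹ else 0)) := by
  apply Measurable.ite _ measurable_inv measurable_const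
  exact measurableSet_le measurable_const (by fun_prop)

lemma rzH_int {f : ℝ → ℝ} (hf : RzNice f) {ε : ℝ} (hε : 0 < ε) (x : ℝ) :
    Integrable (fun t => (if ε ≤ |t| then t⁻¹ else 0) * f (x - t)) := by
  have hi : Integrable f := hf.integrable
  have hi2 := hi.comp_sub_left x
  apply Integrable.mono' (hi2.norm.const_mul ε⁻¹)
  · exact ((rzH_meas ε).mul (hf.meas.comp (measurable_const.sub measurable_id))).aestronglyMeasurable
  · refine Eventually.of_forall fun t => ?_
    rw [norm_mul]
    gcongr
    split_ifs with h
    · rw [norm_inv]; gcongr; simpa using h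
    · simp; positivity

lemma rzH_le {f : ℝ → ℝ} (hf : RzNice f) (h0 : ∀ x, 0 ≤ f x) {ε : ℝ} (hε : 0 < ε) (x : ℝ) :
    |rzH f ε x| ≤ |rzV f ε x| + rzU f ε x := by
  have h1 : rzH f ε x - rzV f ε x =
      ∫ t, ((if ε ≤ |t| then t⁻¹ else 0) - t / (t ^ 2 + ε ^ 2)) * f (x - t) := by
    rw [rzH, rzV_eq, ← integral_sub (rzH_int hf hε x) (rzV_int' hf hε x)]
    congr 1; ext t; ring
  have h2 : |rzH f ε x - rzV f ε x| ≤ rzU f ε x := by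
    rw [h1, rzU_eq, ← Real.norm_eq_abs]
    apply norm_integral_le_of_norm_le (rzU_int' hf hε x)
    refine Eventually.of_forall fun t => ?_
    rw [norm_mul, Real.norm_eq_abs, Real.norm_eq_abs, abs_of_nonneg (h0 _)]
    exact mul_le_mul_of_nonneg_right (rzD_le hε t) (h0 _)
  have h3 := abs_add_le (rzH f ε x - rzV f ε x) (rzV f ε x)
  rw [sub_add_cancel] at h3
  linarith

lemma rz_poisson_mass {ε : ℝ} (hε : 0 < ε) :
    ∫⁻ t : ℝ, ‖ε / (t ^ 2 + ε ^ 2)‖ₑ = ENNReal.ofReal Real.pi := by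
  have e : ∀ t : ℝ, ε / (t ^ 2 + ε ^ 2) = ε⁻¹ * (1 + (ε⁻¹ * t) ^ 2)⁻¹ := by
    intro t; field_simp; ring
  have hi : Integrable (fun t : ℝ => ε⁻¹ * (1 + (ε⁻¹ * t) ^ 2)⁻¹) :=
    ((integrable_inv_one_add_sq).comp_mul_left' (R := ε⁻¹) (by positivity)).const_mul _
  simp only [e]
  rw [← ofReal_integral_norm_eq_lintegral_enorm hi]
  congr 1
  have : ∀ t : ℝ, ‖ε⁻¹ * (1 + (ε⁻¹ * t) ^ 2)⁻¹‖ = ε⁻¹ * (1 + (ε⁻¹ * t) ^ 2)⁻¹ := by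
    intro t; rw [Real.norm_of_nonneg]; positivity
  simp only [this]
  rw [integral_const_mul, Measure.integral_comp_mul_left (fun t : ℝ => (1 + t ^ 2)⁻¹) ε⁻¹,
    integral_univ_inv_one_add_sq]
  rw [inv_inv, abs_of_pos hε, smul_eq_mul]
  field_simp

lemma rzU_Lq {f : ℝ → ℝ} (hf : RzNice f) {ε : ℝ} (hε : 0 < ε) {q : ℝ} (hq : 1 < q) :
    ∫⁻ x, ‖rzU f ε x‖ₑ ^ q ≤ ENNReal.ofReal Real.pi ^ q * ∫⁻ x, ‖f x‖ₑ ^ q := by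
  rw [← rz_poisson_mass hε]
  refine le_trans ?_ (rz_young volume (fun t : ℝ => ‖ε / (t ^ 2 + ε ^ 2)‖ₑ) (fun t => ‖f t‖ₑ)
    (by fun_prop) (hf.meas.enorm) q hq)
  gcongr with x
  rw [rzU_eq]
  refine (enorm_integral_le_lintegral_enorm _).trans (le_of_eq ?_)
  simp only [enorm_mul]

lemma rz_V_Lq (q : ℝ) (h1 : 1 < q) (h2 : q ≤ 2) : ∃ A : ℝ≥0, ∀ (f : ℝ → ℝ), RzNice f →
    (∀ x, 0 ≤ f x) → ∀ ε : ℝ, 0 < ε →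
    ∫⁻ x, ‖rzV f ε x‖ₑ ^ q ≤ A * ∫⁻ x, ‖rzU f ε x‖ₑ ^ q := by
  obtain ⟨A, B, hA, hB, hAB⟩ := rz_pt q h1 h2
  refine ⟨A.toNNReal, fun f hf h0 ε hε => ?_⟩
  have hq0 : 0 < q := by linarith
  by_cases hne : f =ᵐ[volume] 0
  · have : ∀ x, rzV f ε x = 0 := by
      intro x
      rw [rzV]
      apply integral_eq_zero_of_ae
      filter_upwards [hne] with t ht
      simp [ht]
    simp [this, hq0]
  have hcont : Continuous (fun x : ℝ => rzCau f (x + ε * Complex.I)) := by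
    rw [continuous_iff_continuousAt]
    intro x
    exact (rzCau_diff hf (z := x + ε * Complex.I) (by simpa)).continuousAt.comp
      (f := fun x : ℝ => (x : ℂ) + ε * Complex.I) (by fun_prop)
  have hpos : ∀ x : ℝ, 0 < (rzCau f (x + ε * Complex.I)).re := fun x => by
    rw [rzCau_re hf hε]; exact rzU_pos hf h0 hne hε x
  have hcq : Continuous (fun x : ℝ => rzCau f (x + ε * Complex.I) ^ (q : ℂ)) := by
    apply hcont.cpow continuous_const
    intro x; left; exact hpos x
  have hU : Continuous (fun x => rzU f ε x) := by
    have := Complex.continuous_re.comp hcont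
    refine this.congr fun x => ?_
    exact rzCau_re hf hε x
  have hV : Continuous (fun x => rzV f ε x) := by
    have := Complex.continuous_im.comp hcont
    refine this.congr fun x => ?_
    exact rzCau_im hf hε x
  have hVq : Continuous (fun x => |rzV f ε x| ^ q) := hV.abs.rpow_const fun _ => Or.inr hq0.le
  have hUq : Continuous (fun x => rzU f ε x ^ q) := hU.rpow_const fun _ => Or.inr hq0.le
  have hUpos : ∀ x, 0 < rzU f ε x := fun x => rzU_pos hf h0 hne hε x
  have eV : ∀ x, ‖rzV f ε x‖ₑ ^ q = ENNReal.ofReal (|rzV f ε x| ^ q) := fun x => by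
    rw [← ofReal_norm, ENNReal.ofReal_rpow_of_nonneg (norm_nonneg _) hq0.le]; rfl
  have eU : ∀ x, ‖rzU f ε x‖ₑ ^ q = ENNReal.ofReal (rzU f ε x ^ q) := fun x => by
    rw [← ofReal_norm, ENNReal.ofReal_rpow_of_nonneg (norm_nonneg _) hq0.le,
      Real.norm_of_nonneg (hUpos x).le]
  have key : ∀ R : ℝ, 0 < R → ∫⁻ x in Set.Ioc (-R) R, ‖rzV f ε x‖ₑ ^ q ≤
      A.toNNReal * (∫⁻ x, ‖rzU f ε x‖ₑ ^ q) + ENNReal.ofReal (B *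
        ‖∫ x in (-R)..R, (rzCau f (x + ε * Complex.I)) ^ (q : ℂ)‖) := by
    intro R hR
    have hle : -R ≤ R := by linarith
    have k1 : ∫ x in (-R)..R, |rzV f ε x| ^ q ≤
        A * (∫ x in (-R)..R, rzU f ε x ^ q) +
        B * ‖∫ x in (-R)..R, (rzCau f (x + ε * Complex.I)) ^ (q : ℂ)‖ := by
      have k2 : ∫ x in (-R)..R, |rzV f ε x| ^ q ≤
          ∫ x in (-R)..R, (A * rzU f ε x ^ q - B * (rzCau f (x + ε * Complex.I) ^ (q : ℂ)).re) := by
        apply intervalIntegral.integral_mono_on hle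
        · exact hVq.intervalIntegrable _ _
        · apply Continuous.intervalIntegrable
          exact (continuous_const.mul hUq).sub (continuous_const.mul (Complex.continuous_re.comp hcq))
        · intro x _
          have := hAB _ (hpos x)
          rwa [rzCau_im hf hε, rzCau_re hf hε] at this
      refine k2.trans ?_
      rw [intervalIntegral.integral_sub, intervalIntegral.integral_const_mul,
        intervalIntegral.integral_const_mul]
      · have k3 : ∫ x in (-R)..R, (rzCau f (x + ε * Complex.I) ^ (q : ℂ)).re =
            (∫ x in (-R)..R, (rzCau f (x + ε * Complex.I)) ^ (q : ℂ)).re := by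
          have := Complex.reCLM.intervalIntegral_comp_comm (μ := volume)
            (hcq.intervalIntegrable (-R) R)
          simpa using this
        rw [k3]
        have k4 := (abs_le.mp (Complex.abs_re_le_norm
          (∫ x in (-R)..R, (rzCau f (x + ε * Complex.I)) ^ (q : ℂ)))).1
        nlinarith
      · exact (continuous_const.mul hUq).intervalIntegrable _ _
      · exact (continuous_const.mul (Complex.continuous_re.comp hcq)).intervalIntegrable _ _
    simp only [eV, eU]
    rw [intervalIntegral.integral_of_le hle, intervalIntegral.integral_of_le hle] at k1
    rw [← ofReal_integral_eq_lintegral_ofReal]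
    · refine (ENNReal.ofReal_le_ofReal k1).trans ?_
      rw [ENNReal.ofReal_add]
      · gcongr
        rw [ENNReal.ofReal_mul hA]
        gcongr
        · rfl
        rw [ofReal_integral_eq_lintegral_ofReal]
        · exact setLIntegral_le_lintegral _ _
        · exact (hUq.integrableOn_Icc).mono_set Set.Ioc_subset_Icc_self
        · exact Eventually.of_forall fun x => by have := hUpos x; positivity
      · apply mul_nonneg hA
        apply integral_nonneg
        intro x; have := hUpos x; positivity
      · positivity
    · exact (hVq.integrableOn_Icc).mono_set Set.Ioc_subset_Icc_self
    · exact Eventually.of_forall fun x => by positivity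
  have lim1 := (aecover_Ioc (μ := (volume : Measure ℝ)) tendsto_neg_atTop_atBot
    tendsto_id).lintegral_tendsto_of_countably_generated
      (f := fun x => ‖rzV f ε x‖ₑ ^ q) (by
        exact (hV.measurable.enorm.pow_const q).aemeasurable)
  have lim2 : Tendsto (fun R : ℝ => A.toNNReal * (∫⁻ x, ‖rzU f ε x‖ₑ ^ q) + ENNReal.ofReal (B *
        ‖∫ x in (-R)..R, (rzCau f (x + ε * Complex.I)) ^ (q : ℂ)‖)) atTop
        (nhds (A.toNNReal * (∫⁻ x, ‖rzU f ε x‖ₑ ^ q) + 0)) := by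
    apply Tendsto.const_add
    have := ((rz_contour hf h0 hne hε h1).norm.const_mul B)
    have := ENNReal.tendsto_ofReal this
    simpa using this
  rw [add_zero] at lim2
  apply le_of_tendsto_of_tendsto lim1 lim2
  filter_upwards [eventually_gt_atTop 0] with R hR
  exact key R hR

lemma rz_add_rpow (a b : ℝ≥0∞) (q : ℝ) (hq : 1 < q) : (a + b) ^ q ≤ 2 ^ (q - 1) * (a ^ q + b ^ q) := by
  exact ENNReal.rpow_add_le_mul_rpow_add_rpow a b hq.le

lemma rz_H_pos (q : ℝ) (h1 : 1 < q) (h2 : q ≤ 2) : ∃ A : ℝ≥0, ∀ (f : ℝ → ℝ), RzNice f →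
    (∀ x, 0 ≤ f x) → ∀ ε : ℝ, 0 < ε →
    ∫⁻ x, ‖rzH f ε x‖ₑ ^ q ≤ A * ∫⁻ x, ‖f x‖ₑ ^ q := by
  obtain ⟨A, hA⟩ := rz_V_Lq q h1 h2
  refine ⟨(2 ^ (q - 1) * (A + 1)) * (Real.pi.toNNReal) ^ q, fun f hf h0 ε hε => ?_⟩
  have hcont : Continuous (fun x : ℝ => rzCau f (x + ε * Complex.I)) := by
    rw [continuous_iff_continuousAt]
    intro x
    exact (rzCau_diff hf (z := x + ε * Complex.I) (by simpa)).continuousAt.comp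
      (f := fun x : ℝ => (x : ℂ) + ε * Complex.I) (by fun_prop)
  have hU : Continuous (fun x => rzU f ε x) := by
    have := Complex.continuous_re.comp hcont
    refine this.congr fun x => ?_
    exact rzCau_re hf hε x
  calc ∫⁻ x, ‖rzH f ε x‖ₑ ^ q ≤ ∫⁻ x, 2 ^ (q - 1) * (‖rzV f ε x‖ₑ ^ q + ‖rzU f ε x‖ₑ ^ q) := by
        gcongr with x
        refine le_trans ?_ (rz_add_rpow _ _ q h1)
        gcongr
        have h := rzH_le hf h0 hε x
        have h' : ‖rzH f ε x‖ ≤ ‖rzV f ε x‖ + ‖rzU f ε x‖ := by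
          simp only [Real.norm_eq_abs]
          exact h.trans (by gcongr; exact le_abs_self _)
        rw [← ofReal_norm, ← ofReal_norm, ← ofReal_norm,
          ← ENNReal.ofReal_add (norm_nonneg _) (norm_nonneg _)]
        exact ENNReal.ofReal_le_ofReal h'
    _ = 2 ^ (q - 1) * ((∫⁻ x, ‖rzV f ε x‖ₑ ^ q) + ∫⁻ x, ‖rzU f ε x‖ₑ ^ q) := by
        rw [lintegral_const_mul' _ _ (by finiteness), lintegral_add_right]
        exact hU.measurable.enorm.pow_const q
    _ ≤ 2 ^ (q - 1) * ((A * (∫⁻ x, ‖rzU f ε x‖ₑ ^ q)) + ∫⁻ x, ‖rzU f ε x‖ₑ ^ q) := by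
        gcongr
        exact hA f hf h0 ε hε
    _ = 2 ^ (q - 1) * (A + 1) * ∫⁻ x, ‖rzU f ε x‖ₑ ^ q := by ring
    _ ≤ 2 ^ (q - 1) * (A + 1) * (ENNReal.ofReal Real.pi ^ q * ∫⁻ x, ‖f x‖ₑ ^ q) := by
        gcongr
        exact rzU_Lq hf hε h1
    _ = _ := by
        rw [← mul_assoc]
        congr 1
        rw [ENNReal.coe_mul, ENNReal.coe_mul, ENNReal.coe_add,
          ENNReal.coe_rpow_of_nonneg _ (by linarith : 0 ≤ q - 1),
          ENNReal.coe_rpow_of_nonneg _ (by linarith : 0 ≤ q)]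
        simp [ENNReal.ofReal]

lemma rz_H (q : ℝ) (h1 : 1 < q) (h2 : q ≤ 2) : ∃ A : ℝ≥0, ∀ (f : ℝ → ℝ), RzNice f →
    ∀ ε : ℝ, 0 < ε → ∫⁻ x, ‖rzH f ε x‖ₑ ^ q ≤ A * ∫⁻ x, ‖f x‖ₑ ^ q := by
  obtain ⟨A, hA⟩ := rz_H_pos q h1 h2
  have hq0 : 0 < q := by linarith
  refine ⟨2 ^ (q - 1) * (A + A), fun f hf ε hε => ?_⟩
  obtain ⟨M, hM0, hM⟩ := hf.bdd
  obtain ⟨R, hR0, hR⟩ := hf.supp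
  have n1 : RzNice (fun x => max (f x) 0) :=
    ⟨hf.meas.max measurable_const, ⟨M, hM0, fun x => by
      have := abs_le.mp (hM x)
      rw [abs_of_nonneg (le_max_right _ _)]; exact max_le this.2 hM0⟩,
      ⟨R, hR0, fun x hx => by simp [hR x hx]⟩⟩
  have n2 : RzNice (fun x => max (-f x) 0) :=
    ⟨hf.meas.neg.max measurable_const, ⟨M, hM0, fun x => by
      have := abs_le.mp (hM x)
      rw [abs_of_nonneg (le_max_right _ _)]; exact max_le (by linarith) hM0⟩,
      ⟨R, hR0, fun x hx => by simp [hR x hx]⟩⟩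
  have b1 := hA _ n1 (fun x => le_max_right _ _) ε hε
  have b2 := hA _ n2 (fun x => le_max_right _ _) ε hε
  have m1 : ∫⁻ x, ‖max (f x) 0‖ₑ ^ q ≤ ∫⁻ x, ‖f x‖ₑ ^ q := by
    gcongr with x
    rw [enorm_le_iff_norm_le, Real.norm_eq_abs, Real.norm_eq_abs, abs_of_nonneg (le_max_right _ _)]
    exact max_le (le_abs_self _) (abs_nonneg _)
  have m2 : ∫⁻ x, ‖max (-f x) 0‖ₑ ^ q ≤ ∫⁻ x, ‖f x‖ₑ ^ q := by
    gcongr with x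
    rw [enorm_le_iff_norm_le, Real.norm_eq_abs, Real.norm_eq_abs, abs_of_nonneg (le_max_right _ _)]
    exact max_le (neg_le_abs _) (abs_nonneg _)
  have hdec : ∀ x, rzH f ε x = rzH (fun x => max (f x) 0) ε x - rzH (fun x => max (-f x) 0) ε x := by
    intro x
    rw [rzH, rzH, rzH, ← integral_sub (rzH_int n1 hε x) (rzH_int n2 hε x)]
    congr 1; ext t
    rw [← mul_sub]
    congr 1
    rcases le_total 0 (f (x - t)) with h | h
    · rw [max_eq_left h, max_eq_right (by linarith)]; ring
    · rw [max_eq_right h, max_eq_left (by linarith)]; ring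
  have hmeas : Measurable (fun x => rzH (fun x => max (-f x) 0) ε x) := by
    unfold rzH
    apply StronglyMeasurable.measurable
    apply StronglyMeasurable.integral_prod_right
      (f := fun (x t : ℝ) => (if ε ≤ |t| then t⁻¹ else 0) * max (-f (x - t)) 0)
    apply Measurable.stronglyMeasurable
    apply ((rzH_meas ε).comp measurable_snd).mul
    exact n2.meas.comp (measurable_fst.sub measurable_snd)
  calc ∫⁻ x, ‖rzH f ε x‖ₑ ^ q ≤ ∫⁻ x, 2 ^ (q - 1) * (‖rzH (fun x => max (f x) 0) ε x‖ₑ ^ q +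
          ‖rzH (fun x => max (-f x) 0) ε x‖ₑ ^ q) := by
        gcongr with x
        refine le_trans ?_ (rz_add_rpow _ _ q h1)
        gcongr
        rw [hdec]
        exact enorm_sub_le
    _ = 2 ^ (q - 1) * ((∫⁻ x, ‖rzH (fun x => max (f x) 0) ε x‖ₑ ^ q) +
          ∫⁻ x, ‖rzH (fun x => max (-f x) 0) ε x‖ₑ ^ q) := by
        rw [lintegral_const_mul' _ _ (by finiteness), lintegral_add_right]
        exact hmeas.enorm.pow_const q
    _ ≤ 2 ^ (q - 1) * (A * (∫⁻ x, ‖f x‖ₑ ^ q) + A * ∫⁻ x, ‖f x‖ₑ ^ q) := by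
        gcongr
        · exact b1.trans (by gcongr)
        · exact b2.trans (by gcongr)
    _ = _ := by
        rw [ENNReal.coe_mul, ENNReal.coe_add, ENNReal.coe_rpow_of_nonneg _ (by linarith : 0 ≤ q - 1)]
        push_cast
        ring

abbrev REu (n : ℕ) := EuclideanSpace ℝ (Fin n)

lemma rz_slice {n : ℕ} (v : REu n) (hv : v ≠ 0) : ∃ c : ℝ≥0∞, ∀ Φ : REu n → ℝ≥0∞, Measurable Φ →
    ∫⁻ x, Φ x = c * ∫⁻ w : (Submodule.span ℝ {v})ᗮ, ∫⁻ s : ℝ, Φ (s • v + (w : REu n)) := by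
  let p : Submodule ℝ (REu n) := Submodule.span ℝ {v}
  let L0 : (ℝ × pᗮ) ≃ₗ[ℝ] REu n :=
    ((LinearEquiv.toSpanNonzeroSingleton ℝ (REu n) v hv).prodCongr (LinearEquiv.refl ℝ pᗮ)).trans
      (Submodule.prodEquivOfIsCompl p pᗮ (Submodule.isCompl_orthogonal p))
  let L : (ℝ × pᗮ) ≃L[ℝ] REu n := L0.toContinuousLinearEquiv
  have hL : ∀ a : ℝ × pᗮ, L a = a.1 • v + (a.2 : REu n) := by
    intro a
    simp [L, L0, p]
  have hH : (Measure.map L ((volume : Measure ℝ).prod (volume : Measure pᗮ))).IsAddHaarMeasure :=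
    L.isAddHaarMeasure_map _
  have hc := Measure.isAddLeftInvariant_eq_smul (volume : Measure (REu n))
    (Measure.map L ((volume : Measure ℝ).prod (volume : Measure pᗮ)))
  refine ⟨(Measure.addHaarScalarFactor (volume : Measure (REu n))
    (Measure.map L ((volume : Measure ℝ).prod (volume : Measure pᗮ)))  : ℝ≥0), fun Φ hΦ => ?_⟩
  conv_lhs => rw [hc]
  rw [lintegral_smul_measure, lintegral_map hΦ L.continuous.measurable, ENNReal.smul_def, smul_eq_mul]
  congr 1
  have hm : Measurable (fun a => Φ (L a)) := hΦ.comp L.continuous.measurable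
  rw [lintegral_prod_symm _ hm.aemeasurable]
  simp only [hL]
  rfl

def rzHv {n : ℕ} (f : REu n → ℝ) (v : REu n) (ε : ℝ) (x : REu n) : ℝ :=
  ∫ t : ℝ, (if ε ≤ |t| then t⁻¹ else 0) * f (x - t • v)

lemma rzHv_meas {n : ℕ} {f : REu n → ℝ} (hf : Measurable f) (ε : ℝ) :
    Measurable (fun a : REu n × REu n => rzHv f a.1 ε a.2) := by
  unfold rzHv
  apply StronglyMeasurable.measurable
  apply StronglyMeasurable.integral_prod_right
    (f := fun (a : REu n × REu n) (t : ℝ) => (if ε ≤ |t| then t⁻¹ else 0) * f (a.2 - t • a.1))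
  apply Measurable.stronglyMeasurable
  apply ((rzH_meas ε).comp measurable_snd).mul
  apply hf.comp
  fun_prop

lemma rz_Hv {n : ℕ} (q : ℝ) (h1 : 1 < q) (h2 : q ≤ 2) : ∃ A : ℝ≥0, ∀ (f : REu n → ℝ), RzNice f →
    ∀ v : REu n, v ≠ 0 → ∀ ε : ℝ, 0 < ε →
    ∫⁻ x, ‖rzHv f v ε x‖ₑ ^ q ≤ A * ∫⁻ x, ‖f x‖ₑ ^ q := by
  obtain ⟨A, hA⟩ := rz_H q h1 h2
  refine ⟨A, fun f hf v hv ε hε => ?_⟩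
  obtain ⟨c, hc⟩ := rz_slice v hv
  have hm : Measurable (fun x => rzHv f v ε x) :=
    (rzHv_meas hf.meas ε).comp (measurable_const.prodMk measurable_id)
  rw [hc _ (hm.enorm.pow_const q), hc _ (hf.meas.enorm.pow_const q), mul_left_comm]
  gcongr
  rw [← lintegral_const_mul' _ _ (by finiteness)]
  gcongr with w
  have hn : RzNice (fun s : ℝ => f (s • v + (w : REu n))) := by
    obtain ⟨M, hM0, hM⟩ := hf.bdd
    obtain ⟨R, hR0, hR⟩ := hf.supp
    refine ⟨hf.meas.comp (by fun_prop), ⟨M, hM0, fun s => hM _⟩, ⟨(R + ‖w‖) / ‖v‖, ?_, ?_⟩⟩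
    · have := norm_pos_iff.mpr hv
      have := norm_nonneg w
      positivity
    · intro s hs
      apply hR
      have hvp := norm_pos_iff.mpr hv
      rw [div_lt_iff₀ hvp] at hs
      have := norm_sub_norm_le (s • v) (-(w : REu n))
      rw [norm_smul, sub_neg_eq_add, norm_neg] at this
      have e : ‖(w : REu n)‖ = ‖w‖ := rfl
      linarith
  have := hA _ hn ε hε
  refine le_trans (le_of_eq ?_) this
  congr 1; ext s
  congr 2
  rw [rzHv, rzH]
  congr 1; ext t
  congr 2
  module

-- radial kernel computation
lemma rz_tint {n : ℕ} (m : ℝ) (hm : 0 < m) :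
    ∫ t : ℝ, (if m ≤ |t| then (|t| ^ (n + 2))⁻¹ else 0) = 2 / (n + 1) / m ^ (n + 1) := by
  have h := integral_comp_abs (f := fun t : ℝ => if m ≤ t then (t ^ (n + 2))⁻¹ else 0)
  rw [h]
  have e : ∫ t in Set.Ioi (0:ℝ), (if m ≤ t then (t ^ (n + 2))⁻¹ else 0) =
      ∫ t in Set.Ioi m, t ^ (-((n : ℝ) + 2)) := by
    have h1 : (fun t : ℝ => (if m ≤ t then (t ^ (n + 2))⁻¹ else 0)) =
        Set.indicator (Set.Ici m) (fun t => (t ^ (n + 2))⁻¹) := by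
      ext t; simp [Set.indicator]
    have h2 : Set.Ioi (0:ℝ) ∩ Set.Ici m = Set.Ici m :=
      Set.inter_eq_right.mpr (fun t ht => lt_of_lt_of_le hm ht)
    rw [h1, setIntegral_indicator measurableSet_Ici, h2, integral_Ici_eq_integral_Ioi]
    apply setIntegral_congr_fun measurableSet_Ioi
    intro t ht
    have : 0 < t := hm.trans ht
    simp only
    rw [Real.rpow_neg this.le]
    congr 1
    exact_mod_cast (Real.rpow_natCast t (n + 2)).symm
  rw [e, integral_Ioi_rpow_of_lt (by have : (0:ℝ) ≤ n := Nat.cast_nonneg n; linarith) hm]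
  have e2 : -((n : ℝ) + 2) + 1 = -((n + 1 : ℕ) : ℝ) := by push_cast; ring
  rw [e2, Real.rpow_neg hm.le, Real.rpow_natCast]
  push_cast
  have : (n : ℝ) + 1 ≠ 0 := by positivity
  field_simp

lemma rz_tintble {k : ℕ} (m : ℝ) (hm : 0 < m) :
    Integrable (fun t : ℝ => (if m ≤ |t| then (|t| ^ (k + 2))⁻¹ else 0)) := by
  by_contra h
  have h1 := integral_undef h
  rw [rz_tint m hm] at h1
  have : 2 / ((k:ℝ) + 1) / m ^ (k + 1) ≠ 0 := by positivity
  exact this h1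

def kerK {n : ℕ} (j : Fin n) (ε : ℝ) (z : REu n) : ℝ :=
  if ε ≤ ‖z‖ then z j / ‖z‖ ^ (n + 1) else 0

def rzT {n : ℕ} (j : Fin n) (ε : ℝ) (f : REu n → ℝ) (x : REu n) : ℝ :=
  ∫ z, kerK j ε z * f (x - z)

lemma rz_coord_meas {n : ℕ} (j : Fin n) : Measurable (fun v : REu n => v j) := by fun_prop

lemma rz_coord_le {n : ℕ} (j : Fin n) (v : REu n) : |v j| ≤ ‖v‖ := by
  simpa using PiLp.norm_apply_le v j

lemma kerK_meas {n : ℕ} (j : Fin n) (ε : ℝ) : Measurable (kerK j ε) := by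
  unfold kerK
  refine Measurable.ite (measurableSet_le measurable_const measurable_norm) ?_ measurable_const
  exact (rz_coord_meas j).div (measurable_norm.pow_const _)

lemma rz_sub_nice {n : ℕ} {f : REu n → ℝ} (hf : RzNice f) (x : REu n) :
    RzNice (fun z => f (x - z)) := by
  obtain ⟨M, hM0, hM⟩ := hf.bdd
  obtain ⟨R, hR0, hR⟩ := hf.supp
  refine ⟨hf.meas.comp (by fun_prop), ⟨M, hM0, fun s => hM _⟩, ⟨R + ‖x‖, by positivity, ?_⟩⟩
  intro z hz
  apply hR
  have := norm_sub_norm_le z x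
  rw [norm_sub_rev] at this
  linarith

lemma rz_coord_nice {n : ℕ} {f : REu n → ℝ} (hf : RzNice f) (j : Fin n) :
    RzNice (fun z => z j * f z) := by
  obtain ⟨M, hM0, hM⟩ := hf.bdd
  obtain ⟨R, hR0, hR⟩ := hf.supp
  refine ⟨(rz_coord_meas j).mul hf.meas, ⟨R * M, by positivity, fun s => ?_⟩, ⟨R, hR0, ?_⟩⟩
  · rcases le_or_gt ‖s‖ R with h | h
    · rw [abs_mul]
      gcongr
      · exact (rz_coord_le j s).trans h
      · exact hM s
    · rw [hR s h]; simp; positivity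
  · intro z hz; rw [hR z hz, mul_zero]

lemma rz_identity {n : ℕ} (j : Fin n) (ε : ℝ) (hε : 0 < ε) {f : REu n → ℝ} (hf : RzNice f)
    (x : REu n) :
    ∫ v : REu n, (if ‖v‖ ≤ 1 then v j else 0) * rzHv f v ε x =
    ∫ z : REu n, 2 / (n + 1) * (z j / (max ε ‖z‖) ^ (n + 1)) * f (x - z) := by
  have hf' := rz_sub_nice hf x
  obtain ⟨M, hM0, hM⟩ := hf'.bdd
  obtain ⟨R, hR0, hR⟩ := hf'.supp
  have hmv : Measurable (fun v : REu n => (if ‖v‖ ≤ 1 then v j else 0)) :=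
    Measurable.ite (measurableSet_le measurable_norm measurable_const) (rz_coord_meas j)
      measurable_const
  -- first Fubini
  have hF : Integrable (fun a : REu n × ℝ => (if ‖a.1‖ ≤ 1 then a.1 j else 0) *
      ((if ε ≤ |a.2| then a.2⁻¹ else 0) * f (x - a.2 • a.1))) (volume.prod volume) := by
    have hb : Integrable (fun v : REu n => (if ‖v‖ ≤ 1 then M * R else 0)) := by
      have : (fun v : REu n => (if ‖v‖ ≤ 1 then M * R else 0)) =
          Set.indicator (closedBall 0 1) (fun _ => M * R) := by
        ext v; simp [Set.indicator]
      rw [this, integrable_indicator_iff measurableSet_closedBall]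
      exact integrableOn_const measure_closedBall_lt_top.ne
    refine Integrable.mono' (hb.mul_prod (rz_tintble (k := 0) ε hε)) ?_ ?_
    · apply Measurable.aestronglyMeasurable
      refine (hmv.comp measurable_fst).mul (((rzH_meas ε).comp measurable_snd).mul ?_)
      apply hf.meas.comp
      fun_prop
    · refine Eventually.of_forall ?_
      rintro ⟨v, t⟩
      simp only [Real.norm_eq_abs]
      by_cases h1 : ‖v‖ ≤ 1
      · by_cases h2 : ε ≤ |t|
        · rw [if_pos h1, if_pos h2, if_pos h1, if_pos h2]
          have ht : 0 < |t| := hε.trans_le h2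
          rcases le_or_gt ‖t • v‖ R with h3 | h3
          · rw [norm_smul, Real.norm_eq_abs] at h3
            rw [abs_mul, abs_mul, abs_inv]
            have h4 : |v j| ≤ R / |t| := by
              rw [le_div_iff₀ ht]
              have := rz_coord_le j v
              nlinarith
            calc |v j| * (|t|⁻¹ * |f (x - t • v)|) ≤ (R / |t|) * (|t|⁻¹ * M) := by
                  gcongr; exact hM _
              _ = M * R * (|t| ^ (0 + 2))⁻¹ := by rw [zero_add]; field_simp
          · rw [hR _ h3]; simp; positivity
        · rw [if_neg h2, if_neg h2]; simp
      · rw [if_neg h1, if_neg h1]; simp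
  -- second Fubini
  have hG : Integrable (fun a : ℝ × REu n => (if max ε ‖a.2‖ ≤ |a.1| then (|a.1| ^ (n + 2))⁻¹ else 0)
      * (a.2 j * f (x - a.2))) (volume.prod volume) := by
    refine Integrable.mono' (((rz_tintble (k := n) ε hε)).mul_prod (rz_coord_nice hf' j).integrable.norm) ?_ ?_
    · apply Measurable.aestronglyMeasurable
      refine Measurable.mul ?_ ((rz_coord_nice hf' j).meas.comp measurable_snd)
      refine Measurable.ite (measurableSet_le ?_ ?_) ?_ measurable_const
      · fun_prop
      · fun_prop
      · fun_prop
    · refine Eventually.of_forall ?_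
      rintro ⟨t, z⟩
      simp only [norm_mul]
      gcongr
      split_ifs with h1 h2
      · rw [Real.norm_of_nonneg (by positivity)]
      · exact absurd ((le_max_left _ _).trans h1) h2
      · simp
      · simp
  calc ∫ v : REu n, (if ‖v‖ ≤ 1 then v j else 0) * rzHv f v ε x
      = ∫ v : REu n, ∫ t : ℝ, (if ‖v‖ ≤ 1 then v j else 0) *
      ((if ε ≤ |t| then t⁻¹ else 0) * f (x - t • v)) := by
        simp only [rzHv, integral_const_mul]
    _ = ∫ t : ℝ, ∫ v : REu n, (if ‖v‖ ≤ 1 then v j else 0) *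
      ((if ε ≤ |t| then t⁻¹ else 0) * f (x - t • v)) := integral_integral_swap hF
    _ = ∫ t : ℝ, ∫ z : REu n, (if max ε ‖z‖ ≤ |t| then (|t| ^ (n + 2))⁻¹ else 0)
      * (z j * f (x - z)) := by
        congr 1; ext t
        by_cases h2 : ε ≤ |t|
        · have ht : 0 < |t| := hε.trans_le h2
          have ht0 : t ≠ 0 := abs_pos.mp ht
          have := Measure.integral_comp_smul (volume : Measure (REu n))
            (fun z => (if ‖z‖ ≤ |t| then (|t| ^ 2)⁻¹ else 0) * (z j * f (x - z))) t
          rw [smul_eq_mul, ← integral_const_mul] at this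
          refine Eq.trans ?_ (this.trans ?_)
          · congr 1; ext v
            have e : ‖t • v‖ ≤ |t| ↔ ‖v‖ ≤ 1 := by
              rw [norm_smul, Real.norm_eq_abs]
              constructor
              · intro h; by_contra h'; push Not at h'; nlinarith
              · intro h; nlinarith
            simp only [e, if_pos h2, PiLp.smul_apply, smul_eq_mul]
            split_ifs
            · rw [sq_abs]; field_simp
            · simp
          · congr 1; ext z
            have e : max ε ‖z‖ ≤ |t| ↔ ‖z‖ ≤ |t| := by simp [h2]
            simp only [e]
            split_ifs
            · rw [finrank_euclideanSpace_fin, abs_inv, abs_pow, pow_add, mul_inv]; ring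
            · simp
        · have h3 : ∀ z : REu n, ¬ (max ε ‖z‖ ≤ |t|) := fun z h => h2 ((le_max_left _ _).trans h)
          simp [h2, h3]
    _ = ∫ z : REu n, ∫ t : ℝ, (if max ε ‖z‖ ≤ |t| then (|t| ^ (n + 2))⁻¹ else 0)
      * (z j * f (x - z)) := integral_integral_swap hG
    _ = _ := by
        congr 1; ext z
        rw [integral_mul_const, rz_tint _ (lt_max_of_lt_left hε)]
        ring

lemma rz_bdd_int {n : ℕ} {k : REu n → ℝ} (hk : Measurable k) {C : ℝ} (hC : ∀ z, |k z| ≤ C)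
    {f : REu n → ℝ} (hf : RzNice f) (x : REu n) : Integrable (fun z => k z * f (x - z)) := by
  exact (rz_sub_nice hf x).integrable.bdd_mul hk.aestronglyMeasurable (Eventually.of_forall hC)

lemma kerK_bdd {n : ℕ} (j : Fin n) {ε : ℝ} (hε : 0 < ε) (z : REu n) :
    |kerK j ε z| ≤ (ε ^ n)⁻¹ := by
  unfold kerK
  split_ifs with h
  · have hz : 0 < ‖z‖ := hε.trans_le h
    rw [abs_div, abs_pow, abs_norm]
    calc |z j| / ‖z‖ ^ (n + 1) ≤ ‖z‖ / ‖z‖ ^ (n + 1) := by gcongr; exact rz_coord_le j z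
      _ = (‖z‖ ^ n)⁻¹ := by field_simp; ring
      _ ≤ _ := by gcongr
  · simp; positivity

lemma rz_max_bdd {n : ℕ} (j : Fin n) {ε : ℝ} (hε : 0 < ε) (z : REu n) :
    |z j / (max ε ‖z‖) ^ (n + 1)| ≤ (ε ^ n)⁻¹ := by
  have hm : 0 < max ε ‖z‖ := lt_max_of_lt_left hε
  rw [abs_div, abs_of_pos (pow_pos hm _)]
  calc |z j| / (max ε ‖z‖) ^ (n + 1) ≤ max ε ‖z‖ / (max ε ‖z‖) ^ (n + 1) := by
        gcongr; exact (rz_coord_le j z).trans (le_max_right _ _)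
    _ = ((max ε ‖z‖) ^ n)⁻¹ := by field_simp; ring
    _ ≤ _ := by gcongr; exact le_max_left _ _

def rzL {n : ℕ} (j : Fin n) (ε : ℝ) (z : REu n) : ℝ := if ‖z‖ < ε then z j / ε ^ (n + 1) else 0

lemma rzL_meas {n : ℕ} (j : Fin n) (ε : ℝ) : Measurable (rzL j ε) :=
  Measurable.ite (measurableSet_lt measurable_norm measurable_const)
    ((rz_coord_meas j).div_const _) measurable_const

lemma rzL_bdd {n : ℕ} (j : Fin n) {ε : ℝ} (hε : 0 < ε) (z : REu n) :
    |rzL j ε z| ≤ (ε ^ n)⁻¹ := by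
  unfold rzL
  split_ifs with h
  · rw [abs_div, abs_of_pos (pow_pos hε _)]
    calc |z j| / ε ^ (n + 1) ≤ ε / ε ^ (n + 1) := by
          gcongr; exact (rz_coord_le j z).trans h.le
      _ = _ := by field_simp; ring
  · simp; positivity

lemma rz_decomp {n : ℕ} (j : Fin n) (ε : ℝ) (hε : 0 < ε) {f : REu n → ℝ} (hf : RzNice f)
    (x : REu n) : rzT j ε f x =
      ((n : ℝ) + 1) / 2 * (∫ v : REu n, (if ‖v‖ ≤ 1 then v j else 0) * rzHv f v ε x) -
      ∫ z, rzL j ε z * f (x - z) := by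
  have hmm : Measurable (fun z : REu n => z j / (max ε ‖z‖) ^ (n + 1)) := by
    apply (rz_coord_meas j).div
    fun_prop
  rw [rz_identity j ε hε hf x, ← integral_const_mul, ← integral_sub]
  · unfold rzT
    congr 1; ext z
    have : kerK j ε z = z j / (max ε ‖z‖) ^ (n + 1) - rzL j ε z := by
      unfold kerK rzL
      split_ifs with h1 h2 h2
      · exact absurd h1 (not_le.mpr h2)
      · rw [max_eq_right h1]; ring
      · rw [max_eq_left h2.le]; ring
      · exact absurd (not_lt.mp h2) h1
    rw [this]
    have : (n : ℝ) + 1 ≠ 0 := by positivity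
    field_simp
  · have := (rz_bdd_int hmm (rz_max_bdd j hε) hf x)
    convert this using 2 with z
    have : (n : ℝ) + 1 ≠ 0 := by positivity
    field_simp
  · exact rz_bdd_int (rzL_meas j ε) (rzL_bdd j hε) hf x

lemma rzL_L1 {n : ℕ} (j : Fin n) {ε : ℝ} (hε : 0 < ε) :
    ∫⁻ z, ‖rzL j ε z‖ₑ ≤ volume (ball (0 : REu n) 1) := by
  calc ∫⁻ z, ‖rzL j ε z‖ₑ ≤ ∫⁻ z : REu n, Set.indicator (ball 0 ε) (fun _ => ENNReal.ofReal ((ε ^ n)⁻¹)) z := by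
        gcongr with z
        by_cases h : ‖z‖ < ε
        · rw [Set.indicator_of_mem (by simpa using h), ← ofReal_norm]
          exact ENNReal.ofReal_le_ofReal (rzL_bdd j hε z)
        · simp [rzL, h]
    _ = ENNReal.ofReal ((ε ^ n)⁻¹) * volume (ball (0 : REu n) ε) := by
        rw [lintegral_indicator measurableSet_ball, setLIntegral_const]
    _ = _ := by
        rw [Measure.addHaar_ball_of_pos _ _ hε, ← mul_assoc, ← ENNReal.ofReal_mul (by positivity),
          finrank_euclideanSpace_fin, inv_mul_cancel₀ (by positivity)]
        simp

lemma rz_T2 {n : ℕ} (q : ℝ) (h1 : 1 < q) (h2 : q ≤ 2) : ∃ A : ℝ≥0, ∀ (j : Fin n) (f : REu n → ℝ),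
    RzNice f → ∀ ε : ℝ, 0 < ε → ∫⁻ x, ‖rzT j ε f x‖ₑ ^ q ≤ A * ∫⁻ x, ‖f x‖ₑ ^ q := by
  obtain ⟨A, hA⟩ := rz_Hv (n := n) q h1 h2
  have hq0 : 0 < q := by linarith
  set V : ℝ≥0∞ := volume (closedBall (0 : REu n) 1) with hV
  have hVt : V ≠ ⊤ := measure_closedBall_lt_top.ne
  let B : ℝ≥0∞ := 2 ^ (q - 1) * (‖((n : ℝ) + 1) / 2‖ₑ ^ q * (V ^ (q - 1) * (V * A)) + V ^ q)
  have hB : B ≠ ⊤ := by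
    have : (2:ℝ≥0∞) ^ (q - 1) ≠ ⊤ := ENNReal.rpow_ne_top_of_nonneg (by linarith) (by simp)
    have : V ^ (q - 1) ≠ ⊤ := ENNReal.rpow_ne_top_of_nonneg (by linarith) hVt
    have : V ^ q ≠ ⊤ := ENNReal.rpow_ne_top_of_nonneg (by linarith) hVt
    have : ‖((n : ℝ) + 1) / 2‖ₑ ^ q ≠ ⊤ := ENNReal.rpow_ne_top_of_nonneg (by linarith) (by simp)
    finiteness
  refine ⟨B.toNNReal, fun j f hf ε hε => ?_⟩
  rw [ENNReal.coe_toNNReal hB]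
  have hmv : Measurable (fun v : REu n => (if ‖v‖ ≤ 1 then v j else 0)) :=
    Measurable.ite (measurableSet_le measurable_norm measurable_const) (rz_coord_meas j)
      measurable_const
  have hW : ∫⁻ v : REu n, ‖(if ‖v‖ ≤ 1 then v j else 0)‖ₑ ≤ V := by
    calc _ ≤ ∫⁻ v : REu n, Set.indicator (closedBall 0 1) (fun _ => 1) v := by
          gcongr with v
          by_cases h : ‖v‖ ≤ 1
          · rw [Set.indicator_of_mem (by simpa using h), if_pos h, ← ofReal_norm, ← ENNReal.ofReal_one]
            exact ENNReal.ofReal_le_ofReal ((rz_coord_le j v).trans h)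
          · simp [h]
      _ = V := by
          rw [lintegral_indicator measurableSet_closedBall, setLIntegral_const, one_mul]
  have e1 : ∫⁻ x, ‖∫ v : REu n, (if ‖v‖ ≤ 1 then v j else 0) * rzHv f v ε x‖ₑ ^ q ≤
      V ^ (q - 1) * (V * A) * ∫⁻ x, ‖f x‖ₑ ^ q := by
    calc _ ≤ ∫⁻ x, (∫⁻ v : REu n, ‖(if ‖v‖ ≤ 1 then v j else 0)‖ₑ * ‖rzHv f v ε x‖ₑ) ^ q := by
          gcongr with x
          refine (enorm_integral_le_lintegral_enorm _).trans (le_of_eq ?_)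
          congr 1; ext v; rw [enorm_mul]
      _ ≤ (∫⁻ v : REu n, ‖(if ‖v‖ ≤ 1 then v j else 0)‖ₑ) ^ (q - 1) *
          ∫⁻ v : REu n, ‖(if ‖v‖ ≤ 1 then v j else 0)‖ₑ * ∫⁻ x, ‖rzHv f v ε x‖ₑ ^ q := by
          apply rz_minkowski
          all_goals first | exact h1 | exact hmv.enorm | exact (rzHv_meas hf.meas ε).enorm
      _ ≤ V ^ (q - 1) * ∫⁻ v : REu n, ‖(if ‖v‖ ≤ 1 then v j else 0)‖ₑ * (A * ∫⁻ x, ‖f x‖ₑ ^ q) := by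
          refine mul_le_mul' (by gcongr) (lintegral_mono fun v => ?_)
          by_cases hv : v = 0
          · simp [hv]
          · dsimp only; gcongr; exact hA f hf v hv ε hε
      _ = V ^ (q - 1) * ((∫⁻ v : REu n, ‖(if ‖v‖ ≤ 1 then v j else 0)‖ₑ) * (A * ∫⁻ x, ‖f x‖ₑ ^ q)) := by
          rw [lintegral_mul_const _ hmv.enorm]
      _ ≤ V ^ (q - 1) * (V * (A * ∫⁻ x, ‖f x‖ₑ ^ q)) := by gcongr
      _ = _ := by ring
  have e2 : ∫⁻ x, ‖∫ z, rzL j ε z * f (x - z)‖ₑ ^ q ≤ V ^ q * ∫⁻ x, ‖f x‖ₑ ^ q := by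
    calc _ ≤ ∫⁻ x, (∫⁻ z, ‖rzL j ε z‖ₑ * ‖f (x - z)‖ₑ) ^ q := by
          gcongr with x
          refine (enorm_integral_le_lintegral_enorm _).trans (le_of_eq ?_)
          congr 1; ext v; rw [enorm_mul]
      _ ≤ (∫⁻ z, ‖rzL j ε z‖ₑ) ^ q * ∫⁻ x, ‖f x‖ₑ ^ q := 
          rz_young volume (fun z => ‖rzL j ε z‖ₑ) (fun z => ‖f z‖ₑ) (rzL_meas j ε).enorm hf.meas.enorm q h1
      _ ≤ _ := by
          gcongr
          exact (rzL_L1 j hε).trans (measure_mono ball_subset_closedBall)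
  have m1 : Measurable (fun x => ‖∫ v : REu n, (if ‖v‖ ≤ 1 then v j else 0) * rzHv f v ε x‖ₑ) := by
    apply Measurable.enorm
    apply StronglyMeasurable.measurable
    apply StronglyMeasurable.integral_prod_right
      (f := fun (x : REu n) (v : REu n) => (if ‖v‖ ≤ 1 then v j else 0) * rzHv f v ε x)
    apply Measurable.stronglyMeasurable
    exact (hmv.comp measurable_snd).mul ((rzHv_meas hf.meas ε).comp measurable_swap)
  calc ∫⁻ x, ‖rzT j ε f x‖ₑ ^ q ≤ ∫⁻ x, 2 ^ (q - 1) * (‖((n : ℝ) + 1) / 2‖ₑ ^ q *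
        ‖∫ v : REu n, (if ‖v‖ ≤ 1 then v j else 0) * rzHv f v ε x‖ₑ ^ q +
        ‖∫ z, rzL j ε z * f (x - z)‖ₑ ^ q) := by
        gcongr with x
        rw [rz_decomp j ε hε hf x, ← ENNReal.mul_rpow_of_nonneg _ _ hq0.le, ← enorm_mul]
        refine le_trans ?_ (rz_add_rpow _ _ q h1)
        gcongr
        exact enorm_sub_le
    _ = 2 ^ (q - 1) * (‖((n : ℝ) + 1) / 2‖ₑ ^ q *
        (∫⁻ x, ‖∫ v : REu n, (if ‖v‖ ≤ 1 then v j else 0) * rzHv f v ε x‖ₑ ^ q) +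
        ∫⁻ x, ‖∫ z, rzL j ε z * f (x - z)‖ₑ ^ q) := by
        rw [lintegral_const_mul' _ _ (ENNReal.rpow_ne_top_of_nonneg (by linarith) (by simp)),
          lintegral_add_left (by fun_prop),
          lintegral_const_mul' _ _ (ENNReal.rpow_ne_top_of_nonneg (by linarith) (by simp))]
    _ ≤ 2 ^ (q - 1) * (‖((n : ℝ) + 1) / 2‖ₑ ^ q * (V ^ (q - 1) * (V * A) * ∫⁻ x, ‖f x‖ₑ ^ q) +
        V ^ q * ∫⁻ x, ‖f x‖ₑ ^ q) := by gcongr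
    _ = B * ∫⁻ x, ‖f x‖ₑ ^ q := by simp only [B]; ring

lemma kerK_neg {n : ℕ} (j : Fin n) (ε : ℝ) (z : REu n) : kerK j ε (-z) = - kerK j ε z := by
  unfold kerK
  rw [norm_neg]
  split_ifs
  · simp [neg_div]
  · simp

lemma rzT_eq {n : ℕ} (j : Fin n) (ε : ℝ) (f : REu n → ℝ) (x : REu n) :
    rzT j ε f x = ∫ y, kerK j ε (x - y) * f y := by
  rw [← integral_sub_left_eq_self _ volume x]
  simp [rzT]

lemma rzT_int {n : ℕ} (j : Fin n) {ε : ℝ} (hε : 0 < ε) {f : REu n → ℝ} (hf : Integrable f)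
    (x : REu n) : Integrable (fun y => kerK j ε (x - y) * f y) :=
  hf.bdd_mul ((kerK_meas j ε).comp (by fun_prop)).aestronglyMeasurable
    (Eventually.of_forall fun y => kerK_bdd j hε (x - y))

lemma rzT_bdd {n : ℕ} (j : Fin n) {ε : ℝ} (hε : 0 < ε) {f : REu n → ℝ} (hf : Integrable f)
    (x : REu n) : |rzT j ε f x| ≤ (ε ^ n)⁻¹ * ∫ y, |f y| := by
  rw [rzT_eq, ← integral_const_mul]
  refine (norm_integral_le_integral_norm (fun y => kerK j ε (x - y) * f y)).trans ?_
  apply integral_mono_of_nonneg (Eventually.of_forall fun y => norm_nonneg _)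
    (hf.abs.const_mul _)
  refine Eventually.of_forall fun y => ?_
  simp only [norm_mul]
  rw [Real.norm_eq_abs (f y)]
  gcongr
  exact kerK_bdd j hε (x - y)

lemma rzT_meas {n : ℕ} (j : Fin n) (ε : ℝ) {f : REu n → ℝ} (hf : Measurable f) :
    Measurable (rzT j ε f) := by
  unfold rzT
  apply StronglyMeasurable.measurable
  apply StronglyMeasurable.integral_prod_right
    (f := fun (x : REu n) (z : REu n) => kerK j ε z * f (x - z))
  apply Measurable.stronglyMeasurable
  exact ((kerK_meas j ε).comp measurable_snd).mul (hf.comp (by fun_prop))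

lemma rzT_congr {n : ℕ} (j : Fin n) (ε : ℝ) {f g : REu n → ℝ} (h : f =ᵐ[volume] g) :
    rzT j ε f = rzT j ε g := by
  ext x
  rw [rzT_eq, rzT_eq]
  apply integral_congr_ae
  filter_upwards [h] with y hy
  rw [hy]

lemma rzT_anti {n : ℕ} (j : Fin n) {ε : ℝ} (hε : 0 < ε) {f g : REu n → ℝ} (hf : Integrable f)
    (hg : Integrable g) : ∫ x, g x * rzT j ε f x = - ∫ y, f y * rzT j ε g y := by
  have hi : Integrable (fun a : REu n × REu n => g a.1 * (kerK j ε (a.1 - a.2) * f a.2))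
      (volume.prod volume) := by
    have h := (hg.mul_prod hf).bdd_mul (c := (ε ^ n)⁻¹)
      (f := fun a : REu n × REu n => kerK j ε (a.1 - a.2)) 
      ((kerK_meas j ε).comp (by fun_prop)).aestronglyMeasurable
      (Eventually.of_forall fun y => kerK_bdd j hε (y.1 - y.2))
    refine h.congr (Eventually.of_forall fun a => ?_)
    simp only; ring
  simp only [rzT_eq, ← integral_const_mul]
  rw [integral_integral_swap hi, ← integral_neg]
  congr 1; ext y
  rw [← integral_neg]
  congr 1; ext x
  rw [← neg_sub y x, kerK_neg]; ring

lemma rz_enorm_pow (a q : ℝ) (hq : 2 < q) : ‖|a| ^ (q - 2) * a‖ₑ = ‖a‖ₑ ^ (q - 1) := by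
  rw [Real.enorm_eq_ofReal_abs, Real.enorm_eq_ofReal_abs, ENNReal.ofReal_rpow_of_nonneg (abs_nonneg _) (by linarith)]
  congr 1
  rw [abs_mul, abs_of_nonneg (by positivity : 0 ≤ |a| ^ (q - 2)), ← Real.rpow_add_one' (abs_nonneg _) (by linarith)]
  congr 1; ring

lemma rz_T_nice {n : ℕ} (q : ℝ) (h1 : 1 < q) : ∃ A : ℝ≥0, ∀ (j : Fin n) (f : REu n → ℝ),
    RzNice f → ∀ ε : ℝ, 0 < ε → ∫⁻ x, ‖rzT j ε f x‖ₑ ^ q ≤ A * ∫⁻ x, ‖f x‖ₑ ^ q := by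
  rcases le_or_gt q 2 with h2 | h2
  · exact rz_T2 q h1 h2
  have hq0 : 0 < q := by linarith
  have hq1 : 0 < q - 1 := by linarith
  set p : ℝ := q / (q - 1) with hp
  have hp1 : 1 < p := by rw [hp, lt_div_iff₀ hq1]; linarith
  have hp2 : p ≤ 2 := by rw [hp, div_le_iff₀ hq1]; linarith
  have hpq : p.HolderConjugate q := (Real.HolderConjugate.conjExponent h1).symm
  obtain ⟨A, hA⟩ := rz_T2 (n := n) p hp1 hp2
  refine ⟨A ^ (q - 1), fun j f hf ε hε => ?_⟩
  set F := ∫⁻ x, ‖f x‖ₑ ^ q with hF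
  have hTm : Measurable (rzT j ε f) := rzT_meas j ε hf.meas
  obtain ⟨C, hC⟩ : ∃ C : ℝ, ∀ x, |rzT j ε f x| ≤ C := ⟨_, rzT_bdd j hε hf.integrable⟩
  have hC0 : 0 ≤ C := (abs_nonneg _).trans (hC 0)
  have key : ∀ R : ℝ, 0 < R → ∫⁻ x in closedBall 0 R, ‖rzT j ε f x‖ₑ ^ q ≤ (A ^ (q - 1) : ℝ≥0) * F := by
    intro R hR
    set I := ∫⁻ x in closedBall (0 : REu n) R, ‖rzT j ε f x‖ₑ ^ q with hI
    let g : REu n → ℝ := Set.indicator (closedBall 0 R)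
      (fun x => |rzT j ε f x| ^ (q - 2) * rzT j ε f x)
    have hg : RzNice g := by
      refine ⟨?_, ⟨C ^ (q - 2) * C, by positivity, fun x => ?_⟩, ⟨R, hR, fun x hx => ?_⟩⟩
      · apply Measurable.indicator _ measurableSet_closedBall
        exact ((continuous_abs.measurable.comp hTm).pow_const _).mul hTm
      · simp only [g, Set.indicator]
        split_ifs
        · rw [abs_mul, abs_of_nonneg (by positivity)]
          have h3 := hC x
          have h4 : 0 ≤ q - 2 := by linarith
          gcongr
        · simp; positivity
      · simp only [g]
        rw [Set.indicator_of_notMem]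
        simpa using hx
    have hgT : ∀ x, ‖g x * rzT j ε f x‖ₑ = Set.indicator (closedBall 0 R) (fun x => ‖rzT j ε f x‖ₑ ^ q) x := by
      intro x
      simp only [g, Set.indicator]
      split_ifs
      · rw [enorm_mul, rz_enorm_pow _ _ h2]
        nth_rewrite 2 [← ENNReal.rpow_one ‖rzT j ε f x‖ₑ]
        rw [← ENNReal.rpow_add_of_nonneg _ _ hq1.le zero_le_one, sub_add_cancel]
      · simp
    have hgp : ∀ x, ‖g x‖ₑ ^ p = Set.indicator (closedBall 0 R) (fun x => ‖rzT j ε f x‖ₑ ^ q) x := by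
      intro x
      simp only [g, Set.indicator]
      split_ifs
      · rw [rz_enorm_pow _ _ h2, ← ENNReal.rpow_mul]
        congr 1; rw [hp]; field_simp
      · rw [enorm_zero, ENNReal.zero_rpow_of_pos (by linarith)]
    have hnn : ∀ x, 0 ≤ g x * rzT j ε f x := by
      intro x
      simp only [g, Set.indicator]
      split_ifs
      · rw [mul_assoc]; 
        have := mul_self_nonneg (rzT j ε f x)
        positivity
      · simp
    have hIg : ∫⁻ x, ‖g x‖ₑ ^ p = I := by
      simp_rw [hgp]; rw [lintegral_indicator measurableSet_closedBall]
    have hI1 : I = ‖∫ x, g x * rzT j ε f x‖ₑ := by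
      rw [← lintegral_indicator measurableSet_closedBall] at hI
      rw [hI, ← lintegral_congr hgT]
      have hint : Integrable (fun x => g x * rzT j ε f x) :=
        hg.integrable.mul_bdd hTm.aestronglyMeasurable (Eventually.of_forall hC)
      rw [lintegral_enorm_of_nonneg hnn, ← ofReal_integral_eq_lintegral_ofReal hint (Eventually.of_forall hnn),
        Real.enorm_of_nonneg (integral_nonneg hnn)]
    have hIt : I ≠ ⊤ := by rw [hI1]; exact enorm_ne_top
    have hI2 : I ≤ A ^ (1 / p) * I ^ (1 / p) * F ^ (1 / q) := by
      calc I ≤ ∫⁻ y, ‖f y * rzT j ε g y‖ₑ := by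
            rw [hI1, rzT_anti j hε hf.integrable hg.integrable, enorm_neg]
            exact enorm_integral_le_lintegral_enorm _
        _ = ∫⁻ y, ‖rzT j ε g y‖ₑ * ‖f y‖ₑ := by
            congr 1; ext y; rw [enorm_mul, mul_comm]
        _ ≤ (∫⁻ y, ‖rzT j ε g y‖ₑ ^ p) ^ (1 / p) * F ^ (1 / q) :=
            ENNReal.lintegral_mul_le_Lp_mul_Lq volume hpq (rzT_meas j ε hg.meas).enorm.aemeasurable
              hf.meas.enorm.aemeasurable
        _ ≤ (A * ∫⁻ y, ‖g y‖ₑ ^ p) ^ (1 / p) * F ^ (1 / q) := by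
            gcongr; exact hA j g hg ε hε
        _ = _ := by rw [hIg, ENNReal.mul_rpow_of_nonneg _ _ (by positivity)]
    rcases eq_or_ne I 0 with h0 | h0
    · rw [h0]; simp
    have hI3 : I ^ (1 / q) ≤ A ^ (1 / p) * F ^ (1 / q) := by
      have e : I = I ^ (1 / p) * I ^ (1 / q) := by
        rw [← ENNReal.rpow_add _ _ h0 hIt, hpq.one_div_add_one_div, one_div_one, ENNReal.rpow_one]
      have : I ^ (1 / p) * I ^ (1 / q) ≤ I ^ (1 / p) * (A ^ (1 / p) * F ^ (1 / q)) := by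
        rw [← e]; exact hI2.trans (le_of_eq (by ring))
      rwa [ENNReal.mul_le_mul_iff_right] at this
      · exact (ENNReal.rpow_pos (pos_iff_ne_zero.mpr h0) hIt).ne'
      · exact ENNReal.rpow_ne_top_of_nonneg (by positivity) hIt
    have := ENNReal.rpow_le_rpow hI3 hq0.le
    rw [ENNReal.mul_rpow_of_nonneg _ _ hq0.le, ← ENNReal.rpow_mul, ← ENNReal.rpow_mul, ← ENNReal.rpow_mul,
      one_div_mul_cancel hq0.ne', ENNReal.rpow_one, ENNReal.rpow_one] at this
    rw [ENNReal.coe_rpow_of_nonneg _ hq1.le]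
    convert this using 3
    rw [hp]; field_simp
  have hcov : AECover volume atTop (fun R : ℝ => closedBall (0 : REu n) R) :=
    aecover_closedBall tendsto_id
  have ht := hcov.lintegral_tendsto_of_countably_generated (f := fun x => ‖rzT j ε f x‖ₑ ^ q)
    (hTm.enorm.pow_const q).aemeasurable
  exact le_of_tendsto ht (by filter_upwards [eventually_gt_atTop 0] with R hR using key R hR)

lemma rz_T {n : ℕ} (q : ℝ) (h1 : 1 < q) : ∃ A : ℝ≥0, ∀ (j : Fin n) (f : REu n → ℝ),
    Integrable f → ∀ ε : ℝ, 0 < ε → ∫⁻ x, ‖rzT j ε f x‖ₑ ^ q ≤ A * ∫⁻ x, ‖f x‖ₑ ^ q := by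
  obtain ⟨A, hA⟩ := rz_T_nice (n := n) q h1
  have hq0 : 0 < q := by linarith
  have main : ∀ (j : Fin n) (f : REu n → ℝ), Measurable f → 
    Integrable f → ∀ ε : ℝ, 0 < ε → ∫⁻ x, ‖rzT j ε f x‖ₑ ^ q ≤ A * ∫⁻ x, ‖f x‖ₑ ^ q := by
    intro j f hfm hf ε hε
    let u : ℕ → REu n → ℝ := fun N => Set.indicator ({x | |f x| ≤ N} ∩ closedBall 0 N) f
    have hms : ∀ N : ℕ, MeasurableSet ({x | |f x| ≤ N} ∩ closedBall (0 : REu n) N) := fun N =>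
      (measurableSet_le (continuous_abs.measurable.comp hfm) measurable_const).inter
        measurableSet_closedBall
    have hu : ∀ N, RzNice (u N) := by
      intro N
      refine ⟨hfm.indicator (hms N), ⟨N, by positivity, fun x => ?_⟩, ⟨N + 1, by positivity, fun x hx => ?_⟩⟩
      · simp only [u, Set.indicator]
        split_ifs with h
        · exact h.1
        · simp
      · simp only [u]
        apply Set.indicator_of_notMem
        rintro ⟨-, h⟩
        rw [mem_closedBall_zero_iff] at h
        linarith
    have hle : ∀ N x, ‖u N x‖ ≤ ‖f x‖ := fun N x => norm_indicator_le_norm_self _ _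
    have hlim : ∀ x, Tendsto (fun N => u N x) atTop (nhds (f x)) := by
      intro x
      apply tendsto_const_nhds.congr'
      filter_upwards [eventually_ge_atTop ⌈|f x|⌉₊, eventually_ge_atTop ⌈‖x‖⌉₊] with N h1 h2
      simp only [u]
      rw [Set.indicator_of_mem]
      refine ⟨(Nat.le_ceil _).trans (Nat.cast_le.mpr h1), ?_⟩
      rw [mem_closedBall_zero_iff]
      exact (Nat.le_ceil _).trans (Nat.cast_le.mpr h2)
    have hT : ∀ x, Tendsto (fun N => rzT j ε (u N) x) atTop (nhds (rzT j ε f x)) := by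
      intro x
      simp only [rzT_eq]
      apply tendsto_integral_of_dominated_convergence (fun y => ‖kerK j ε (x - y) * f y‖)
      · intro N; exact (rzT_int j hε (hu N).integrable x).aestronglyMeasurable
      · exact (rzT_int j hε hf x).norm
      · intro N; refine Eventually.of_forall fun y => ?_
        rw [norm_mul, norm_mul]; gcongr; exact hle N y
      · exact Eventually.of_forall fun y => (hlim y).const_mul _
    calc ∫⁻ x, ‖rzT j ε f x‖ₑ ^ q = ∫⁻ x, liminf (fun N => ‖rzT j ε (u N) x‖ₑ ^ q) atTop := by
          congr 1; ext x
          refine (Tendsto.liminf_eq ?_).symm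
          exact ((ENNReal.continuous_rpow_const.tendsto _).comp (hT x).enorm)
      _ ≤ liminf (fun N => ∫⁻ x, ‖rzT j ε (u N) x‖ₑ ^ q) atTop :=
          lintegral_liminf_le fun N => (rzT_meas j ε (hu N).meas).enorm.pow_const q
      _ ≤ liminf (fun N : ℕ => A * ∫⁻ x, ‖f x‖ₑ ^ q) atTop := by
          refine liminf_le_liminf (Eventually.of_forall fun N => ?_)
          refine (hA j (u N) (hu N) ε hε).trans ?_
          gcongr with x
          exact enorm_le_iff_norm_le.mpr (hle N x)
      _ = _ := by simp
  refine ⟨A, fun j f hf ε hε => ?_⟩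
  have hfm := hf.aestronglyMeasurable.aemeasurable
  rw [rzT_congr j ε hfm.ae_eq_mk]
  refine (main j _ hfm.measurable_mk (hf.congr hfm.ae_eq_mk) ε hε).trans (le_of_eq ?_)
  congr 1
  apply lintegral_congr_ae
  filter_upwards [hfm.ae_eq_mk] with x hx
  rw [← hx]

lemma rz_complete {X : Type*} [MeasurableSpace X] {μ : Measure X} {p : ℝ≥0∞} (hp : 1 ≤ p)
    (F : ℝ → X → ℝ) (hF : ∀ ε > 0, MemLp (F ε) p μ)
    (hc : ∀ η : ℝ, 0 < η → ∃ ε0 > 0, ∀ ε ε', 0 < ε → ε < ε0 → 0 < ε' → ε' < ε0 →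
      eLpNorm (fun x => F ε x - F ε' x) p μ ≤ ENNReal.ofReal η) :
    ∃ g, MemLp g p μ ∧ Tendsto (fun ε => eLpNorm (fun x => F ε x - g x) p μ)
      (nhdsWithin 0 (Set.Ioi 0)) (nhds 0) := by
  have : Fact (1 ≤ p) := ⟨hp⟩
  classical
  let u : ℝ → Lp ℝ p μ := fun ε => if h : 0 < ε then (hF ε h).toLp (F ε) else 0
  have hu : ∀ ε (h : 0 < ε), u ε = (hF ε h).toLp (F ε) := fun ε h => dif_pos h
  have hcau : Cauchy (Filter.map u (nhdsWithin 0 (Set.Ioi 0))) := by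
    rw [Metric.cauchy_iff]
    refine ⟨inferInstance, fun η hη => ?_⟩
    obtain ⟨ε0, h0, h⟩ := hc (η / 2) (by positivity)
    refine ⟨u '' Set.Ioo 0 ε0, image_mem_map (Ioo_mem_nhdsGT h0), ?_⟩
    rintro _ ⟨a, ha, rfl⟩ _ ⟨b, hb, rfl⟩
    rw [hu a ha.1, hu b hb.1, Lp.dist_edist, Lp.edist_toLp_toLp]
    refine lt_of_le_of_lt (ENNReal.toReal_mono ENNReal.ofReal_ne_top (h a b ha.1 ha.2 hb.1 hb.2)) ?_
    rw [ENNReal.toReal_ofReal (by positivity)]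
    linarith
  obtain ⟨G, hG⟩ := cauchy_map_iff_exists_tendsto.mp hcau
  refine ⟨G, Lp.memLp G, ?_⟩
  have h1 := tendsto_iff_edist_tendsto_0.mp hG
  refine h1.congr' ?_
  filter_upwards [self_mem_nhdsWithin] with ε hε
  rw [hu ε hε, Lp.edist_def]
  apply eLpNorm_congr_ae
  filter_upwards [(hF ε hε).coeFn_toLp] with x hx
  simp [hx]

lemma rz_eLpNorm_eq {X : Type*} [MeasurableSpace X] {μ : Measure X} {q : ℝ} (hq : 1 < q)
    (f : X → ℝ) : eLpNorm f (ENNReal.ofReal q) μ = (∫⁻ x, ‖f x‖ₑ ^ q ∂μ) ^ (1 / q) := by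
  rw [eLpNorm_eq_lintegral_rpow_enorm_toReal (by simp; linarith) ENNReal.ofReal_ne_top,
    ENNReal.toReal_ofReal (by linarith)]

lemma rz_Tn {n : ℕ} (q : ℝ) (h1 : 1 < q) : ∃ A : ℝ≥0, ∀ (j : Fin n) (f : REu n → ℝ),
    Integrable f → ∀ ε : ℝ, 0 < ε → eLpNorm (rzT j ε f) (ENNReal.ofReal q) volume ≤
      A * eLpNorm f (ENNReal.ofReal q) volume := by
  obtain ⟨A, hA⟩ := rz_T (n := n) q h1
  have hq : 0 ≤ 1 / q := by have : 0 < q := by linarith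
                            positivity
  refine ⟨A ^ (1 / q), fun j f hf ε hε => ?_⟩
  rw [rz_eLpNorm_eq h1, rz_eLpNorm_eq h1, ENNReal.coe_rpow_of_nonneg _ hq,
    ← ENNReal.mul_rpow_of_nonneg _ _ hq]
  exact ENNReal.rpow_le_rpow (hA j f hf ε hε) hq

lemma rzT_aesm {n : ℕ} (j : Fin n) (ε : ℝ) {f : REu n → ℝ} (hf : Integrable f) :
    Measurable (rzT j ε f) := by
  have hfm := hf.aestronglyMeasurable.aemeasurable
  rw [rzT_congr j ε hfm.ae_eq_mk]
  exact rzT_meas j ε hfm.measurable_mk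

lemma rzT_sub {n : ℕ} (j : Fin n) {ε : ℝ} (hε : 0 < ε) {f g : REu n → ℝ} (hf : Integrable f)
    (hg : Integrable g) (x : REu n) :
    rzT j ε (fun y => f y - g y) x = rzT j ε f x - rzT j ε g x := by
  simp only [rzT_eq]
  rw [← integral_sub (rzT_int j hε hf x) (rzT_int j hε hg x)]
  congr 1; ext y; ring

lemma kerK_diff_zero {n : ℕ} (j : Fin n) (ε ε' : ℝ) :
    ∫ z : REu n, (kerK j ε z - kerK j ε' z) = 0 := by
  have h := integral_neg_eq_self (fun z : REu n => kerK j ε z - kerK j ε' z) volume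
  have h2 : ∫ z : REu n, (kerK j ε (-z) - kerK j ε' (-z)) = - ∫ z : REu n, (kerK j ε z - kerK j ε' z) := by
    rw [← integral_neg]
    congr 1; ext z; rw [kerK_neg, kerK_neg]; ring
  rw [h2] at h
  linarith

lemma kerK_le {n : ℕ} (j : Fin n) (ε : ℝ) (z : REu n) : |kerK j ε z| ≤ (‖z‖ ^ n)⁻¹ := by
  unfold kerK
  split_ifs with h
  · rcases eq_or_ne z 0 with hz | hz
    · simp [hz]; 
    have hz : 0 < ‖z‖ := norm_pos_iff.mpr hz
    rw [abs_div, abs_pow, abs_norm]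
    calc |z j| / ‖z‖ ^ (n + 1) ≤ ‖z‖ / ‖z‖ ^ (n + 1) := by gcongr; exact rz_coord_le j z
      _ = (‖z‖ ^ n)⁻¹ := by field_simp; ring
  · simp; 

lemma kerK_diff_le {n : ℕ} (j : Fin n) {ε ε' ε0 : ℝ} (h : ε < ε0) (h' : ε' < ε0) (z : REu n) :
    |kerK j ε z - kerK j ε' z| ≤ Set.indicator (ball 0 ε0) (fun z => (‖z‖ ^ n)⁻¹) z := by
  by_cases hz : ‖z‖ < ε0
  · rw [Set.indicator_of_mem (by simpa using hz)]
    have := kerK_le j 0 z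
    unfold kerK at this ⊢
    rw [if_pos (norm_nonneg z)] at this
    have h0 : 0 ≤ (‖z‖ ^ n)⁻¹ := by positivity
    split_ifs
    · simpa using h0
    · simpa using this
    · simpa using this
    · simpa using h0
  · push Not at hz
    rw [Set.indicator_of_notMem (by simpa using hz)]
    unfold kerK
    rw [if_pos (by linarith), if_pos (by linarith)]
    simp

lemma kerK_diff_int {n : ℕ} (j : Fin n) {ε ε' : ℝ} (h : 0 < ε) (h' : 0 < ε') :
    Integrable (fun z : REu n => kerK j ε z - kerK j ε' z) := by
  have hi : Integrable (Set.indicator (ball (0 : REu n) (max ε ε' + 1)) (fun _ => (ε ^ n)⁻¹ + (ε' ^ n)⁻¹)) := by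
    rw [integrable_indicator_iff measurableSet_ball]
    exact integrableOn_const measure_ball_lt_top.ne
  refine hi.mono' ((kerK_meas j ε).sub (kerK_meas j ε')).aestronglyMeasurable (Eventually.of_forall fun z => ?_)
  by_cases hz : z ∈ ball (0 : REu n) (max ε ε' + 1)
  · rw [Set.indicator_of_mem hz]
    exact (abs_sub _ _).trans (add_le_add (kerK_bdd j h z) (kerK_bdd j h' z))
  · have := kerK_diff_le j (ε := ε) (ε' := ε') (ε0 := max ε ε' + 1) (by linarith [le_max_left ε ε'])
      (by linarith [le_max_right ε ε']) z
    rw [Set.indicator_of_notMem hz] at this ⊢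
    exact this

lemma rz_om_int {n : ℕ} (j : Fin n) : IntegrableOn (fun z : REu n => ‖z‖ * (‖z‖ ^ n)⁻¹) (ball 0 1) := by
  obtain ⟨m, rfl⟩ : ∃ m, n = m + 1 := ⟨n - 1, by have := j.pos; omega⟩
  have : Nontrivial (REu (m + 1)) := inferInstance
  rw [integrableOn_fun_norm_addHaar (volume : Measure (REu (m+1))) (f := fun y => y * (y ^ (m+1))⁻¹)]
  rw [finrank_euclideanSpace_fin]
  have : IntegrableOn (fun _ : ℝ => (1:ℝ)) (Set.Ioo 0 1) := integrableOn_const (by simp)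
  refine this.congr_fun ?_ measurableSet_Ioo
  intro y hy
  have := hy.1
  simp only [smul_eq_mul, Nat.add_sub_cancel]
  field_simp; ring

def rzom (n : ℕ) (ε : ℝ) : ℝ := ∫ z in ball (0 : REu n) ε, ‖z‖ * (‖z‖ ^ n)⁻¹

lemma rzom_tendsto {n : ℕ} (j : Fin n) : Tendsto (rzom n) (nhdsWithin 0 (Set.Ioi 0)) (nhds 0) := by
  have hi := rz_om_int j
  have : Tendsto (fun ε => ∫ z in ball (0 : REu n) ε, ‖z‖ * (‖z‖ ^ n)⁻¹ ∂(volume.restrict (ball 0 1)))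
      (nhdsWithin 0 (Set.Ioi 0)) (nhds 0) := by
    apply Integrable.tendsto_setIntegral_nhds_zero hi
    have h1 : Tendsto (fun ε : ℝ => ENNReal.ofReal (ε ^ n) * volume (ball (0 : REu n) 1)) 
        (nhdsWithin 0 (Set.Ioi 0)) (nhds 0) := by
      have h2 : Tendsto (fun ε : ℝ => ENNReal.ofReal (ε ^ n)) (nhdsWithin 0 (Set.Ioi 0)) (nhds 0) := by
        rw [← ENNReal.ofReal_zero]
        apply ENNReal.tendsto_ofReal
        have : Tendsto (fun ε : ℝ => ε ^ n) (nhds 0) (nhds (0 ^ n)) := (continuous_pow n).tendsto 0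
        rw [zero_pow (by have := j.pos; omega)] at this
        exact this.mono_left nhdsWithin_le_nhds
      have := ENNReal.Tendsto.mul_const h2 (b := volume (ball (0 : REu n) 1)) (Or.inr measure_ball_lt_top.ne)
      simpa using this
    refine tendsto_of_tendsto_of_tendsto_of_le_of_le' tendsto_const_nhds h1 (by simp) ?_
    filter_upwards [self_mem_nhdsWithin] with ε hε
    refine (Measure.restrict_apply_le _ _).trans ?_
    rw [Measure.addHaar_ball_of_pos _ _ hε, finrank_euclideanSpace_fin]
  refine this.congr' ?_
  filter_upwards [Ioo_mem_nhdsGT (zero_lt_one)] with ε hε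
  rw [Measure.restrict_restrict measurableSet_ball, Set.inter_eq_left.mpr (ball_subset_ball hε.2.le)]
  rfl

lemma rz_smooth {n : ℕ} (j : Fin n) {φ : REu n → ℝ} {L : ℝ≥0} (hφ : LipschitzWith L φ)
    {R : ℝ} (hR : ∀ x, R < ‖x‖ → φ x = 0) (hi : Integrable φ) {ε ε' ε0 : ℝ} (h : 0 < ε) (h0 : ε < ε0)
    (h' : 0 < ε') (h0' : ε' < ε0) (h1 : ε0 ≤ 1) (x : REu n) :
    |rzT j ε φ x - rzT j ε' φ x| ≤ Set.indicator (ball 0 (R + 2)) (fun _ => L * rzom n ε0) x := by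
  have hint : ∀ ε > 0, Integrable (fun z => kerK j ε z * φ (x - z)) := by
    intro ε hε
    have := (integrable_comp_sub_left (fun y => kerK j ε (x - y) * φ y) x).mpr (rzT_int j hε hi x)
    simpa using this
  have e : rzT j ε φ x - rzT j ε' φ x = ∫ z, (kerK j ε z - kerK j ε' z) * φ (x - z) := by
    unfold rzT
    rw [← integral_sub (hint ε h) (hint ε' h')]
    congr 1; ext z; ring
  by_cases hx : ‖x‖ < R + 2
  · rw [Set.indicator_of_mem (by simpa using hx)]
    have e2 : rzT j ε φ x - rzT j ε' φ x = ∫ z, (kerK j ε z - kerK j ε' z) * (φ (x - z) - φ x) := by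
      rw [e]
      have : ∫ z, (kerK j ε z - kerK j ε' z) * φ x = 0 := by
        rw [integral_mul_const, kerK_diff_zero, zero_mul]
      rw [← sub_zero (∫ z, (kerK j ε z - kerK j ε' z) * φ (x - z)), ← this, ← integral_sub]
      · congr 1; ext z; ring
      · refine ((hint ε h).sub (hint ε' h')).congr (Eventually.of_forall fun z => ?_)
        simp only [Pi.sub_apply]; ring
      · exact (kerK_diff_int j h h').mul_const _
    rw [e2]
    have hi2 : Integrable (Set.indicator (ball (0 : REu n) ε0) (fun z => L * (‖z‖ * (‖z‖ ^ n)⁻¹))) := by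
      rw [integrable_indicator_iff measurableSet_ball]
      exact ((rz_om_int j).mono_set (ball_subset_ball h1)).const_mul _
    refine (norm_integral_le_of_norm_le (f := fun z => (kerK j ε z - kerK j ε' z) * (φ (x - z) - φ x)) hi2 (Eventually.of_forall fun z => ?_)).trans (le_of_eq ?_)
    · have hk := kerK_diff_le j h0 h0' z
      rw [norm_mul, Real.norm_eq_abs]
      by_cases hz : z ∈ ball (0 : REu n) ε0
      · rw [Set.indicator_of_mem hz] at hk ⊢
        have hl := hφ.norm_sub_le (x - z) x
        rw [show x - z - x = -z by abel, norm_neg] at hl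
        calc _ ≤ (‖z‖ ^ n)⁻¹ * (L * ‖z‖) := by gcongr
          _ = _ := by ring
      · rw [Set.indicator_of_notMem hz] at hk ⊢
        rw [le_antisymm hk (abs_nonneg _), zero_mul]
    · rw [integral_indicator measurableSet_ball, integral_const_mul, rzom]
  · push Not at hx
    rw [Set.indicator_of_notMem (by simpa using hx), e]
    apply le_of_eq
    rw [abs_eq_zero]
    rw [← integral_zero (REu n) ℝ]
    congr 1; ext z
    by_cases hz : z ∈ ball (0 : REu n) ε0
    · rw [mem_ball_zero_iff] at hz
      rw [hR (x - z), mul_zero]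
      have := norm_sub_norm_le x z
      linarith
    · have hk := kerK_diff_le j h0 h0' z
      rw [Set.indicator_of_notMem hz] at hk
      rw [abs_eq_zero.mp (le_antisymm hk (abs_nonneg _)), zero_mul]

lemma rz_Tlim {n : ℕ} (q : ℝ) (h1 : 1 < q) (j : Fin n) {h : REu n → ℝ} (hi : Integrable h)
    (hh : MemLp h (ENNReal.ofReal q) volume) : ∃ g, MemLp g (ENNReal.ofReal q) volume ∧
      Tendsto (fun ε => eLpNorm (fun x => rzT j ε h x - g x) (ENNReal.ofReal q) volume)
      (nhdsWithin 0 (Set.Ioi 0)) (nhds 0) := by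
  have hp : 1 ≤ ENNReal.ofReal q := by
    rw [← ENNReal.ofReal_one]; exact ENNReal.ofReal_le_ofReal h1.le
  obtain ⟨A, hA⟩ := rz_Tn (n := n) q h1
  apply rz_complete hp (fun ε => rzT j ε h)
  · intro ε hε
    refine ⟨(rzT_aesm j ε hi).aestronglyMeasurable, (hA j h hi ε hε).trans_lt ?_⟩
    exact ENNReal.mul_lt_top ENNReal.coe_lt_top hh.2
  intro η hη
  obtain ⟨φ, hφ1, hφ2, hφ3⟩ := hh.exist_eLpNorm_sub_le ENNReal.ofReal_ne_top hp
    (ε := η / (3 * (A + 1))) (by positivity)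
  have hφi : Integrable φ := hφ2.continuous.integrable_of_hasCompactSupport hφ1
  obtain ⟨L, hL⟩ := ContDiff.lipschitzWith_of_hasCompactSupport hφ1 hφ2 (by simp)
  obtain ⟨R, hR⟩ := hφ1.isCompact.isBounded.subset_closedBall (0 : REu n)
  have hR' : ∀ x, R < ‖x‖ → φ x = 0 := by
    intro x hx
    by_contra h0
    have := hR (subset_tsupport φ h0)
    rw [mem_closedBall_zero_iff] at this
    linarith
  set V : ℝ≥0∞ := volume (ball (0 : REu n) (R + 2)) ^ (1 / (ENNReal.ofReal q).toReal) with hV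
  have hVt : V ≠ ⊤ := ENNReal.rpow_ne_top_of_nonneg (by positivity) measure_ball_lt_top.ne
  have ht : Tendsto (fun ε => V * ENNReal.ofReal (L * rzom n ε)) (nhdsWithin 0 (Set.Ioi 0)) (nhds 0) := by
    have := (rzom_tendsto j).const_mul (L : ℝ)
    have := ENNReal.tendsto_ofReal this
    have := ENNReal.Tendsto.const_mul this (a := V) (Or.inr hVt)
    simpa using this
  have hη3 : (0 : ℝ≥0∞) < ENNReal.ofReal (η / 3) := by simp [hη]
  have hev := (ht.eventually (gt_mem_nhds hη3)).and (Ioo_mem_nhdsGT (zero_lt_one))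
  obtain ⟨ε0, hε1, hε01⟩ := hev.exists
  refine ⟨ε0, hε01.1, fun ε ε' he he0 he' he0' => ?_⟩
  have hb : eLpNorm (fun x => rzT j ε φ x - rzT j ε' φ x) (ENNReal.ofReal q) volume ≤ ENNReal.ofReal (η / 3) := by
    calc _ ≤ eLpNorm (Set.indicator (ball (0 : REu n) (R + 2)) (fun _ => L * rzom n ε0)) (ENNReal.ofReal q) volume :=
          eLpNorm_mono_real fun x => rz_smooth j hL hR' hφi he he0 he' he0' hε01.2.le x
      _ ≤ ‖L * rzom n ε0‖ₑ * V := eLpNorm_indicator_const_le _ _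
      _ = V * ENNReal.ofReal (L * rzom n ε0) := by
          rw [mul_comm, Real.enorm_of_nonneg]
          have : 0 ≤ rzom n ε0 := integral_nonneg fun z => by positivity
          positivity
      _ ≤ _ := hε1.le
  have hd : ∀ e : ℝ, 0 < e → eLpNorm (rzT j e (fun y => h y - φ y)) (ENNReal.ofReal q) volume ≤ ENNReal.ofReal (η / 3) := by
    intro e he
    refine (hA j _ (hi.sub hφi) e he).trans ?_
    calc _ ≤ (A : ℝ≥0∞) * ENNReal.ofReal (η / (3 * (A + 1))) := by gcongr
      _ = ENNReal.ofReal (A * (η / (3 * (A + 1)))) := by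
          rw [ENNReal.ofReal_mul (by positivity), ENNReal.ofReal_coe_nnreal]
      _ ≤ _ := by
          apply ENNReal.ofReal_le_ofReal
          have hA1 : (0:ℝ) < A + 1 := by positivity
          rw [mul_div_assoc', div_le_div_iff₀ (by positivity) (by positivity)]
          nlinarith
  have hm : ∀ e : ℝ, AEStronglyMeasurable (rzT j e (fun y => h y - φ y)) volume := fun e =>
    (rzT_aesm j e (hi.sub hφi)).aestronglyMeasurable
  have hm2 : ∀ e : ℝ, AEStronglyMeasurable (rzT j e φ) volume := fun e =>
    (rzT_aesm j e hφi).aestronglyMeasurable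
  calc eLpNorm (fun x => rzT j ε h x - rzT j ε' h x) (ENNReal.ofReal q) volume
      = eLpNorm ((rzT j ε (fun y => h y - φ y) - rzT j ε' (fun y => h y - φ y)) + 
          (fun x => rzT j ε φ x - rzT j ε' φ x)) (ENNReal.ofReal q) volume := by
        congr 1; ext x
        simp only [Pi.add_apply, Pi.sub_apply]
        rw [rzT_sub j he hi hφi, rzT_sub j he' hi hφi]; ring
    _ ≤ (eLpNorm (rzT j ε (fun y => h y - φ y)) (ENNReal.ofReal q) volume + 
          eLpNorm (rzT j ε' (fun y => h y - φ y)) (ENNReal.ofReal q) volume) + 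
          eLpNorm (fun x => rzT j ε φ x - rzT j ε' φ x) (ENNReal.ofReal q) volume := by
        refine (eLpNorm_add_le ((hm ε).sub (hm ε')) ((hm2 ε).sub (hm2 ε')) hp).trans ?_
        exact add_le_add (eLpNorm_sub_le (hm ε) (hm ε') hp) le_rfl
    _ ≤ (ENNReal.ofReal (η / 3) + ENNReal.ofReal (η / 3)) + ENNReal.ofReal (η / 3) := by
        gcongr
        · exact hd ε he
        · exact hd ε' he'
    _ = ENNReal.ofReal η := by
        rw [← ENNReal.ofReal_add (by positivity) (by positivity), ← ENNReal.ofReal_add (by positivity) (by positivity)]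
        congr 1; ring

def rzv (n : ℕ) : ℝ := (volume (ball (0 : REu n) 1)).toReal

lemma rzv_pos (n : ℕ) : 0 < rzv n :=
  ENNReal.toReal_pos (measure_ball_pos _ _ one_pos).ne' measure_ball_lt_top.ne

lemma rz_vol {n : ℕ} (x : REu n) {r : ℝ} (hr : 0 < r) :
    volume (ball x r) = ENNReal.ofReal (rzv n * r ^ n) := by
  rw [Measure.addHaar_ball_of_pos _ _ hr, finrank_euclideanSpace_fin, mul_comm (rzv n),
    ENNReal.ofReal_mul (by positivity), rzv, ENNReal.ofReal_toReal measure_ball_lt_top.ne]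

lemma rz_vol' {n : ℕ} (x : REu n) {r : ℝ} (hr : 0 < r) :
    (volume (ball x r)).toReal = rzv n * r ^ n := by
  rw [rz_vol x hr, ENNReal.toReal_ofReal]
  have := rzv_pos n
  positivity

/-- dyadic summation lemma -/
lemma rz_dyadic {n : ℕ} (x : REu n) {r : ℝ} (hr : 0 < r) (h : REu n → ℝ)
    (hm : AEStronglyMeasurable h volume) (m : ℕ) (M θ : ℝ) (hM : 0 ≤ M) (hθ : θ < 0)
    (H : ∀ k : ℕ, ∫⁻ y in ball x (2 ^ (k + 1) * r), ‖h y‖ₑ ≤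
      ENNReal.ofReal (M * (2 ^ k * r) ^ m * (2 ^ θ) ^ k)) :
    ∫⁻ y in (ball x r)ᶜ, ‖h y‖ₑ * ENNReal.ofReal ((‖x - y‖ ^ m)⁻¹) ≤
      ENNReal.ofReal (M * (1 - 2 ^ θ)⁻¹) := by
  have h2 : (2:ℝ) ^ θ < 1 := Real.rpow_lt_one_of_one_lt_of_neg one_lt_two hθ
  have h20 : (0:ℝ) < 2 ^ θ := by positivity
  calc ∫⁻ y in (ball x r)ᶜ, ‖h y‖ₑ * ENNReal.ofReal ((‖x - y‖ ^ m)⁻¹)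
      ≤ ∫⁻ y, ∑' k : ℕ, Set.indicator (ball x (2 ^ (k + 1) * r))
          (fun y => ‖h y‖ₑ * ENNReal.ofReal (((2 ^ k * r) ^ m)⁻¹)) y := by
        rw [← lintegral_indicator measurableSet_ball.compl]
        apply lintegral_mono
        intro y
        by_cases hy : y ∈ (ball x r)ᶜ
        · rw [Set.indicator_of_mem hy]
          rw [Set.mem_compl_iff, mem_ball, not_lt, dist_comm, dist_eq_norm] at hy
          obtain ⟨k, hk1, hk2⟩ := exists_nat_pow_near (x := ‖x - y‖ / r) (y := 2)
            (by rwa [le_div_iff₀ hr, one_mul]) one_lt_two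
          rw [le_div_iff₀ hr] at hk1
          rw [div_lt_iff₀ hr] at hk2
          refine le_trans ?_ (ENNReal.le_tsum k)
          rw [Set.indicator_of_mem (by rwa [mem_ball, dist_comm, dist_eq_norm])]
          gcongr
        · rw [Set.indicator_of_notMem hy]; exact zero_le
    _ = ∑' k : ℕ, (∫⁻ y in ball x (2 ^ (k + 1) * r), ‖h y‖ₑ) * ENNReal.ofReal (((2 ^ k * r) ^ m)⁻¹) := by
        rw [lintegral_tsum]
        · congr 1; ext k
          rw [lintegral_indicator measurableSet_ball, lintegral_mul_const' _ _ ENNReal.ofReal_ne_top]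
        · intro k
          exact (hm.enorm.mul_const _).indicator measurableSet_ball
    _ ≤ ∑' k : ℕ, ENNReal.ofReal (M * (2 ^ θ) ^ k) := by
        gcongr with k
        refine (mul_le_mul' (H k) le_rfl).trans (le_of_eq ?_)
        rw [← ENNReal.ofReal_mul (by positivity)]
        congr 1
        have : (2 ^ k * r) ^ m ≠ 0 := by positivity
        field_simp
    _ = ENNReal.ofReal (∑' k : ℕ, M * (2 ^ θ) ^ k) := by
        rw [ENNReal.ofReal_tsum_of_nonneg (fun k => by positivity)]
        exact (summable_geometric_of_lt_one h20.le h2).mul_left _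
    _ = _ := by rw [tsum_mul_left, tsum_geometric_of_lt_one h20.le h2]

/-- kernel smoothness -/
lemma rz_kdiff {n : ℕ} (j : Fin n) {a b : REu n} (hab : 2 * ‖a - b‖ ≤ ‖b‖) (hb : b ≠ 0) :
    |kerK j 0 a - kerK j 0 b| ≤ ((n : ℝ) + 2) * 4 ^ (n + 1) * ‖a - b‖ / ‖b‖ ^ (n + 1) := by
  have hB : 0 < ‖b‖ := norm_pos_iff.mpr hb
  have h1 : ‖b‖ ≤ ‖a‖ + ‖a - b‖ := by
    have := norm_sub_norm_le b a
    rw [norm_sub_rev] at this; linarith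
  have h2 : ‖a‖ ≤ ‖b‖ + ‖a - b‖ := by
    have := norm_sub_norm_le a b; linarith
  have hA : ‖b‖ / 2 ≤ ‖a‖ := by linarith
  have hA0 : 0 < ‖a‖ := by linarith
  unfold kerK
  rw [if_pos (norm_nonneg _), if_pos (norm_nonneg _)]
  set d := ‖a - b‖
  have hd0 : 0 ≤ d := norm_nonneg _
  set s := ‖a‖
  set t := ‖b‖
  have e : a j / s ^ (n + 1) - b j / t ^ (n + 1) =
      (a j - b j) / s ^ (n + 1) + b j * (t ^ (n + 1) - s ^ (n + 1)) / (s ^ (n + 1) * t ^ (n + 1)) := by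
    field_simp; ring
  have hs : (s ^ (n + 1))⁻¹ ≤ 2 ^ (n + 1) / t ^ (n + 1) := by
    rw [← div_pow, ← inv_pow]
    gcongr
    rw [inv_le_comm₀ hA0 (by positivity), inv_div]; exact hA
  have i1 : |(a j - b j) / s ^ (n + 1)| ≤ 2 ^ (n + 1) * d / t ^ (n + 1) := by
    rw [abs_div, abs_of_pos (by positivity : 0 < s ^ (n + 1)), div_eq_mul_inv]
    calc |a j - b j| * (s ^ (n + 1))⁻¹ ≤ d * (2 ^ (n + 1) / t ^ (n + 1)) := by
          gcongr
          exact rz_coord_le j (a - b)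
      _ = _ := by ring
  have i2 : |t ^ (n + 1) - s ^ (n + 1)| ≤ d * (n + 1) * (2 * t) ^ n := by
    have := abs_pow_sub_pow_le t s (n + 1)
    refine this.trans ?_
    push_cast
    rw [abs_of_pos hB, abs_of_pos hA0]
    gcongr
    · rw [abs_sub_le_iff]; constructor <;> linarith
    · rw [max_le_iff]; constructor <;> linarith
  have i3 : |b j * (t ^ (n + 1) - s ^ (n + 1)) / (s ^ (n + 1) * t ^ (n + 1))| ≤
      (n + 1) * 4 ^ (n + 1) * d / t ^ (n + 1) := by
    rw [abs_div, abs_mul, abs_of_pos (by positivity : 0 < s ^ (n + 1) * t ^ (n + 1)), div_eq_mul_inv, mul_inv]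
    calc |b j| * |t ^ (n + 1) - s ^ (n + 1)| * ((s ^ (n + 1))⁻¹ * (t ^ (n + 1))⁻¹)
        ≤ t * (d * (n + 1) * (2 * t) ^ n) * ((2 ^ (n + 1) / t ^ (n + 1)) * (t ^ (n + 1))⁻¹) := by
          gcongr
          exact rz_coord_le j b
      _ = (n + 1) * (2 ^ n * 2 ^ (n + 1)) * d / t ^ (n + 1) := by
          rw [mul_pow]; field_simp; ring
      _ ≤ _ := by
          gcongr
          rw [show (4:ℝ) = 2 * 2 by norm_num, mul_pow]
          gcongr <;> norm_num
  rw [e]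
  refine (abs_add_le _ _).trans ((add_le_add i1 i3).trans ?_)
  rw [← add_div]
  gcongr
  have : (2:ℝ) ^ (n + 1) ≤ 4 ^ (n + 1) := by gcongr; norm_num
  nlinarith

lemma kerK_eq0 {n : ℕ} (j : Fin n) {ε : ℝ} {z : REu n} (h : ε ≤ ‖z‖) : kerK j ε z = kerK j 0 z := by
  unfold kerK; rw [if_pos h, if_pos (norm_nonneg z)]

lemma kerK_zero {n : ℕ} (j : Fin n) {ε : ℝ} {z : REu n} (h : ‖z‖ < ε) : kerK j ε z = 0 := by
  unfold kerK; rw [if_neg (not_le.mpr h)]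

structure RzTail {n : ℕ} (f : REu n → ℝ) : Prop where
  loc : LocallyIntegrable f volume
  tail : ∀ (x : REu n) (r : ℝ), 0 < r →
    IntegrableOn (fun y => f y * (‖x - y‖ ^ (n + 1))⁻¹) (ball x r)ᶜ

lemma rz_locball {n : ℕ} {f : REu n → ℝ} (h : LocallyIntegrable f volume) (x : REu n) (r : ℝ) :
    IntegrableOn f (ball x r) :=
  (h.integrableOn_isCompact (isCompact_closedBall x r)).mono_set ball_subset_closedBall

lemma rz_tail_of_lint {n : ℕ} {f : REu n → ℝ} (hf : AEStronglyMeasurable f volume) {m : ℕ} {s : Set (REu n)}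
    {x : REu n} (h : ∫⁻ y in s, ‖f y‖ₑ * ENNReal.ofReal ((‖x - y‖ ^ m)⁻¹) < ⊤) :
    IntegrableOn (fun y => f y * (‖x - y‖ ^ m)⁻¹) s := by
  refine ⟨(hf.mul (Measurable.aestronglyMeasurable (by fun_prop))).restrict, ?_⟩
  refine lt_of_le_of_lt (le_of_eq ?_) h
  congr 1; ext y
  rw [enorm_mul, Real.enorm_of_nonneg (by positivity : 0 ≤ (‖x - y‖ ^ m)⁻¹)]

lemma RzTail.const {n : ℕ} (c : ℝ) : RzTail (fun _ : REu n => c) := by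
  refine ⟨locallyIntegrable_const c, fun x r hr => ?_⟩
  apply rz_tail_of_lint aestronglyMeasurable_const
  have := rzv_pos n
  refine (rz_dyadic x hr (fun _ => c) aestronglyMeasurable_const (n + 1) (|c| * rzv n * 2 ^ n / r) (-1)
    (by positivity) (by norm_num) ?_).trans_lt ENNReal.ofReal_lt_top
  intro k
  rw [setLIntegral_const, rz_vol _ (by positivity), Real.enorm_eq_ofReal_abs, ← ENNReal.ofReal_mul (by positivity)]
  apply ENNReal.ofReal_le_ofReal
  apply le_of_eq
  rw [Real.rpow_neg_one, inv_pow, mul_pow, mul_pow, pow_succ (2 ^ k : ℝ), pow_succ (2:ℝ) k, mul_pow]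
  field_simp
  ring

lemma RzTail.sub {n : ℕ} {f g : REu n → ℝ} (hf : RzTail f) (hg : RzTail g) :
    RzTail (fun y => f y - g y) := by
  refine ⟨hf.loc.sub hg.loc, fun x r hr => ?_⟩
  refine IntegrableOn.congr_fun ((hf.tail x r hr).sub (hg.tail x r hr)) ?_ measurableSet_ball.compl
  intro y _
  simp only [Pi.sub_apply]; ring

/-- integrability of kernel differences -/
lemma rz_kint {n : ℕ} (j : Fin n) {f : REu n → ℝ} (hf : RzTail f) {ε ε' : ℝ} (h : 0 < ε) (h' : 0 < ε')
    (x x' : REu n) : Integrable (fun y => (kerK j ε (x - y) - kerK j ε' (x' - y)) * f y) := by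
  set R := 2 * ‖x - x'‖ + ε + ε' + 1 with hR
  have hn := norm_nonneg (x - x')
  have hR0 : 0 < R := by positivity
  have hmk : Measurable (fun y => (kerK j ε (x - y) - kerK j ε' (x' - y))) :=
    ((kerK_meas j ε).comp (by fun_prop)).sub ((kerK_meas j ε').comp (by fun_prop))
  rw [← integrableOn_univ, ← Set.union_compl_self (ball x' R)]
  refine IntegrableOn.union ?_ ?_
  · exact (rz_locball hf.loc x' R).bdd_mul (c := (ε ^ n)⁻¹ + (ε' ^ n)⁻¹) hmk.aestronglyMeasurable
      (Eventually.of_forall fun y => (abs_sub _ _).trans (add_le_add (kerK_bdd j h _) (kerK_bdd j h' _)))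
  · refine Integrable.mono' ((hf.tail x' R hR0).norm.const_mul (((n : ℝ) + 2) * 4 ^ (n + 1) * ‖x - x'‖))
      (hmk.aestronglyMeasurable.mul hf.loc.aestronglyMeasurable.restrict) ?_
    rw [ae_restrict_iff' measurableSet_ball.compl]
    refine Eventually.of_forall fun y hy => ?_
    rw [Set.mem_compl_iff, mem_ball, not_lt, dist_comm, dist_eq_norm] at hy
    have hxy : ‖x' - y‖ ≤ ‖x - y‖ + ‖x - x'‖ := by
      have := norm_sub_le (x - y) (x - x')
      rwa [show x - y - (x - x') = x' - y by abel] at this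
    rw [kerK_eq0 j (by linarith : ε ≤ ‖x - y‖), kerK_eq0 j (by linarith : ε' ≤ ‖x' - y‖), norm_mul, norm_mul]
    have hk := rz_kdiff j (a := x - y) (b := x' - y) (by
      rw [show x - y - (x' - y) = x - x' by abel]; linarith) (norm_pos_iff.mp (by linarith))
    rw [show x - y - (x' - y) = x - x' by abel] at hk
    calc _ ≤ ((n : ℝ) + 2) * 4 ^ (n + 1) * ‖x - x'‖ / ‖x' - y‖ ^ (n + 1) * ‖f y‖ := by
          gcongr; exact hk
      _ = _ := by
          rw [norm_inv, norm_pow, norm_norm]; ring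

lemma kerK_two {n : ℕ} (j : Fin n) (ε : ℝ) (z : REu n) :
    kerK j (2 * ε) ((2:ℝ) • z) = (2 ^ n)⁻¹ * kerK j ε z := by
  unfold kerK
  rw [norm_smul, Real.norm_of_nonneg zero_le_two]
  by_cases h : ε ≤ ‖z‖
  · rw [if_pos h, if_pos (by linarith), mul_pow, PiLp.smul_apply, smul_eq_mul]
    by_cases hz : ‖z‖ = 0
    · simp [hz]
    · field_simp; ring
  · rw [if_neg h, if_neg (by linarith), mul_zero]

lemma rz_kint1 {n : ℕ} (j : Fin n) {ε ε' : ℝ} (h : 0 < ε) (h' : 0 < ε')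
    (x x' : REu n) : Integrable (fun y => (kerK j ε (x - y) - kerK j ε' (x' - y))) := by
  have := rz_kint j (RzTail.const (n := n) 1) h h' x x'
  simpa using this

lemma rz_Z {n : ℕ} (j : Fin n) {ε ε' : ℝ} (h : 0 < ε) (h' : 0 < ε') (x x' : REu n) :
    ∫ y, (kerK j ε (x - y) - kerK j ε' (x' - y)) = 0 := by
  have s0 : ∀ (a b : ℝ) (u : REu n), ∫ y, (kerK j a (u - y) - kerK j b (u - y)) = 0 := by
    intro a b u
    rw [integral_sub_left_eq_self (fun z => kerK j a z - kerK j b z) volume u]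
    exact kerK_diff_zero j a b
  have s1 : ∀ (a b : ℝ), 0 < a → 0 < b → ∀ u v : REu n,
      ∫ y, (kerK j a (u - y) - kerK j a (v - y)) = ∫ y, (kerK j b (u - y) - kerK j b (v - y)) := by
    intro a b ha hb u v
    rw [← sub_eq_zero, ← integral_sub (rz_kint1 j ha ha u v) (rz_kint1 j hb hb u v)]
    have := integral_sub (rz_kint1 j ha hb u u) (rz_kint1 j ha hb v v)
    rw [s0, s0, sub_zero] at this
    rw [← this]
    congr 1; ext y; ring
  have s2 : ∀ (a : ℝ), 0 < a → ∀ u v w : REu n,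
      ∫ y, (kerK j a (u - y) - kerK j a (v - y)) =
        ∫ y, (kerK j a (u - w - y) - kerK j a (v - w - y)) := by
    intro a ha u v w
    rw [← integral_add_right_eq_self _ w]
    congr 1; ext y
    rw [show u - (y + w) = u - w - y by abel, show v - (y + w) = v - w - y by abel]
  have s3 : ∀ (a : ℝ), 0 < a → ∀ u : REu n, ∫ y, (kerK j a (u - y) - kerK j a (0 - y)) = 0 := by
    intro a ha u
    have e1 : ∫ y, (kerK j (2 * a) ((2:ℝ) • u - y) - kerK j (2 * a) (0 - y)) =
        ∫ y, (kerK j a (u - y) - kerK j a (0 - y)) := by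
      have := Measure.integral_comp_smul (volume : Measure (REu n))
        (fun y => (kerK j (2 * a) ((2:ℝ) • u - y) - kerK j (2 * a) (0 - y))) (2:ℝ)
      rw [finrank_euclideanSpace_fin, abs_of_pos (by positivity), smul_eq_mul] at this
      have e : ∀ y : REu n, kerK j (2 * a) ((2:ℝ) • u - (2:ℝ) • y) - kerK j (2 * a) (0 - (2:ℝ) • y)
          = (2 ^ n)⁻¹ * (kerK j a (u - y) - kerK j a (0 - y)) := by
        intro y
        rw [← smul_sub, zero_sub, ← smul_neg, kerK_two, kerK_two, zero_sub]; ring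
      simp only [e] at this
      rw [integral_const_mul] at this
      exact (mul_left_cancel₀ (by positivity) this).symm
    rw [s1 (2 * a) a (by positivity) ha] at e1
    have e2 : ∫ y, (kerK j a ((2:ℝ) • u - y) - kerK j a (0 - y)) =
        (∫ y, (kerK j a ((2:ℝ) • u - y) - kerK j a (u - y))) + ∫ y, (kerK j a (u - y) - kerK j a (0 - y)) := by
      rw [← integral_add (rz_kint1 j ha ha _ _) (rz_kint1 j ha ha _ _)]
      congr 1; ext y; ring
    rw [s2 a ha ((2:ℝ) • u) u u, show (2:ℝ) • u - u = u by rw [two_smul]; abel, sub_self, e1] at e2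
    linarith
  have := integral_add (rz_kint1 j h h x x') (rz_kint1 j h h' x' x')
  rw [s0, s2 ε h x x' x', sub_self, s3 ε h, add_zero] at this
  rw [← this]
  congr 1; ext y; ring

/-! growth function -/
lemma phi_pos {n : ℕ} {a b c : ℝ} (x : REu n) {r : ℝ} (hr : 0 < r) : 0 < phiEx n a b c x r := by
  unfold phiEx; split_ifs <;> positivity

lemma phi_grow {n : ℕ} {α δ β : ℝ} (hδ : δ < 0) (hα : 0 < α) (hβ : β < 0) (x : REu n) {r t : ℝ}
    (hr : 0 < r) (ht : 1 ≤ t) :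
    phiEx n α δ β x (t * r) ≤ 2 ^ (-δ) * t ^ α * phiEx n α δ β x r := by
  have hA : (1:ℝ) ≤ 2 ^ (-δ) := Real.one_le_rpow one_le_two (by linarith)
  have ht0 : 0 < t := by linarith
  have htα : 1 ≤ t ^ α := Real.one_le_rpow ht hα.le
  have hAt : 1 ≤ 2 ^ (-δ) * t ^ α := one_le_mul_of_one_le_of_one_le hA htα
  have hrt : r ≤ t * r := by nlinarith
  have key : ∀ c : ℝ, c < 0 → (t * r) ^ c ≤ 2 ^ (-δ) * t ^ α * r ^ c := by
    intro c hc
    rw [Real.mul_rpow ht0.le hr.le]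
    gcongr
    exact (Real.rpow_le_one_of_one_le_of_nonpos ht hc.le).trans hAt
  unfold phiEx
  by_cases h1 : t * r ≤ 2
  · rw [if_pos h1, if_pos (by linarith : r ≤ 2)]
    by_cases h2 : ‖x‖ ≤ 2
    · rw [if_pos h2, if_pos h2, Real.mul_rpow ht0.le hr.le]
      gcongr
      nlinarith
    · rw [if_neg h2, if_neg h2]
      exact key δ hδ
  · rw [if_neg h1]
    by_cases h2 : r ≤ 2
    · rw [if_pos h2]
      have h3 : (t * r) ^ β ≤ 1 := Real.rpow_le_one_of_one_le_of_nonpos (by linarith) hβ.le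
      refine h3.trans ?_
      by_cases h4 : ‖x‖ ≤ 2
      · rw [if_pos h4, mul_assoc, ← Real.mul_rpow ht0.le hr.le]
        exact one_le_mul_of_one_le_of_one_le hA (Real.one_le_rpow (by linarith) hα.le)
      · rw [if_neg h4]
        have h5 : (2:ℝ) ^ δ ≤ r ^ δ := Real.rpow_le_rpow_of_nonpos hr h2 hδ.le
        calc (1:ℝ) = 2 ^ (-δ) * 1 * 2 ^ δ := by
              rw [mul_one, ← Real.rpow_add two_pos]; simp
          _ ≤ _ := by gcongr
    · rw [if_neg h2]
      exact key β hβ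

lemma phi_zero {n : ℕ} {α δ β : ℝ} (hα : 0 < α) (hβ : β < 0) {r : ℝ} (hr : 1 ≤ r) :
    phiEx n α δ β 0 r ≤ 2 ^ (α - β) * r ^ β := by
  unfold phiEx
  rw [norm_zero, if_pos zero_le_two]
  by_cases h : r ≤ 2
  · rw [if_pos h, ← sub_add_cancel α β, Real.rpow_add (by linarith)]
    rw [sub_add_cancel]
    gcongr
    linarith
  · rw [if_neg h]
    have : (1:ℝ) ≤ 2 ^ (α - β) := Real.one_le_rpow one_le_two (by linarith)
    have h2 : 0 ≤ r ^ β := by positivity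
    nlinarith

structure RzG {n : ℕ} (ψ : REu n → ℝ → ℝ) (α A : ℝ) : Prop where
  pos : ∀ x r, 0 < r → 0 < ψ x r
  grow : ∀ x r t, 0 < r → 1 ≤ t → ψ x (t * r) ≤ A * t ^ α * ψ x r
  hA : 0 ≤ A
  h0 : 0 < α
  h1 : α < 1

structure RzCamp {n : ℕ} (q : ℝ) (ψ : REu n → ℝ → ℝ) (f : REu n → ℝ) (S : ℝ) : Prop where
  loc : LocallyIntegrable f volume
  mem : ∀ x r, 0 < r → MemLp f (ENNReal.ofReal q) (volume.restrict (ball x r))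
  nn : 0 ≤ S
  bd : ∀ x r, 0 < r → eLpNorm (fun y => f y - ballAvg f x r) (ENNReal.ofReal q) (volume.restrict (ball x r))
    ≤ ENNReal.ofReal (S * ψ x r * (rzv n * r ^ n) ^ (1 / q))

lemma rz_holder {n : ℕ} {q : ℝ} (hq : 1 < q) {g : REu n → ℝ} {x : REu n} {r M : ℝ} (hr : 0 < r)
    (hg : AEStronglyMeasurable g (volume.restrict (ball x r)))
    (h : eLpNorm g (ENNReal.ofReal q) (volume.restrict (ball x r)) ≤
      ENNReal.ofReal (M * (rzv n * r ^ n) ^ (1 / q))) :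
    ∫⁻ y in ball x r, ‖g y‖ₑ ≤ ENNReal.ofReal (M * (rzv n * r ^ n)) := by
  have hV : 0 < rzv n * r ^ n := mul_pos (rzv_pos n) (by positivity)
  rw [← eLpNorm_one_eq_lintegral_enorm]
  refine (eLpNorm_le_eLpNorm_mul_rpow_measure_univ (q := ENNReal.ofReal q)
    (by rw [← ENNReal.ofReal_one]; exact ENNReal.ofReal_le_ofReal hq.le) hg).trans ?_
  rw [Measure.restrict_apply_univ, rz_vol x hr, ENNReal.toReal_ofReal (by linarith), ENNReal.toReal_one,
    ENNReal.ofReal_rpow_of_pos hV]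
  refine (mul_le_mul' h le_rfl).trans (le_of_eq ?_)
  rw [← ENNReal.ofReal_mul' (by positivity), mul_assoc, ← Real.rpow_add hV]
  congr 2
  rw [show 1 / q + (1 / 1 - 1 / q) = 1 by ring, Real.rpow_one]

lemma rz_avg_sub {n : ℕ} {f : REu n → ℝ} (hf : LocallyIntegrable f volume) {x : REu n} {r : ℝ} (hr : 0 < r)
    {c M : ℝ} (hM : 0 ≤ M) (h : ∫⁻ y in ball x r, ‖f y - c‖ₑ ≤ ENNReal.ofReal (M * (rzv n * r ^ n))) :
    |ballAvg f x r - c| ≤ M := by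
  have hV : 0 < rzv n * r ^ n := mul_pos (rzv_pos n) (by positivity)
  have hc : IntegrableOn (fun _ => c) (ball x r) := integrableOn_const (hs := measure_ball_lt_top.ne)
  have e : ballAvg f x r - c = (rzv n * r ^ n)⁻¹ * ∫ y in ball x r, (f y - c) := by
    unfold ballAvg
    rw [integral_sub (rz_locball hf x r) hc, setIntegral_const, rz_vol' x hr, Measure.real, rz_vol' x hr,
      smul_eq_mul]
    have := (rzv_pos n).ne'
    field_simp
  have h2 : |∫ y in ball x r, (f y - c)| ≤ M * (rzv n * r ^ n) := by
    have := enorm_integral_le_lintegral_enorm (μ := volume.restrict (ball x r)) (fun y => f y - c)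
    have := this.trans h
    rw [Real.enorm_eq_ofReal_abs] at this
    exact (ENNReal.ofReal_le_ofReal_iff (by positivity)).mp this
  rw [e, abs_mul, abs_of_pos (inv_pos.mpr hV), inv_mul_le_iff₀ hV, mul_comm _ M]
  exact h2

lemma RzCamp.l1 {n : ℕ} {q : ℝ} (hq : 1 < q) {ψ : REu n → ℝ → ℝ} {f : REu n → ℝ} {S : ℝ} 
    (hf : RzCamp q ψ f S) (x : REu n) {r : ℝ} (hr : 0 < r) :
    ∫⁻ y in ball x r, ‖f y - ballAvg f x r‖ₑ ≤ ENNReal.ofReal (S * ψ x r * (rzv n * r ^ n)) :=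
  rz_holder hq hr ((hf.loc.aestronglyMeasurable.sub aestronglyMeasurable_const).restrict) (hf.bd x r hr)

lemma RzCamp.l2 {n : ℕ} {q : ℝ} (hq : 1 < q) {ψ : REu n → ℝ → ℝ} {f : REu n → ℝ} {S : ℝ} 
    (hf : RzCamp q ψ f S) (x : REu n) {r : ℝ} (hr : 0 < r) (hψ : 0 ≤ ψ x (2 * r)) :
    |ballAvg f x r - ballAvg f x (2 * r)| ≤ 2 ^ n * S * ψ x (2 * r) := by
  have := hf.nn
  apply rz_avg_sub hf.loc hr (by positivity)
  refine (lintegral_mono_set (ball_subset_ball (by linarith : r ≤ 2 * r))).trans ?_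
  refine (hf.l1 hq x (by positivity)).trans (le_of_eq ?_)
  congr 1
  rw [mul_pow]; ring

lemma RzCamp.l3 {n : ℕ} {q α A : ℝ} (hq : 1 < q) {ψ : REu n → ℝ → ℝ} (hψ : RzG ψ α A) {f : REu n → ℝ} {S : ℝ} 
    (hf : RzCamp q ψ f S) (x : REu n) {r : ℝ} (hr : 0 < r) (k : ℕ) :
    |ballAvg f x (2 ^ k * r) - ballAvg f x r| ≤
      2 ^ n * A * 2 ^ α * (2 ^ α - 1)⁻¹ * S * ψ x r * (2 ^ α) ^ k := by
  have hS := hf.nn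
  have hp := (hψ.pos x r hr).le
  have hA := hψ.hA
  have ha : (1:ℝ) < 2 ^ α := Real.one_lt_rpow one_lt_two hψ.h0
  have ha' : 0 < (2:ℝ) ^ α - 1 := by linarith
  induction k with
  | zero => simp only [pow_zero, one_mul, sub_self, abs_zero]; positivity
  | succ k ih =>
    have h1 := hf.l2 hq x (r := 2 ^ k * r) (by positivity) (hψ.pos _ _ (by positivity)).le
    have h2 := hψ.grow x r (2 ^ (k + 1)) hr (one_le_pow₀ one_le_two)
    rw [show 2 * (2 ^ k * r) = 2 ^ (k + 1) * r by ring] at h1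
    have e1 : ((2:ℝ) ^ (k + 1)) ^ α = (2 ^ α) ^ (k + 1) := by
      rw [← Real.rpow_natCast, ← Real.rpow_mul zero_le_two, mul_comm, Real.rpow_mul zero_le_two, Real.rpow_natCast]
    rw [e1] at h2
    have h3 : |ballAvg f x (2 ^ k * r) - ballAvg f x (2 ^ (k + 1) * r)| ≤
        2 ^ n * S * (A * (2 ^ α) ^ (k + 1) * ψ x r) := h1.trans (by gcongr)
    have h4 : |ballAvg f x (2 ^ (k + 1) * r) - ballAvg f x r| ≤
      |ballAvg f x (2 ^ k * r) - ballAvg f x (2 ^ (k + 1) * r)| + |ballAvg f x (2 ^ k * r) - ballAvg f x r| := by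
      rw [abs_sub_comm (ballAvg f x (2 ^ k * r))]
      exact abs_sub_le _ _ _
    refine h4.trans ((add_le_add h3 ih).trans (le_of_eq ?_))
    rw [pow_succ]
    field_simp
    ring

lemma rz_l4 {n : ℕ} {q α A : ℝ} (hq : 1 < q) {ψ : REu n → ℝ → ℝ} (hψ : RzG ψ α A) :
    ∃ C, 0 ≤ C ∧ ∀ (f : REu n → ℝ) (S : ℝ), RzCamp q ψ f S → ∀ (x : REu n) (r : ℝ), 0 < r →
    ∫⁻ y in (ball x r)ᶜ, ‖f y - ballAvg f x r‖ₑ * ENNReal.ofReal ((‖x - y‖ ^ (n + 1))⁻¹) ≤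
      ENNReal.ofReal (C * S * ψ x r / r) := by
  have hA := hψ.hA
  have ha : (1:ℝ) < 2 ^ α := Real.one_lt_rpow one_lt_two hψ.h0
  have ha' : 0 < (2:ℝ) ^ α - 1 := by linarith
  have ha2 : 0 < 1 - (2:ℝ) ^ (α - 1) := by
    have := Real.rpow_lt_one_of_one_lt_of_neg one_lt_two (by linarith [hψ.h1] : α - 1 < 0)
    linarith
  have hv := rzv_pos n
  set D := 2 ^ n * A * 2 ^ α * ((2:ℝ) ^ α - 1)⁻¹ with hD
  have hD0 : 0 ≤ D := by positivity
  refine ⟨(A + D) * 2 ^ α * rzv n * 2 ^ n * (1 - 2 ^ (α - 1))⁻¹, by positivity, ?_⟩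
  intro f S hf x r hr
  have hS := hf.nn
  have hp := (hψ.pos x r hr).le
  refine (rz_dyadic x hr (fun y => f y - ballAvg f x r) (hf.loc.aestronglyMeasurable.sub aestronglyMeasurable_const)
    (n + 1) (S * ψ x r * (A + D) * 2 ^ α * rzv n * 2 ^ n / r) (α - 1) (by positivity)
    (by linarith [hψ.h1]) ?_).trans (le_of_eq ?_)
  · intro k
    have hR : 0 < 2 ^ (k + 1) * r := by positivity
    set b := ballAvg f x (2 ^ (k + 1) * r) with hb
    set V := rzv n * (2 ^ (k + 1) * r) ^ n with hV
    have hV0 : 0 ≤ V := by positivity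
    have h3 := hf.l3 hq hψ x hr (k + 1)
    rw [← hb, ← hD] at h3
    have h2 := hψ.grow x r (2 ^ (k + 1)) hr (one_le_pow₀ one_le_two)
    have e1 : ((2:ℝ) ^ (k + 1)) ^ α = (2 ^ α) ^ (k + 1) := by
      rw [← Real.rpow_natCast, ← Real.rpow_mul zero_le_two, mul_comm, Real.rpow_mul zero_le_two, Real.rpow_natCast]
    rw [e1] at h2
    calc ∫⁻ y in ball x (2 ^ (k + 1) * r), ‖f y - ballAvg f x r‖ₑ
        ≤ ∫⁻ y in ball x (2 ^ (k + 1) * r), (‖f y - b‖ₑ + ‖b - ballAvg f x r‖ₑ) := by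
          apply lintegral_mono; intro y
          have := enorm_add_le (f y - b) (b - ballAvg f x r)
          simpa using this
      _ = (∫⁻ y in ball x (2 ^ (k + 1) * r), ‖f y - b‖ₑ) + ‖b - ballAvg f x r‖ₑ * ENNReal.ofReal V := by
          rw [lintegral_add_right _ measurable_const, setLIntegral_const, rz_vol _ hR]
      _ ≤ ENNReal.ofReal (S * ψ x (2 ^ (k + 1) * r) * V) +
            ENNReal.ofReal (D * S * ψ x r * (2 ^ α) ^ (k + 1)) * ENNReal.ofReal V := by
          gcongr
          · exact hf.l1 hq x hR
          · rw [Real.enorm_eq_ofReal_abs]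
            exact ENNReal.ofReal_le_ofReal h3
      _ ≤ ENNReal.ofReal (S * (A * (2 ^ α) ^ (k + 1) * ψ x r) * V) +
            ENNReal.ofReal (D * S * ψ x r * (2 ^ α) ^ (k + 1)) * ENNReal.ofReal V := by
          gcongr
      _ = _ := by
          rw [← ENNReal.ofReal_mul (by positivity), ← ENNReal.ofReal_add (by positivity) (by positivity)]
          congr 1
          rw [hV, Real.rpow_sub two_pos, Real.rpow_one, div_pow, mul_pow, mul_pow, pow_succ (2:ℝ) k, mul_pow,
            pow_succ (2 ^ k : ℝ) n, pow_succ r n]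
          field_simp
          ring
  · congr 1; field_simp

lemma RzCamp.tail {n : ℕ} {q α A : ℝ} (hq : 1 < q) {ψ : REu n → ℝ → ℝ} (hψ : RzG ψ α A) {f : REu n → ℝ} {S : ℝ} 
    (hf : RzCamp q ψ f S) : RzTail f := by
  refine ⟨hf.loc, fun x r hr => ?_⟩
  obtain ⟨C, hC, H⟩ := rz_l4 hq hψ
  have h1 := rz_tail_of_lint (f := fun y => f y - ballAvg f x r)
    (hf.loc.aestronglyMeasurable.sub aestronglyMeasurable_const) ((H f S hf x r hr).trans_lt ENNReal.ofReal_lt_top)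
  have h2 := (RzTail.const (n := n) (ballAvg f x r)).tail x r hr
  refine IntegrableOn.congr_fun (h1.add h2) ?_ measurableSet_ball.compl
  intro y _
  simp only [Pi.add_apply]; ring

def rzW {n : ℕ} (j : Fin n) (ε : ℝ) (f : REu n → ℝ) (x : REu n) : ℝ :=
  ∫ y, (kerK j ε (x - y) - kerK j 1 (0 - y)) * f y

lemma kerK_meas2 {n : ℕ} (j : Fin n) (ε : ℝ) :
    Measurable (fun p : REu n × REu n => kerK j ε (p.1 - p.2)) :=
  (kerK_meas j ε).comp (measurable_fst.sub measurable_snd)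

lemma rz_int_aesm {n : ℕ} {k : REu n × REu n → ℝ} (hk : Measurable k) {f : REu n → ℝ}
    (hf : AEStronglyMeasurable f volume) (s t : Set (REu n)) :
    AEStronglyMeasurable (fun x => ∫ y in s, k (x, y) * f y) (volume.restrict t) := by
  have h : AEStronglyMeasurable (fun p : REu n × REu n => k p * f p.2)
      ((volume.restrict t).prod (volume.restrict s)) :=
    hk.aestronglyMeasurable.mul (hf.restrict.comp_snd)
  exact h.integral_prod_right'

lemma rzW_aesm {n : ℕ} (j : Fin n) (ε : ℝ) {f : REu n → ℝ} (hf : AEStronglyMeasurable f volume) :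
    AEStronglyMeasurable (rzW j ε f) volume := by
  have := rz_int_aesm (k := fun p => kerK j ε (p.1 - p.2) - kerK j 1 (0 - p.2))
    ((kerK_meas2 j ε).sub ((kerK_meas j 1).comp (measurable_const.sub measurable_snd))) hf Set.univ Set.univ
  simp only [Measure.restrict_univ] at this
  exact this

lemma rz_const_sub {n : ℕ} (j : Fin n) {f : REu n → ℝ} (hf : RzTail f) {ε ε' : ℝ} (h : 0 < ε) (h' : 0 < ε')
    (x x' : REu n) (b : ℝ) :
    ∫ y, (kerK j ε (x - y) - kerK j ε' (x' - y)) * f y =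
      ∫ y, (kerK j ε (x - y) - kerK j ε' (x' - y)) * (f y - b) := by
  have e : ∀ y, (kerK j ε (x - y) - kerK j ε' (x' - y)) * (f y - b) =
      (kerK j ε (x - y) - kerK j ε' (x' - y)) * f y - (kerK j ε (x - y) - kerK j ε' (x' - y)) * b := by
    intro y; ring
  simp_rw [e]
  rw [integral_sub (rz_kint j hf h h' x x') ((rz_kint1 j h h' x x').mul_const b), integral_mul_const,
    rz_Z j h h', zero_mul, sub_zero]

/-- far part -/
def rzE {n : ℕ} (j : Fin n) (x0 : REu n) (r : ℝ) (h : REu n → ℝ) (x : REu n) : ℝ :=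
  ∫ y in (ball x0 (2 * r))ᶜ, (kerK j 0 (x - y) - kerK j 0 (x0 - y)) * h y

lemma rzW_repr {n : ℕ} (j : Fin n) {h : REu n → ℝ} (hh : RzTail h) {x0 x : REu n} {r ε : ℝ}
    (hr : 0 < r) (hε : 0 < ε) (hεr : ε ≤ r) (hx : x ∈ ball x0 r) :
    rzW j ε h x = (∫ y, (kerK j (2 * r) (x0 - y) - kerK j 1 (0 - y)) * h y) +
      rzT j ε ((ball x0 (2 * r)).indicator h) x + rzE j x0 r h x := by
  have hr2 : 0 < 2 * r := by positivity
  have i1 := rz_kint j hh hr2 one_pos x0 0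
  have i2 := rz_kint j hh hε hr2 x x0
  have e1 : rzW j ε h x = (∫ y, (kerK j (2 * r) (x0 - y) - kerK j 1 (0 - y)) * h y) +
      ∫ y, (kerK j ε (x - y) - kerK j (2 * r) (x0 - y)) * h y := by
    rw [← integral_add i1 i2]
    unfold rzW
    congr 1; ext y; ring
  rw [e1, ← integral_add_compl (measurableSet_ball (x := x0) (ε := 2 * r)) i2, ← add_assoc]
  congr 1
  · congr 1
    rw [rzT_eq, ← integral_indicator measurableSet_ball]
    congr 1; ext y
    by_cases hy : y ∈ ball x0 (2 * r)
    · rw [Set.indicator_of_mem hy, Set.indicator_of_mem hy, kerK_zero (ε := 2 * r), sub_zero]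
      rwa [mem_ball, dist_comm, dist_eq_norm] at hy
    · rw [Set.indicator_of_notMem hy, Set.indicator_of_notMem hy, mul_zero]
  · unfold rzE
    refine setIntegral_congr_fun measurableSet_ball.compl ?_
    intro y hy
    rw [Set.mem_compl_iff, mem_ball, not_lt, dist_comm, dist_eq_norm] at hy
    rw [mem_ball, dist_comm, dist_eq_norm] at hx
    simp only
    have : ‖x0 - y‖ ≤ ‖x0 - x‖ + ‖x - y‖ := norm_sub_le_norm_sub_add_norm_sub _ _ _
    rw [kerK_eq0 j hy, kerK_eq0 j (by linarith : ε ≤ ‖x - y‖)]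

lemma rzE_bound {n : ℕ} (j : Fin n) {h : REu n → ℝ} {x0 x : REu n} {r M : ℝ}
    (hr : 0 < r) (hx : x ∈ ball x0 r) (hM : 0 ≤ M)
    (H : ∫⁻ y in (ball x0 (2 * r))ᶜ, ‖h y‖ₑ * ENNReal.ofReal ((‖x0 - y‖ ^ (n + 1))⁻¹) ≤ ENNReal.ofReal (M / r)) :
    |rzE j x0 r h x| ≤ ((n : ℝ) + 2) * 4 ^ (n + 1) * M := by
  rw [mem_ball, dist_eq_norm] at hx
  have : ‖rzE j x0 r h x‖ₑ ≤ ENNReal.ofReal (((n : ℝ) + 2) * 4 ^ (n + 1) * M) := by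
    refine (enorm_integral_le_lintegral_enorm _).trans ?_
    calc ∫⁻ y in (ball x0 (2 * r))ᶜ, ‖(kerK j 0 (x - y) - kerK j 0 (x0 - y)) * h y‖ₑ
        ≤ ∫⁻ y in (ball x0 (2 * r))ᶜ, ENNReal.ofReal (((n : ℝ) + 2) * 4 ^ (n + 1) * r) *
          (‖h y‖ₑ * ENNReal.ofReal ((‖x0 - y‖ ^ (n + 1))⁻¹)) := by
          apply setLIntegral_mono' measurableSet_ball.compl
          intro y hy
          rw [Set.mem_compl_iff, mem_ball, not_lt, dist_comm, dist_eq_norm] at hy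
          have hk := rz_kdiff j (a := x - y) (b := x0 - y) (by
            rw [show x - y - (x0 - y) = x - x0 by abel]; linarith) (norm_pos_iff.mp (by linarith))
          rw [show x - y - (x0 - y) = x - x0 by abel] at hk
          rw [enorm_mul, mul_comm ‖h y‖ₑ, ← mul_assoc, ← ENNReal.ofReal_mul (by positivity), Real.enorm_eq_ofReal_abs]
          gcongr
          refine hk.trans ?_
          rw [div_eq_mul_inv]
          gcongr
      _ = ENNReal.ofReal (((n : ℝ) + 2) * 4 ^ (n + 1) * r) *
          ∫⁻ y in (ball x0 (2 * r))ᶜ, (‖h y‖ₑ * ENNReal.ofReal ((‖x0 - y‖ ^ (n + 1))⁻¹)) := by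
          rw [lintegral_const_mul' _ _ ENNReal.ofReal_ne_top]
      _ ≤ ENNReal.ofReal (((n : ℝ) + 2) * 4 ^ (n + 1) * r) * ENNReal.ofReal (M / r) := by gcongr
      _ = _ := by
          rw [← ENNReal.ofReal_mul (by positivity)]
          congr 1; field_simp
  rw [Real.enorm_eq_ofReal_abs] at this
  exact (ENNReal.ofReal_le_ofReal_iff (by positivity)).mp this

lemma rz_one_le {q : ℝ} (hq : 1 < q) : (1:ℝ≥0∞) ≤ ENNReal.ofReal q := by
  rw [← ENNReal.ofReal_one]; exact ENNReal.ofReal_le_ofReal hq.le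

lemma rz_eLp_bdd {n : ℕ} {q : ℝ} (hq : 1 < q) {g : REu n → ℝ} {x : REu n} {r M : ℝ} (hr : 0 < r) (hM : 0 ≤ M)
    (h : ∀ y ∈ ball x r, |g y| ≤ M) :
    eLpNorm g (ENNReal.ofReal q) (volume.restrict (ball x r)) ≤ ENNReal.ofReal (M * (rzv n * r ^ n) ^ (1 / q)) := by
  have hV : 0 < rzv n * r ^ n := mul_pos (rzv_pos n) (by positivity)
  refine (eLpNorm_le_of_ae_bound (C := M) ?_).trans ?_
  · rw [ae_restrict_iff' measurableSet_ball]
    exact Eventually.of_forall h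
  · rw [Measure.restrict_apply_univ, rz_vol x hr, ENNReal.toReal_ofReal (by linarith),
      ENNReal.ofReal_rpow_of_pos hV, ← ENNReal.ofReal_mul' hM, mul_comm, one_div]

lemma rz_int_ball {n : ℕ} {q : ℝ} (hq : 1 < q) {g : REu n → ℝ} {x : REu n} {r : ℝ}
    (h : MemLp g (ENNReal.ofReal q) (volume.restrict (ball x r))) : IntegrableOn g (ball x r) := by
  have : IsFiniteMeasure (volume.restrict (ball x r)) := ⟨by
    rw [Measure.restrict_apply_univ]; exact measure_ball_lt_top⟩
  exact h.integrable (rz_one_le hq)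

lemma rz_const_mem {n : ℕ} (p : ℝ≥0∞) (c : ℝ) (x : REu n) (r : ℝ) :
    MemLp (fun _ => c) p (volume.restrict (ball x r)) := by
  have : IsFiniteMeasure (volume.restrict (ball x r)) := ⟨by
    rw [Measure.restrict_apply_univ]; exact measure_ball_lt_top⟩
  exact memLp_const c

lemma rz_local {n : ℕ} {q α A : ℝ} (hq : 1 < q) {ψ : REu n → ℝ → ℝ} (hψ : RzG ψ α A) :
    ∃ C, 0 ≤ C ∧ ∀ (j : Fin n) (f : REu n → ℝ) (S : ℝ), RzCamp q ψ f S → ∀ (x0 : REu n) (r : ℝ), 0 < r →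
    ∃ g0 : REu n → ℝ, MemLp g0 (ENNReal.ofReal q) (volume.restrict (ball x0 r)) ∧
      Tendsto (fun ε => eLpNorm (fun x => rzW j ε f x - g0 x) (ENNReal.ofReal q) (volume.restrict (ball x0 r)))
        (nhdsWithin 0 (Set.Ioi 0)) (nhds 0) ∧
      eLpNorm (fun x => g0 x - ∫ y, (kerK j (2 * r) (x0 - y) - kerK j 1 (0 - y)) * (f y - ballAvg f x0 (2 * r)))
        (ENNReal.ofReal q) (volume.restrict (ball x0 r)) ≤
        ENNReal.ofReal (C * S * ψ x0 r * (rzv n * r ^ n) ^ (1 / q)) := by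
  obtain ⟨C4, hC4, L4⟩ := rz_l4 hq hψ
  obtain ⟨A0, HA⟩ := rz_Tn (n := n) q hq
  have hA := hψ.hA
  set C1 : ℝ := A0 * (A * 2 ^ α) * ((2:ℝ) ^ n) ^ (1 / q) with hC1
  set C2 : ℝ := ((n : ℝ) + 2) * 4 ^ (n + 1) * (C4 * (A * 2 ^ α) / 2) with hC2
  refine ⟨C1 + C2, by positivity, ?_⟩
  intro j f S hf x0 r hr
  have hr2 : 0 < 2 * r := by positivity
  have hS := hf.nn
  have hp := (hψ.pos x0 r hr).le
  have hp2 := (hψ.pos x0 (2 * r) hr2).le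
  have hg2 := hψ.grow x0 r 2 hr one_le_two
  have hv := rzv_pos n
  set b := ballAvg f x0 (2 * r) with hb
  set c := ∫ y, (kerK j (2 * r) (x0 - y) - kerK j 1 (0 - y)) * (f y - b) with hc
  have hft : RzTail f := hf.tail hq hψ
  set h : REu n → ℝ := fun y => f y - b with hh
  have hht : RzTail h := hft.sub (RzTail.const b)
  set hχ := (ball x0 (2 * r)).indicator h with hhχ
  have hhi : Integrable hχ := (rz_locball hht.loc x0 (2 * r)).integrable_indicator measurableSet_ball
  have hhm : MemLp hχ (ENNReal.ofReal q) volume := by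
    rw [hhχ, memLp_indicator_iff_restrict measurableSet_ball]
    exact (hf.mem x0 (2 * r) hr2).sub (rz_const_mem _ b _ _)
  obtain ⟨g, hg, hgt⟩ := rz_Tlim q hq j hhi hhm
  have hEb : ∀ x ∈ ball x0 r, |rzE j x0 r h x| ≤ C2 * S * ψ x0 r := by
    intro x hx
    refine (rzE_bound (M := C4 * S * ψ x0 (2 * r) / 2) j hr hx (by positivity) ?_).trans ?_
    · refine (L4 f S hf x0 (2 * r) hr2).trans (le_of_eq ?_)
      congr 1; field_simp
    · calc ((n : ℝ) + 2) * 4 ^ (n + 1) * (C4 * S * ψ x0 (2 * r) / 2)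
          ≤ ((n : ℝ) + 2) * 4 ^ (n + 1) * (C4 * S * (A * 2 ^ α * ψ x0 r) / 2) := by gcongr
        _ = _ := by rw [hC2]; ring
  have hEm : AEStronglyMeasurable (rzE j x0 r h) (volume.restrict (ball x0 r)) :=
    rz_int_aesm (k := fun p => kerK j 0 (p.1 - p.2) - kerK j 0 (x0 - p.2))
      ((kerK_meas2 j 0).sub ((kerK_meas j 0).comp (measurable_const.sub measurable_snd)))
      hht.loc.aestronglyMeasurable _ _
  have hEn := rz_eLp_bdd hq hr (by positivity : 0 ≤ C2 * S * ψ x0 r) hEb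
  have hE : MemLp (rzE j x0 r h) (ENNReal.ofReal q) (volume.restrict (ball x0 r)) :=
    ⟨hEm, hEn.trans_lt ENNReal.ofReal_lt_top⟩
  refine ⟨fun x => c + (g x + rzE j x0 r h x), (rz_const_mem _ c _ _).add ((hg.restrict _).add hE), ?_, ?_⟩
  · refine tendsto_of_tendsto_of_tendsto_of_le_of_le' tendsto_const_nhds hgt
      (Eventually.of_forall fun _ => zero_le) ?_
    filter_upwards [Ioc_mem_nhdsGT hr] with ε hε
    refine le_trans (le_of_eq ?_) (eLpNorm_restrict_le _ _ _ (ball x0 r))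
    apply eLpNorm_congr_ae
    rw [EventuallyEq, ae_restrict_iff' measurableSet_ball]
    refine Eventually.of_forall fun x hx => ?_
    have e1 : rzW j ε f x = rzW j ε h x := rz_const_sub j hft hε.1 one_pos x 0 b
    rw [e1, rzW_repr j hht hr hε.1 hε.2 hx]
    ring
  · have e : (fun x => c + (g x + rzE j x0 r h x) - c) = g + rzE j x0 r h := by
      ext x; simp only [Pi.add_apply]; ring
    rw [e]
    refine (eLpNorm_add_le (hg.restrict _).1 hEm (rz_one_le hq)).trans ?_
    have hgn : eLpNorm g (ENNReal.ofReal q) volume ≤ A0 * eLpNorm hχ (ENNReal.ofReal q) volume := by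
      have hlim : Tendsto (fun ε => eLpNorm (fun x => rzT j ε hχ x - g x) (ENNReal.ofReal q) volume
          + A0 * eLpNorm hχ (ENNReal.ofReal q) volume) (nhdsWithin 0 (Set.Ioi 0))
          (nhds (0 + A0 * eLpNorm hχ (ENNReal.ofReal q) volume)) := hgt.add tendsto_const_nhds
      rw [zero_add] at hlim
      refine ge_of_tendsto hlim ?_
      filter_upwards [self_mem_nhdsWithin] with ε hε
      have hε : 0 < ε := hε
      have hTm := (rzT_aesm j ε hhi).aestronglyMeasurable (μ := volume)
      calc eLpNorm g (ENNReal.ofReal q) volume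
          = eLpNorm ((fun x => g x - rzT j ε hχ x) + rzT j ε hχ) (ENNReal.ofReal q) volume := by
            congr 1; ext x; simp
        _ ≤ _ := eLpNorm_add_le (hg.1.sub hTm) hTm (rz_one_le hq)
        _ ≤ _ := by
            gcongr
            · rw [← eLpNorm_neg]
              apply le_of_eq; congr 1; ext x; simp
            · exact HA j hχ hhi ε hε
    have hχn : eLpNorm hχ (ENNReal.ofReal q) volume ≤
        ENNReal.ofReal (S * ψ x0 (2 * r) * (rzv n * (2 * r) ^ n) ^ (1 / q)) := by
      rw [hhχ, eLpNorm_indicator_eq_eLpNorm_restrict measurableSet_ball]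
      exact hf.bd x0 (2 * r) hr2
    calc eLpNorm g (ENNReal.ofReal q) (volume.restrict (ball x0 r)) + eLpNorm (rzE j x0 r h) (ENNReal.ofReal q) (volume.restrict (ball x0 r))
        ≤ A0 * ENNReal.ofReal (S * ψ x0 (2 * r) * (rzv n * (2 * r) ^ n) ^ (1 / q)) +
          ENNReal.ofReal (C2 * S * ψ x0 r * (rzv n * r ^ n) ^ (1 / q)) := by
          refine add_le_add ?_ hEn
          refine (eLpNorm_restrict_le _ _ _ _).trans (hgn.trans ?_)
          gcongr
      _ ≤ ENNReal.ofReal (C1 * S * ψ x0 r * (rzv n * r ^ n) ^ (1 / q)) +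
          ENNReal.ofReal (C2 * S * ψ x0 r * (rzv n * r ^ n) ^ (1 / q)) := by
          gcongr
          rw [← ENNReal.ofReal_coe_nnreal, ← ENNReal.ofReal_mul (by positivity)]
          apply ENNReal.ofReal_le_ofReal
          rw [show rzv n * (2 * r) ^ n = 2 ^ n * (rzv n * r ^ n) by rw [mul_pow]; ring,
            Real.mul_rpow (by positivity) (by positivity)]
          calc (A0:ℝ) * (S * ψ x0 (2 * r) * (((2:ℝ) ^ n) ^ (1 / q) * (rzv n * r ^ n) ^ (1 / q)))
              ≤ (A0:ℝ) * (S * (A * 2 ^ α * ψ x0 r) * (((2:ℝ) ^ n) ^ (1 / q) * (rzv n * r ^ n) ^ (1 / q))) := by gcongr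
            _ = _ := by rw [hC1]; ring
      _ = _ := by
          rw [← ENNReal.ofReal_add (by positivity) (by positivity)]
          congr 1; ring

/-- uniqueness of limits -/
lemma rz_uniq {n : ℕ} {p : ℝ≥0∞} (hp : 1 ≤ p) {μ : Measure (REu n)} {F : ℝ → REu n → ℝ} {g g' : REu n → ℝ}
    (hF : ∀ ε, AEStronglyMeasurable (F ε) μ) (hg : AEStronglyMeasurable g μ) (hg' : AEStronglyMeasurable g' μ)
    (h : Tendsto (fun ε => eLpNorm (fun x => F ε x - g x) p μ) (nhdsWithin 0 (Set.Ioi 0)) (nhds 0))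
    (h' : Tendsto (fun ε => eLpNorm (fun x => F ε x - g' x) p μ) (nhdsWithin 0 (Set.Ioi 0)) (nhds 0)) :
    g =ᵐ[μ] g' := by
  have hz : eLpNorm (fun x => g x - g' x) p μ = 0 := by
    have hl := h.add h'
    rw [add_zero] at hl
    refine le_antisymm (ge_of_tendsto hl ?_) zero_le
    refine Eventually.of_forall fun ε => ?_
    calc eLpNorm (fun x => g x - g' x) p μ
        = eLpNorm ((fun x => g x - F ε x) + fun x => F ε x - g' x) p μ := by
          congr 1; ext x; simp
      _ ≤ _ := eLpNorm_add_le (hg.sub (hF ε)) ((hF ε).sub hg') hp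
      _ ≤ _ := by
          gcongr
          rw [← eLpNorm_neg]
          apply le_of_eq; congr 1; ext x; simp
  replace hz := (eLpNorm_eq_zero_iff (hg.sub hg') (one_pos.trans_le hp).ne').mp hz
  filter_upwards [hz] with x hx
  simpa [sub_eq_zero] using hx

lemma rz_patch {n : ℕ} {p : ℝ≥0∞} (hp : 1 ≤ p) {F : ℝ → REu n → ℝ}
    (hF : ∀ ε, AEStronglyMeasurable (F ε) volume)
    (H : ∀ N : ℕ, ∃ g, MemLp g p (volume.restrict (ball (0 : REu n) (N + 1))) ∧
      Tendsto (fun ε => eLpNorm (fun x => F ε x - g x) p (volume.restrict (ball (0 : REu n) (N + 1))))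
        (nhdsWithin 0 (Set.Ioi 0)) (nhds 0)) :
    ∃ g, ∀ x r, MemLp g p (volume.restrict (ball x r)) ∧
      Tendsto (fun ε => eLpNorm (fun x => F ε x - g x) p (volume.restrict (ball x r)))
        (nhdsWithin 0 (Set.Ioi 0)) (nhds 0) := by
  choose G hGm hGt using H
  have hu : ∀ N M : ℕ, M ≤ N → ∀ᵐ x : REu n, x ∈ ball (0 : REu n) (M + 1) → G M x = G N x := by
    intro N M hMN
    rw [← ae_restrict_iff' measurableSet_ball]
    have hsub : ball (0 : REu n) (M + 1) ⊆ ball (0 : REu n) (N + 1) := ball_subset_ball (by gcongr)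
    have hle : volume.restrict (ball (0 : REu n) (M + 1)) ≤ volume.restrict (ball (0 : REu n) (N + 1)) :=
      Measure.restrict_mono_set _ hsub
    refine rz_uniq hp (fun ε => (hF ε).restrict) (hGm M).1 ((hGm N).1.mono_measure hle) (hGt M) ?_
    exact tendsto_of_tendsto_of_tendsto_of_le_of_le tendsto_const_nhds (hGt N) (fun _ => zero_le)
      (fun ε => eLpNorm_mono_measure _ hle)
  set g : REu n → ℝ := fun x => G ⌊‖x‖⌋₊ x with hg
  have hgN : ∀ N : ℕ, G N =ᵐ[volume.restrict (ball (0 : REu n) (N + 1))] g := by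
    intro N
    rw [EventuallyEq, ae_restrict_iff' measurableSet_ball]
    have : ∀ᵐ x : REu n, ∀ M : ℕ, M ≤ N → x ∈ ball (0 : REu n) (M + 1) → G M x = G N x := by
      rw [ae_all_iff]; intro M
      by_cases hM : M ≤ N
      · filter_upwards [hu N M hM] with x hx _ using hx
      · exact Eventually.of_forall fun x h => absurd h hM
    filter_upwards [this] with x hx hxN
    rw [mem_ball_zero_iff] at hxN
    refine (hx ⌊‖x‖⌋₊ ?_ ?_).symm
    · have : ⌊‖x‖⌋₊ < N + 1 := by
        rw [Nat.floor_lt (norm_nonneg x)]; push_cast; exact hxN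
      omega
    · rw [mem_ball_zero_iff]; exact Nat.lt_floor_add_one _
  refine ⟨g, fun x r => ?_⟩
  obtain ⟨N, hN⟩ := exists_nat_ge (‖x‖ + r)
  have hsub : ball x r ⊆ ball (0 : REu n) (N + 1) := by
    intro y hy
    rw [mem_ball, dist_eq_norm] at hy
    rw [mem_ball_zero_iff]
    have := norm_le_norm_add_norm_sub x y
    rw [norm_sub_rev] at this
    linarith
  have hle : volume.restrict (ball x r) ≤ volume.restrict (ball (0 : REu n) (N + 1)) :=
    Measure.restrict_mono_set _ hsub
  refine ⟨((memLp_congr_ae (hgN N)).mp (hGm N)).mono_measure hle, ?_⟩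
  refine tendsto_of_tendsto_of_tendsto_of_le_of_le tendsto_const_nhds (hGt N) (fun _ => zero_le)
    (fun ε => (eLpNorm_mono_measure _ hle).trans (le_of_eq ?_))
  apply eLpNorm_congr_ae
  filter_upwards [hgN N] with x hx
  rw [hx]

lemma rz_loc_of_mem {n : ℕ} {q : ℝ} (hq : 1 < q) {g : REu n → ℝ}
    (h : ∀ x r, 0 < r → MemLp g (ENNReal.ofReal q) (volume.restrict (ball x r))) : LocallyIntegrable g volume :=
  fun x => ⟨ball x 1, ball_mem_nhds x one_pos, rz_int_ball hq (h x 1 one_pos)⟩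

lemma rz_camp_of {n : ℕ} {q : ℝ} (hq : 1 < q) {ψ : REu n → ℝ → ℝ} (hψ : ∀ x r, 0 < r → 0 < ψ x r)
    {g : REu n → ℝ} {M : ℝ} (hM : 0 ≤ M)
    (h : ∀ x r, 0 < r → MemLp g (ENNReal.ofReal q) (volume.restrict (ball x r)))
    (H : ∀ x r, 0 < r → ∃ c : ℝ, eLpNorm (fun y => g y - c) (ENNReal.ofReal q) (volume.restrict (ball x r)) ≤
      ENNReal.ofReal (M * ψ x r * (rzv n * r ^ n) ^ (1 / q))) : RzCamp q ψ g (2 * M) := by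
  have hloc := rz_loc_of_mem hq h
  refine ⟨hloc, h, by positivity, fun x r hr => ?_⟩
  have hv := rzv_pos n
  have hp := (hψ x r hr).le
  obtain ⟨c, hc⟩ := H x r hr
  have hm : AEStronglyMeasurable (fun y => g y - c) (volume.restrict (ball x r)) :=
    (h x r hr).1.sub aestronglyMeasurable_const
  have h1 := rz_avg_sub hloc hr (by positivity) (rz_holder hq hr hm hc)
  have h2 := rz_eLp_bdd hq (g := fun _ => c - ballAvg g x r) (x := x) hr (by positivity : 0 ≤ M * ψ x r)
    (fun y _ => by rw [abs_sub_comm]; exact h1)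
  calc eLpNorm (fun y => g y - ballAvg g x r) (ENNReal.ofReal q) (volume.restrict (ball x r))
      = eLpNorm ((fun y => g y - c) + fun _ => c - ballAvg g x r) (ENNReal.ofReal q) (volume.restrict (ball x r)) := by
        congr 1; ext y; simp
    _ ≤ _ := eLpNorm_add_le hm aestronglyMeasurable_const (rz_one_le hq)
    _ ≤ _ := add_le_add hc h2
    _ = _ := by
        rw [← ENNReal.ofReal_add (by positivity) (by positivity)]
        congr 1; ring

lemma rz_global {n : ℕ} {q α A : ℝ} (hq : 1 < q) {ψ : REu n → ℝ → ℝ} (hψ : RzG ψ α A) :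
    ∃ C, 0 ≤ C ∧ ∀ (j : Fin n) (f : REu n → ℝ) (S : ℝ), RzCamp q ψ f S →
    ∃ g : REu n → ℝ, RzCamp q ψ g (C * S) ∧ |ballAvg g 0 1| ≤ C * S ∧ ∀ (z : REu n) (ρ : ℝ),
      Tendsto (fun ε => eLpNorm (fun x => rzW j ε f x - g x) (ENNReal.ofReal q) (volume.restrict (ball z ρ)))
        (nhdsWithin 0 (Set.Ioi 0)) (nhds 0) := by
  obtain ⟨C, hC, H⟩ := rz_local hq hψ
  have hp1 := hψ.pos 0 1 one_pos
  have hp2 := hψ.pos 0 2 two_pos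
  have hv := rzv_pos n
  set D := C * ψ 0 1 + ψ 0 2 * (rzv n * 2 ^ n) with hD
  have hD0 : 0 ≤ D := by positivity
  refine ⟨2 * C + D, by positivity, fun j f S hf => ?_⟩
  have hS := hf.nn
  have hft : RzTail f := hf.tail hq hψ
  obtain ⟨g, hg⟩ := rz_patch (rz_one_le hq) (F := fun ε => rzW j ε f)
    (fun ε => rzW_aesm j ε hf.loc.aestronglyMeasurable) (fun N => by
      obtain ⟨g, h1, h2, -⟩ := H j f S hf 0 (N + 1) (by positivity)
      exact ⟨g, h1, h2⟩)
  have key : ∀ x0 r, 0 < r → 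
      eLpNorm (fun x => g x - ∫ y, (kerK j (2 * r) (x0 - y) - kerK j 1 (0 - y)) * (f y - ballAvg f x0 (2 * r)))
        (ENNReal.ofReal q) (volume.restrict (ball x0 r)) ≤
        ENNReal.ofReal (C * S * ψ x0 r * (rzv n * r ^ n) ^ (1 / q)) := by
    intro x0 r hr
    obtain ⟨g0, h1, h2, h3⟩ := H j f S hf x0 r hr
    have hu := rz_uniq (rz_one_le hq) (fun ε => (rzW_aesm j ε hf.loc.aestronglyMeasurable).restrict)
      (hg x0 r).1.1 h1.1 (hg x0 r).2 h2
    refine (le_of_eq ?_).trans h3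
    apply eLpNorm_congr_ae
    filter_upwards [hu] with x hx
    rw [hx]
  have hcamp : RzCamp q ψ g (2 * (C * S)) :=
    rz_camp_of hq hψ.pos (by positivity) (fun x r _ => (hg x r).1) (fun x r hr => ⟨_, key x r hr⟩)
  have hb : |ballAvg g 0 1| ≤ D * S := by
    have k1 := key 0 1 one_pos
    rw [mul_one] at k1
    set c := ∫ y, (kerK j 2 (0 - y) - kerK j 1 (0 - y)) * (f y - ballAvg f 0 2) with hc
    have h1 : |ballAvg g 0 1 - c| ≤ C * S * ψ 0 1 :=
      rz_avg_sub hcamp.loc one_pos (by positivity)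
        (rz_holder hq one_pos ((hg 0 1).1.1.sub aestronglyMeasurable_const) k1)
    have h2 : |c| ≤ S * ψ 0 2 * (rzv n * 2 ^ n) := by
      have : ‖c‖ₑ ≤ ENNReal.ofReal (S * ψ 0 2 * (rzv n * 2 ^ n)) := by
        refine (enorm_integral_le_lintegral_enorm _).trans (le_trans ?_ (hf.l1 hq 0 two_pos))
        rw [← lintegral_indicator measurableSet_ball]
        apply lintegral_mono
        intro y
        beta_reduce
        by_cases hy : y ∈ ball (0 : REu n) 2
        · rw [Set.indicator_of_mem hy, enorm_mul]
          rw [mem_ball, dist_comm, dist_eq_norm] at hy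
          rw [kerK_zero j hy, zero_sub, enorm_neg]
          have := kerK_bdd j one_pos (0 - y)
          rw [one_pow, inv_one] at this
          calc _ ≤ 1 * ‖f y - ballAvg f 0 2‖ₑ := by
                gcongr
                rw [Real.enorm_eq_ofReal_abs, ← ENNReal.ofReal_one]
                exact ENNReal.ofReal_le_ofReal this
            _ = _ := one_mul _
        · rw [Set.indicator_of_notMem hy]
          rw [mem_ball, dist_comm, dist_eq_norm, not_lt] at hy
          rw [kerK_eq0 j hy, kerK_eq0 j (by linarith : 1 ≤ ‖0 - y‖), sub_self, zero_mul, enorm_zero]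
      rw [Real.enorm_eq_ofReal_abs] at this
      exact (ENNReal.ofReal_le_ofReal_iff (by positivity)).mp this
    have h3 : |ballAvg g 0 1| ≤ |ballAvg g 0 1 - c| + |c| := by
      have := abs_add_le (ballAvg g 0 1 - c) c
      rwa [sub_add_cancel] at this
    refine h3.trans ((add_le_add h1 h2).trans (le_of_eq ?_))
    rw [hD]; ring
  refine ⟨g, ⟨hcamp.loc, hcamp.mem, by positivity, fun x r hr => (hcamp.bd x r hr).trans ?_⟩, ?_, fun z ρ => (hg z ρ).2⟩
  · have := (hψ.pos x r hr).le
    apply ENNReal.ofReal_le_ofReal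
    have h5 : 2 * (C * S) ≤ (2 * C + D) * S := by nlinarith [mul_nonneg hD0 hS]
    exact mul_le_mul_of_nonneg_right (mul_le_mul_of_nonneg_right h5 this) (by positivity)
  · nlinarith [mul_nonneg hC hS]

lemma RzCamp.smul {n : ℕ} {q : ℝ} {ψ : REu n → ℝ → ℝ} {f : REu n → ℝ} {S : ℝ} 
    (hf : RzCamp q ψ f S) {c : ℝ} (hc : 0 ≤ c) : RzCamp q ψ (fun y => c * f y) (c * S) := by
  have hS := hf.nn
  refine ⟨hf.loc.smul c, fun x r hr => (hf.mem x r hr).const_mul c, by positivity, fun x r hr => ?_⟩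
  have e : (fun y => c * f y - ballAvg (fun y => c * f y) x r) = c • fun y => f y - ballAvg f x r := by
    ext y
    simp only [Pi.smul_apply, smul_eq_mul, ballAvg]
    rw [integral_const_mul]; ring
  rw [e, eLpNorm_const_smul, Real.enorm_of_nonneg hc, mul_assoc c, mul_assoc c, ENNReal.ofReal_mul hc]
  gcongr
  exact hf.bd x r hr

lemma RzCamp.sub_const {n : ℕ} {q : ℝ} {ψ : REu n → ℝ → ℝ} {f : REu n → ℝ} {S : ℝ} 
    (hf : RzCamp q ψ f S) (c : ℝ) : RzCamp q ψ (fun y => f y - c) S := by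
  refine ⟨hf.loc.sub (locallyIntegrable_const c), fun x r hr => (hf.mem x r hr).sub (rz_const_mem _ c _ _),
    hf.nn, fun x r hr => ?_⟩
  have hV : 0 < rzv n * r ^ n := mul_pos (rzv_pos n) (by positivity)
  have e : ballAvg (fun y => f y - c) x r = ballAvg f x r - c := by
    have hc : IntegrableOn (fun _ => c) (ball x r) := integrableOn_const (hs := measure_ball_lt_top.ne)
    unfold ballAvg
    rw [integral_sub (rz_locball hf.loc x r) hc, setIntegral_const, Measure.real, rz_vol' x hr,
      smul_eq_mul, mul_sub, ← mul_assoc, inv_mul_cancel₀ hV.ne', one_mul]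
  rw [e]
  convert hf.bd x r hr using 2
  ext y; ring

lemma rz_conv {n : ℕ} {q : ℝ} (hq : 1 < q) {g : REu n → ℝ} {x : REu n} {r M : ℝ} (hr : 0 < r) (hM : 0 ≤ M)
    (hg : MemLp g (ENNReal.ofReal q) (volume.restrict (ball x r))) :
    eLpNorm g (ENNReal.ofReal q) (volume.restrict (ball x r)) ≤ ENNReal.ofReal (M * (rzv n * r ^ n) ^ (1 / q)) ↔
    ((volume (ball x r)).toReal⁻¹ * ∫ y in ball x r, |g y| ^ q) ^ (1 / q) ≤ M := by
  have hV : 0 < rzv n * r ^ n := mul_pos (rzv_pos n) (by positivity)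
  rw [hg.eLpNorm_eq_integral_rpow_norm (one_pos.trans_le (rz_one_le hq)).ne' ENNReal.ofReal_ne_top,
    ENNReal.toReal_ofReal (by linarith), ENNReal.ofReal_le_ofReal_iff (by positivity), rz_vol' x hr]
  have hI : 0 ≤ ∫ y in ball x r, |g y| ^ q := integral_nonneg fun y => by positivity
  rw [Real.mul_rpow (by positivity) hI, Real.inv_rpow hV.le, inv_mul_le_iff₀ (by positivity), mul_comm M, one_div]
  rfl

lemma rz_toCamp {n : ℕ} {q : ℝ} (hq : 1 < q) {ψ : REu n → ℝ → ℝ} (hψ : ∀ x r, 0 < r → 0 < ψ x r)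
    {f : REu n → ℝ} (hf : MemLpLoc q f) (h : campSemi q ψ f < ⊤) : RzCamp q ψ f (campSemi q ψ f).toReal := by
  have hm : ∀ x r, 0 < r → MemLp f (ENNReal.ofReal q) (volume.restrict (ball x r)) := by
    intro x r hr
    rw [← integrable_norm_rpow_iff hf.1.aestronglyMeasurable.restrict (one_pos.trans_le (rz_one_le hq)).ne'
      ENNReal.ofReal_ne_top, ENNReal.toReal_ofReal (by linarith)]
    exact hf.2 x r hr
  refine ⟨hf.1, hm, ENNReal.toReal_nonneg, fun x r hr => ?_⟩
  have hp := hψ x r hr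
  refine (rz_conv hq hr (by positivity) ((hm x r hr).sub (rz_const_mem _ _ _ _))).mpr ?_
  have h1 : ENNReal.ofReal ((ψ x r)⁻¹ * ((volume (ball x r)).toReal⁻¹ *
      ∫ y in ball x r, |f y - ballAvg f x r| ^ q) ^ (1 / q)) ≤ campSemi q ψ f :=
    le_iSup_of_le x (le_iSup_of_le r (le_iSup_of_le hr le_rfl))
  rw [ENNReal.ofReal_le_iff_le_toReal h.ne, inv_mul_le_iff₀ hp, mul_comm (ψ x r)] at h1
  exact h1

lemma RzCamp.semi_le {n : ℕ} {q : ℝ} (hq : 1 < q) {ψ : REu n → ℝ → ℝ} (hψ : ∀ x r, 0 < r → 0 < ψ x r)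
    {f : REu n → ℝ} {S : ℝ} (h : RzCamp q ψ f S) : campSemi q ψ f ≤ ENNReal.ofReal S := by
  refine iSup_le fun x => iSup_le fun r => iSup_le fun hr => ?_
  have hS := h.nn
  have hp := hψ x r hr
  apply ENNReal.ofReal_le_ofReal
  rw [inv_mul_le_iff₀ hp, mul_comm (ψ x r)]
  exact (rz_conv hq hr (by positivity) ((h.mem x r hr).sub (rz_const_mem _ _ _ _))).mp (h.bd x r hr)

lemma rz_kereq {n : ℕ} (j : Fin n) {ε : ℝ} {x y : REu n} (h : ε ≤ dist x y) :
    (x j - y j) / dist x y ^ ((n : ℝ) + 1) = kerK j ε (x - y) := by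
  rw [dist_eq_norm] at *
  unfold kerK
  rw [if_pos h, show ((n : ℝ) + 1) = ((n + 1 : ℕ) : ℝ) by push_cast; rfl, Real.rpow_natCast]
  rfl

lemma rz_kereq1 {n : ℕ} (j : Fin n) (y : REu n) :
    (-(y j)) * (1 - Set.indicator (ball (0 : EuclideanSpace ℝ (Fin n)) 1)
        (fun _ => (1 : ℝ)) y) / ‖y‖ ^ ((n : ℝ) + 1) = kerK j 1 (0 - y) := by
  rw [show ((n : ℝ) + 1) = ((n + 1 : ℕ) : ℝ) by push_cast; rfl, Real.rpow_natCast]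
  unfold kerK
  rw [zero_sub, norm_neg]
  by_cases h : 1 ≤ ‖y‖
  · rw [if_pos h, Set.indicator_of_notMem (by rw [mem_ball_zero_iff]; linarith), sub_zero, mul_one]
    rfl
  · rw [if_neg h, Set.indicator_of_mem (by rw [mem_ball_zero_iff]; linarith), sub_self, mul_zero, zero_div]

lemma rz_dset {n : ℕ} (x : REu n) (ε : ℝ) : MeasurableSet {y : REu n | ε ≤ dist x y} :=
  measurableSet_le measurable_const (by fun_prop)

def rzErr {n : ℕ} (j : Fin n) (ε : ℝ) (f : REu n → ℝ) (x : REu n) : ℝ :=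
  ∫ y, (if ‖x - y‖ < ε then kerK j 1 (0 - y) else 0) * f y

lemma rzErr_meas {n : ℕ} (j : Fin n) (ε : ℝ) :
    Measurable (fun p : REu n × REu n => if ‖p.1 - p.2‖ < ε then kerK j 1 (0 - p.2) else 0) :=
  Measurable.ite (measurableSet_lt (by fun_prop) measurable_const)
    ((kerK_meas j 1).comp (measurable_const.sub measurable_snd)) measurable_const

lemma rzErr_aesm {n : ℕ} (j : Fin n) (ε : ℝ) {f : REu n → ℝ} (hf : AEStronglyMeasurable f volume) :
    AEStronglyMeasurable (rzErr j ε f) volume := by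
  have := rz_int_aesm (rzErr_meas j ε) hf Set.univ Set.univ
  simp only [Measure.restrict_univ] at this
  exact this

lemma rzErr_eq {n : ℕ} (j : Fin n) (ε : ℝ) (f : REu n → ℝ) (x : REu n) :
    (fun y => (if ‖x - y‖ < ε then kerK j 1 (0 - y) else 0) * f y) =
      (ball x ε).indicator (fun y => kerK j 1 (0 - y) * f y) := by
  ext y
  by_cases h : ‖x - y‖ < ε
  · rw [if_pos h, Set.indicator_of_mem (by rwa [mem_ball, dist_comm, dist_eq_norm])]
  · rw [if_neg h, Set.indicator_of_notMem (by rwa [mem_ball, dist_comm, dist_eq_norm]), zero_mul]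

lemma rzErr_int {n : ℕ} (j : Fin n) (ε : ℝ) {f : REu n → ℝ} (hf : LocallyIntegrable f volume) (x : REu n) :
    Integrable (fun y => (if ‖x - y‖ < ε then kerK j 1 (0 - y) else 0) * f y) := by
  rw [rzErr_eq, integrable_indicator_iff measurableSet_ball]
  exact (rz_locball hf x ε).bdd_mul (c := ((1:ℝ) ^ n)⁻¹)
    ((kerK_meas j 1).comp (measurable_const.sub measurable_id)).aestronglyMeasurable
      (Eventually.of_forall fun y => kerK_bdd j one_pos _)

lemma rz_mod_ind {n : ℕ} (j : Fin n) (ε : ℝ) (f : REu n → ℝ) (x : REu n) :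
    {y : REu n | ε ≤ dist x y}.indicator (fun y =>
      ((x j - y j) / dist x y ^ ((n : ℝ) + 1) -
      (-(y j)) * (1 - Set.indicator (ball (0 : EuclideanSpace ℝ (Fin n)) 1)
        (fun _ => (1 : ℝ)) y) / ‖y‖ ^ ((n : ℝ) + 1)) * f y) =
    fun y => (kerK j ε (x - y) - kerK j 1 (0 - y)) * f y +
      (if ‖x - y‖ < ε then kerK j 1 (0 - y) else 0) * f y := by
  ext y
  rw [Set.indicator_apply]
  by_cases h : ε ≤ dist x y
  · rw [if_pos (by exact h), rz_kereq j h, rz_kereq1]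
    rw [dist_eq_norm] at h
    rw [if_neg (by linarith), zero_mul, add_zero]
  · rw [if_neg (by exact h)]
    rw [dist_eq_norm, not_le] at h
    rw [if_pos h, kerK_zero j h]; ring

lemma rz_mod_int {n : ℕ} (j : Fin n) {f : REu n → ℝ} (hf : RzTail f) {ε : ℝ} (hε : 0 < ε) (x : REu n) :
    IntegrableOn (fun y =>
      ((x j - y j) / dist x y ^ ((n : ℝ) + 1) -
      (-(y j)) * (1 - Set.indicator (ball (0 : EuclideanSpace ℝ (Fin n)) 1)
        (fun _ => (1 : ℝ)) y) / ‖y‖ ^ ((n : ℝ) + 1)) * f y) {y : REu n | ε ≤ dist x y} volume := by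
  rw [← integrable_indicator_iff (rz_dset x ε), rz_mod_ind]
  exact (rz_kint j hf hε one_pos x 0).add (rzErr_int j ε hf.loc x)

lemma rz_mod_eq {n : ℕ} (j : Fin n) {f : REu n → ℝ} (hf : RzTail f) {ε : ℝ} (hε : 0 < ε) (x : REu n) :
    modRieszTrunc j ε f x = rieszConst n * (rzW j ε f x + rzErr j ε f x) := by
  unfold modRieszTrunc
  congr 1
  rw [← integral_indicator (rz_dset x ε), rz_mod_ind,
    integral_add (rz_kint j hf hε one_pos x 0) (rzErr_int j ε hf.loc x)]
  rfl

lemma rzErr_lim {n : ℕ} {q : ℝ} (hq : 1 < q) (j : Fin n) {f : REu n → ℝ} (hf : LocallyIntegrable f volume)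
    (hm : ∀ x r, 0 < r → MemLp f (ENNReal.ofReal q) (volume.restrict (ball x r))) (z : REu n) {ρ : ℝ} (hρ : 0 < ρ) :
    Tendsto (fun ε => eLpNorm (rzErr j ε f) (ENNReal.ofReal q) (volume.restrict (ball z ρ)))
      (nhdsWithin 0 (Set.Ioi 0)) (nhds 0) := by
  have hn : n ≠ 0 := by rintro rfl; exact j.elim0
  have hv := rzv_pos n
  set N := (eLpNorm f (ENNReal.ofReal q) (volume.restrict (ball z (ρ + 1)))).toReal with hN
  have hq1 : 0 < 1 - 1 / q := by
    rw [sub_pos, div_lt_one (by linarith)]; exact hq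
  have lim : Tendsto (fun ε : ℝ => ENNReal.ofReal (N * (rzv n * ε ^ n) ^ (1 - 1 / q) * (rzv n * ρ ^ n) ^ (1 / q)))
      (nhdsWithin 0 (Set.Ioi 0)) (nhds 0) := by
    have hc : Continuous (fun ε : ℝ => ENNReal.ofReal (N * (rzv n * ε ^ n) ^ (1 - 1 / q) * (rzv n * ρ ^ n) ^ (1 / q))) := by
      apply ENNReal.continuous_ofReal.comp
      refine (continuous_const.mul (Continuous.rpow_const (by fun_prop) (fun _ => Or.inr hq1.le))).mul continuous_const
    have := (hc.tendsto 0).mono_left (nhdsWithin_le_nhds (s := Set.Ioi 0))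
    rwa [zero_pow hn, mul_zero, Real.zero_rpow hq1.ne', mul_zero, zero_mul, ENNReal.ofReal_zero] at this
  refine tendsto_of_tendsto_of_tendsto_of_le_of_le' tendsto_const_nhds lim
      (Eventually.of_forall fun _ => zero_le) ?_
  filter_upwards [Ioc_mem_nhdsGT one_pos] with ε hε
  have hε0 := hε.1
  apply rz_eLp_bdd hq hρ (by positivity)
  intro x hx
  have hsub : ball x ε ⊆ ball z (ρ + 1) := by
    intro y hy
    rw [mem_ball] at *
    linarith [dist_triangle y x z, hε.2]
  have hV : 0 < rzv n * ε ^ n := by positivity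
  have h1 : eLpNorm f (ENNReal.ofReal q) (volume.restrict (ball x ε)) ≤
      ENNReal.ofReal (N * ((rzv n * ε ^ n) ^ (1 / q))⁻¹ * (rzv n * ε ^ n) ^ (1 / q)) := by
    rw [mul_assoc, inv_mul_cancel₀ (by positivity), mul_one, hN,
      ENNReal.ofReal_toReal (hm z (ρ + 1) (by positivity)).2.ne]
    exact eLpNorm_mono_measure _ (Measure.restrict_mono_set _ hsub)
  have h2 := rz_holder hq hε.1 hf.aestronglyMeasurable.restrict h1
  have h3 : ‖rzErr j ε f x‖ₑ ≤ ENNReal.ofReal (N * ((rzv n * ε ^ n) ^ (1 / q))⁻¹ * (rzv n * ε ^ n)) := by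
    refine le_trans ?_ h2
    unfold rzErr
    rw [rzErr_eq, integral_indicator measurableSet_ball]
    refine (enorm_integral_le_lintegral_enorm _).trans (lintegral_mono fun y => ?_)
    rw [enorm_mul]
    have := kerK_bdd j one_pos (0 - y)
    rw [one_pow, inv_one] at this
    calc _ ≤ 1 * ‖f y‖ₑ := by
          gcongr
          rw [Real.enorm_eq_ofReal_abs, ← ENNReal.ofReal_one]
          exact ENNReal.ofReal_le_ofReal this
      _ = _ := one_mul _
  rw [Real.enorm_eq_ofReal_abs] at h3
  have h4 := (ENNReal.ofReal_le_ofReal_iff (by positivity)).mp h3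
  refine h4.trans (le_of_eq ?_)
  rw [Real.rpow_sub hV, Real.rpow_one]; ring

lemma rieszConst_nonneg (n : ℕ) : 0 ≤ rieszConst n := by
  unfold rieszConst
  have := Real.Gamma_pos_of_pos (by positivity : (0:ℝ) < ((n : ℝ) + 1) / 2)
  positivity

lemma rz_mod_lim {n : ℕ} {q : ℝ} (hq : 1 < q) (j : Fin n) {f g : REu n → ℝ} (hf : RzTail f)
    (hm : ∀ x r, 0 < r → MemLp f (ENNReal.ofReal q) (volume.restrict (ball x r))) (z : REu n) {ρ : ℝ} (hρ : 0 < ρ)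
    (hg : AEStronglyMeasurable g volume)
    (h : Tendsto (fun ε => eLpNorm (fun x => rzW j ε f x - g x) (ENNReal.ofReal q) (volume.restrict (ball z ρ)))
        (nhdsWithin 0 (Set.Ioi 0)) (nhds 0)) :
    Tendsto (fun ε => eLpNorm (fun x => modRieszTrunc j ε f x - rieszConst n * g x) (ENNReal.ofReal q)
      (volume.restrict (ball z ρ))) (nhdsWithin 0 (Set.Ioi 0)) (nhds 0) := by
  have h1 := ENNReal.Tendsto.const_mul (a := ‖rieszConst n‖ₑ) (h.add (rzErr_lim hq j hf.loc hm z hρ))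
    (Or.inr (by simp))
  rw [add_zero, mul_zero] at h1
  refine tendsto_of_tendsto_of_tendsto_of_le_of_le' tendsto_const_nhds h1
      (Eventually.of_forall fun _ => zero_le) ?_
  filter_upwards [self_mem_nhdsWithin] with ε hε
  have hε : 0 < ε := hε
  have e : (fun x => modRieszTrunc j ε f x - rieszConst n * g x) =
      rieszConst n • ((fun x => rzW j ε f x - g x) + rzErr j ε f) := by
    ext x
    rw [rz_mod_eq j hf hε]
    simp only [Pi.smul_apply, Pi.add_apply, smul_eq_mul]; ring
  rw [e, eLpNorm_const_smul]
  gcongr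
  exact eLpNorm_add_le ((rzW_aesm j ε hf.loc.aestronglyMeasurable).sub hg).restrict
    (rzErr_aesm j ε hf.loc.aestronglyMeasurable).restrict (rz_one_le hq)

lemma rz_tele {n : ℕ} {q β K : ℝ} (hq : 1 < q) {ψ : REu n → ℝ → ℝ} (hψ : ∀ x r, 0 < r → 0 < ψ x r)
    (hβ : β < 0) (hK0 : 0 ≤ K) (hK : ∀ r, 1 ≤ r → ψ 0 r ≤ K * r ^ β) {f : REu n → ℝ} {S : ℝ}
    (hf : RzCamp q ψ f S) (hσ : Tendsto (fun r => ballAvg f 0 r) atTop (nhds 0)) {r : ℝ} (hr : 1 ≤ r) :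
    |ballAvg f 0 r| ≤ 2 ^ n * K * (1 - 2 ^ β)⁻¹ * S * r ^ β := by
  have hS := hf.nn
  have hr0 : 0 < r := by linarith
  have ha : (2:ℝ) ^ β < 1 := Real.rpow_lt_one_of_one_lt_of_neg one_lt_two hβ
  have ha0 : (0:ℝ) < 2 ^ β := by positivity
  have ha' : 0 < 1 - (2:ℝ) ^ β := by linarith
  set D := 2 ^ n * K * (1 - (2:ℝ) ^ β)⁻¹ * S * r ^ β with hD
  have hD0 : 0 ≤ D := by positivity
  have ind : ∀ k : ℕ, |ballAvg f 0 (2 ^ k * r) - ballAvg f 0 r| ≤ D * (1 - (2 ^ β) ^ k) := by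
    intro k
    induction k with
    | zero => simp
    | succ k ih =>
      have h1 := hf.l2 hq 0 (r := 2 ^ k * r) (by positivity) (hψ _ _ (by positivity)).le
      have h2k : (1:ℝ) ≤ 2 ^ (k + 1) := one_le_pow₀ one_le_two
      have h2 := hK (2 ^ (k + 1) * r) (by nlinarith)
      rw [show 2 * (2 ^ k * r) = 2 ^ (k + 1) * r by ring] at h1
      have e1 : ((2:ℝ) ^ (k + 1) * r) ^ β = (2 ^ β) ^ (k + 1) * r ^ β := by
        rw [Real.mul_rpow (by positivity) hr0.le]
        congr 1
        rw [← Real.rpow_natCast, ← Real.rpow_mul zero_le_two, mul_comm, Real.rpow_mul zero_le_two, Real.rpow_natCast]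
      rw [e1] at h2
      have h3 : |ballAvg f 0 (2 ^ k * r) - ballAvg f 0 (2 ^ (k + 1) * r)| ≤
          D * ((2 ^ β) ^ k - (2 ^ β) ^ (k + 1)) := by
        refine h1.trans ?_
        calc 2 ^ n * S * ψ 0 (2 ^ (k + 1) * r) ≤ 2 ^ n * S * (K * ((2 ^ β) ^ (k + 1) * r ^ β)) := by gcongr
          _ ≤ 2 ^ n * S * (K * ((2 ^ β) ^ k * r ^ β)) := by
              have : ((2:ℝ) ^ β) ^ (k + 1) ≤ (2 ^ β) ^ k := pow_le_pow_of_le_one ha0.le ha.le (by omega)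
              gcongr
          _ = _ := by
              rw [hD, pow_succ]; field_simp
      have h4 : |ballAvg f 0 (2 ^ (k + 1) * r) - ballAvg f 0 r| ≤
        |ballAvg f 0 (2 ^ k * r) - ballAvg f 0 (2 ^ (k + 1) * r)| + |ballAvg f 0 (2 ^ k * r) - ballAvg f 0 r| := by
        rw [abs_sub_comm (ballAvg f 0 (2 ^ k * r))]
        exact abs_sub_le _ _ _
      linarith
  have ht : Tendsto (fun k : ℕ => (2:ℝ) ^ k * r) atTop atTop :=
    (tendsto_pow_atTop_atTop_of_one_lt one_lt_two).atTop_mul_const hr0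
  have hl : Tendsto (fun k : ℕ => |ballAvg f 0 (2 ^ k * r) - ballAvg f 0 r|) atTop (nhds |0 - ballAvg f 0 r|) :=
    ((hσ.comp ht).sub_const _).abs
  rw [zero_sub, abs_neg] at hl
  refine le_of_tendsto hl (Eventually.of_forall fun k => (ind k).trans ?_)
  have : 0 ≤ ((2:ℝ) ^ β) ^ k := by positivity
  nlinarith

/-- uniform decay bounds when the mean at infinity vanishes -/
lemma rz_decay {n : ℕ} {q β K : ℝ} (hq : 1 < q) {ψ : REu n → ℝ → ℝ} (hψ : ∀ x r, 0 < r → 0 < ψ x r)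
    (hβ : β < 0) (hK0 : 0 ≤ K) (hK : ∀ r, 1 ≤ r → ψ 0 r ≤ K * r ^ β) :
    ∃ C, 0 ≤ C ∧ ∀ (f : REu n → ℝ) (S : ℝ), RzCamp q ψ f S → Tendsto (fun r => ballAvg f 0 r) atTop (nhds 0) →
      ∀ r, 1 ≤ r → eLpNorm f (ENNReal.ofReal q) (volume.restrict (ball 0 r)) ≤
          ENNReal.ofReal (C * S * r ^ β * (rzv n * r ^ n) ^ (1 / q)) ∧
        ∫⁻ y in (ball 0 r)ᶜ, ‖f y‖ₑ * ENNReal.ofReal ((‖0 - y‖ ^ n)⁻¹) ≤ ENNReal.ofReal (C * S * r ^ β) := by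
  have hv := rzv_pos n
  have ha : (2:ℝ) ^ β < 1 := Real.rpow_lt_one_of_one_lt_of_neg one_lt_two hβ
  have ha0 : (0:ℝ) < 2 ^ β := by positivity
  have ha' : 0 < 1 - (2:ℝ) ^ β := by linarith
  set C0 := K + 2 ^ n * K * (1 - (2:ℝ) ^ β)⁻¹ with hC0
  have hC00 : 0 ≤ C0 := by positivity
  set C1 := C0 * rzv n * 2 ^ n * 2 ^ β * (1 - 2 ^ β)⁻¹ with hC1
  have hC10 : 0 ≤ C1 := by positivity
  refine ⟨C0 + C1, by positivity, fun f S hf hσ => ?_⟩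
  have hS := hf.nn
  have key : ∀ r, 1 ≤ r → eLpNorm f (ENNReal.ofReal q) (volume.restrict (ball 0 r)) ≤
          ENNReal.ofReal (C0 * S * r ^ β * (rzv n * r ^ n) ^ (1 / q)) := by
    intro r hr
    have hr0 : 0 < r := by linarith
    have h1 := rz_tele hq hψ hβ hK0 hK hf hσ hr
    have h2 := rz_eLp_bdd hq (g := fun _ : REu n => ballAvg f 0 r) (x := (0 : REu n)) hr0 (by positivity :
      0 ≤ 2 ^ n * K * (1 - (2:ℝ) ^ β)⁻¹ * S * r ^ β) (fun y _ => h1)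
    have h3 := hf.bd 0 r hr0
    calc eLpNorm f (ENNReal.ofReal q) (volume.restrict (ball 0 r)) =
        eLpNorm ((fun y => f y - ballAvg f 0 r) + fun _ => ballAvg f 0 r) (ENNReal.ofReal q) (volume.restrict (ball 0 r)) := by
          congr 1; ext y; simp
      _ ≤ _ := eLpNorm_add_le ((hf.loc.aestronglyMeasurable.sub aestronglyMeasurable_const).restrict)
          aestronglyMeasurable_const (rz_one_le hq)
      _ ≤ ENNReal.ofReal (S * (K * r ^ β) * (rzv n * r ^ n) ^ (1 / q)) + _ := by
          refine add_le_add (h3.trans (ENNReal.ofReal_le_ofReal ?_)) h2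
          have := hK r hr
          gcongr
      _ = _ := by
          rw [← ENNReal.ofReal_add (by positivity) (by positivity)]
          congr 1; rw [hC0]; ring
  intro r hr
  have hr0 : 0 < r := by linarith
  constructor
  · refine (key r hr).trans (ENNReal.ofReal_le_ofReal ?_)
    gcongr
    linarith
  · refine (rz_dyadic 0 hr0 f hf.loc.aestronglyMeasurable n (C0 * S * rzv n * 2 ^ n * 2 ^ β * r ^ β) β
      (by positivity) hβ ?_).trans (ENNReal.ofReal_le_ofReal ?_)
    · intro k
      have h2k : (1:ℝ) ≤ 2 ^ (k + 1) := one_le_pow₀ one_le_two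
      refine (rz_holder hq (by positivity) hf.loc.aestronglyMeasurable.restrict
        (key (2 ^ (k + 1) * r) (by nlinarith))).trans (le_of_eq ?_)
      congr 1
      have e1 : ((2:ℝ) ^ (k + 1) * r) ^ β = (2 ^ β) ^ (k + 1) * r ^ β := by
        rw [Real.mul_rpow (by positivity) hr0.le]
        congr 1
        rw [← Real.rpow_natCast, ← Real.rpow_mul zero_le_two, mul_comm, Real.rpow_mul zero_le_two, Real.rpow_natCast]
      rw [e1, pow_succ (2:ℝ) k, pow_succ _ k, mul_pow, mul_pow, mul_pow]
      ring
    · calc C0 * S * rzv n * 2 ^ n * 2 ^ β * r ^ β * (1 - 2 ^ β)⁻¹ = C1 * S * r ^ β := by rw [hC1]; ring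
        _ ≤ _ := by gcongr; linarith

lemma rz_k1int {n : ℕ} (j : Fin n) {f : REu n → ℝ} (hf : LocallyIntegrable f volume)
    (h : ∫⁻ y in (ball 0 1)ᶜ, ‖f y‖ₑ * ENNReal.ofReal ((‖0 - y‖ ^ n)⁻¹) < ⊤) :
    Integrable (fun y => kerK j 1 (0 - y) * f y) := by
  have hmk : Measurable (fun y : REu n => kerK j 1 (0 - y)) := (kerK_meas j 1).comp (by fun_prop)
  refine ⟨hmk.aestronglyMeasurable.mul hf.aestronglyMeasurable, ?_⟩
  refine lt_of_le_of_lt ?_ h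
  rw [← lintegral_indicator measurableSet_ball.compl]
  apply lintegral_mono
  intro y
  beta_reduce
  by_cases hy : y ∈ (ball (0 : REu n) 1)ᶜ
  · rw [Set.indicator_of_mem hy, enorm_mul, mul_comm, Real.enorm_eq_ofReal_abs (kerK j 1 (0 - y))]
    gcongr
    exact kerK_le j 1 (0 - y)
  · rw [Set.indicator_of_notMem hy]
    rw [Set.mem_compl_iff, not_not, mem_ball, dist_comm, dist_eq_norm] at hy
    rw [kerK_zero j hy, zero_mul, enorm_zero]

lemma rz_keint {n : ℕ} (j : Fin n) {f : REu n → ℝ} (hf : RzTail f)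
    (h : Integrable (fun y => kerK j 1 (0 - y) * f y)) {ε : ℝ} (hε : 0 < ε) (x : REu n) :
    Integrable (fun y => kerK j ε (x - y) * f y) := by
  refine ((rz_kint j hf hε one_pos x 0).add h).congr (Eventually.of_forall fun y => ?_)
  simp only [Pi.add_apply]; ring

lemma rzT_W {n : ℕ} (j : Fin n) {f : REu n → ℝ} (hf : RzTail f)
    (h : Integrable (fun y => kerK j 1 (0 - y) * f y)) {ε : ℝ} (hε : 0 < ε) (x : REu n) :
    rzT j ε f x = rzW j ε f x + ∫ y, kerK j 1 (0 - y) * f y := by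
  unfold rzW
  rw [rzT_eq, ← integral_add (rz_kint j hf hε one_pos x 0) h]
  congr 1; ext y; ring

lemma rz_trunc_eq {n : ℕ} (j : Fin n) (f : REu n → ℝ) (ε : ℝ) (x : REu n) :
    rieszTrunc j ε f x = rieszConst n * rzT j ε f x := by
  unfold rieszTrunc
  congr 1
  rw [rzT_eq, ← integral_indicator (rz_dset x ε)]
  congr 1; ext y
  rw [Set.indicator_apply]
  by_cases h : ε ≤ dist x y
  · rw [if_pos (by exact h), rz_kereq j h]
  · rw [if_neg (by exact h)]
    rw [dist_eq_norm, not_le] at h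
    rw [kerK_zero j h, zero_mul]

/-- uniform bound of truncations on centered balls -/
lemma rz_T_ball {n : ℕ} {q β K : ℝ} (hq : 1 < q) {ψ : REu n → ℝ → ℝ} (hψ : ∀ x r, 0 < r → 0 < ψ x r)
    (hβ : β < 0) (hK0 : 0 ≤ K) (hK : ∀ r, 1 ≤ r → ψ 0 r ≤ K * r ^ β) :
    ∃ C, 0 ≤ C ∧ ∀ (j : Fin n) (f : REu n → ℝ) (S : ℝ), RzCamp q ψ f S → RzTail f → 
      Tendsto (fun r => ballAvg f 0 r) atTop (nhds 0) →
      ∀ r, 1 ≤ r → ∀ ε, 0 < ε → eLpNorm (rzT j ε f) (ENNReal.ofReal q) (volume.restrict (ball 0 r)) ≤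
          ENNReal.ofReal (C * S * r ^ β * (rzv n * r ^ n) ^ (1 / q)) := by
  obtain ⟨C, hC, H⟩ := rz_decay hq hψ hβ hK0 hK
  obtain ⟨A0, HA⟩ := rz_Tn (n := n) q hq
  have hv := rzv_pos n
  refine ⟨A0 * C * 2 ^ β * ((2:ℝ) ^ n) ^ (1 / q) + 2 ^ n * C * 2 ^ β, by positivity, ?_⟩
  intro j f S hf hft hσ r hr ε hε
  have hS := hf.nn
  have hr0 : 0 < r := by linarith
  have h1 : Integrable (fun y => kerK j 1 (0 - y) * f y) :=
    rz_k1int j hf.loc ((H f S hf hσ 1 le_rfl).2.trans_lt ENNReal.ofReal_lt_top)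
  obtain ⟨h2, h3⟩ := H f S hf hσ (2 * r) (by linarith)
  rw [Real.mul_rpow zero_le_two hr0.le] at h2 h3
  set fχ := (ball 0 (2 * r)).indicator f with hfχ
  have hfi : Integrable fχ := (rz_locball hf.loc 0 (2 * r)).integrable_indicator measurableSet_ball
  set G : REu n → ℝ := fun x => ∫ y in (ball 0 (2 * r))ᶜ, kerK j ε (x - y) * f y with hG
  have e : rzT j ε f = rzT j ε fχ + G := by
    ext x
    have i := rz_keint j hft h1 hε x
    rw [rzT_eq, ← integral_add_compl (measurableSet_ball (x := 0) (ε := 2 * r)) i, Pi.add_apply]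
    congr 1
    rw [rzT_eq, ← integral_indicator measurableSet_ball]
    congr 1; ext y
    by_cases hy : y ∈ ball (0 : REu n) (2 * r)
    · rw [Set.indicator_of_mem hy, hfχ, Set.indicator_of_mem hy]
    · rw [Set.indicator_of_notMem hy, hfχ, Set.indicator_of_notMem hy, mul_zero]
  have hGm : AEStronglyMeasurable G (volume.restrict (ball 0 r)) :=
    rz_int_aesm (kerK_meas2 j ε) hf.loc.aestronglyMeasurable _ _
  have hGb : ∀ x ∈ ball (0 : REu n) r, |G x| ≤ 2 ^ n * (C * S * (2 ^ β * r ^ β)) := by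
    intro x hx
    rw [mem_ball_zero_iff] at hx
    have : ‖G x‖ₑ ≤ ENNReal.ofReal (2 ^ n * (C * S * (2 ^ β * r ^ β))) := by
      refine (enorm_integral_le_lintegral_enorm _).trans ?_
      rw [ENNReal.ofReal_mul (by positivity)]
      refine le_trans ?_ (mul_le_mul' le_rfl h3)
      rw [← lintegral_const_mul' _ _ ENNReal.ofReal_ne_top]
      apply setLIntegral_mono' measurableSet_ball.compl
      intro y hy
      rw [Set.mem_compl_iff, mem_ball, not_lt, dist_comm, dist_eq_norm, zero_sub, norm_neg] at hy
      have hxy : ‖y‖ ≤ ‖x‖ + ‖x - y‖ := by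
        exact norm_le_norm_add_norm_sub x y
      have hy0 : 0 < ‖y‖ := by linarith
      have hk : |kerK j ε (x - y)| ≤ 2 ^ n * (‖0 - y‖ ^ n)⁻¹ := by
        refine (kerK_le j ε (x - y)).trans ?_
        rw [zero_sub, norm_neg, ← div_eq_mul_inv, ← div_pow, ← inv_pow]
        gcongr
        rw [inv_le_comm₀ (by linarith) (by positivity), inv_div]
        linarith
      rw [enorm_mul, mul_comm ‖f y‖ₑ, ← mul_assoc, ← ENNReal.ofReal_mul (by positivity), Real.enorm_eq_ofReal_abs]
      gcongr
    rw [Real.enorm_eq_ofReal_abs] at this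
    exact (ENNReal.ofReal_le_ofReal_iff (by positivity)).mp this
  have hGn := rz_eLp_bdd hq hr0 (by positivity) hGb
  have hTm := (rzT_aesm j ε hfi).aestronglyMeasurable (μ := volume.restrict (ball 0 r))
  have hχn : eLpNorm fχ (ENNReal.ofReal q) volume ≤
      ENNReal.ofReal (C * S * (2 ^ β * r ^ β) * (rzv n * (2 * r) ^ n) ^ (1 / q)) := by
    rw [hfχ, eLpNorm_indicator_eq_eLpNorm_restrict measurableSet_ball]
    exact h2
  rw [e]
  refine (eLpNorm_add_le hTm hGm (rz_one_le hq)).trans ?_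
  calc eLpNorm (rzT j ε fχ) (ENNReal.ofReal q) (volume.restrict (ball 0 r)) +
        eLpNorm G (ENNReal.ofReal q) (volume.restrict (ball 0 r))
      ≤ A0 * ENNReal.ofReal (C * S * (2 ^ β * r ^ β) * (rzv n * (2 * r) ^ n) ^ (1 / q)) +
        ENNReal.ofReal (2 ^ n * (C * S * (2 ^ β * r ^ β)) * (rzv n * r ^ n) ^ (1 / q)) := by
        refine add_le_add ?_ hGn
        refine (eLpNorm_restrict_le _ _ _ _).trans ((HA j fχ hfi ε hε).trans ?_)
        gcongr
    _ = _ := by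
        rw [← ENNReal.ofReal_coe_nnreal, ← ENNReal.ofReal_mul (by positivity),
          ← ENNReal.ofReal_add (by positivity) (by positivity)]
        rw [show rzv n * (2 * r) ^ n = 2 ^ n * (rzv n * r ^ n) by rw [mul_pow]; ring,
            Real.mul_rpow (by positivity) (by positivity)]
        congr 1; ring

lemma rz_avg_smul {n : ℕ} (c : ℝ) (g : REu n → ℝ) (x : REu n) (r : ℝ) :
    ballAvg (fun y => c * g y) x r = c * ballAvg g x r := by
  unfold ballAvg
  rw [integral_const_mul]; ring

lemma rz_partI {n : ℕ} {q α A : ℝ} (hq : 1 < q) {ψ : REu n → ℝ → ℝ} (hψ : RzG ψ α A) :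
    ∃ C, 0 ≤ C ∧ ∀ (f : REu n → ℝ) (S : ℝ), RzCamp q ψ f S → ∀ j : Fin n, ∃ g : REu n → ℝ,
      RzCamp q ψ g (C * S) ∧ |ballAvg g 0 1| ≤ C * S ∧
      ∀ (z : REu n) (ρ : ℝ), 0 < ρ →
            Tendsto (fun ε : ℝ => eLpNorm (fun x => modRieszTrunc j ε f x - g x)
                (ENNReal.ofReal q) (volume.restrict (ball z ρ)))
              (nhdsWithin 0 (Set.Ioi 0)) (nhds 0) := by
  obtain ⟨C, hC, H⟩ := rz_global hq hψ
  have hc := rieszConst_nonneg n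
  refine ⟨rieszConst n * C, by positivity, fun f S hf j => ?_⟩
  obtain ⟨g, h1, h2, h3⟩ := H j f S hf
  refine ⟨fun y => rieszConst n * g y, ?_, ?_, fun z ρ hρ => ?_⟩
  · rw [mul_assoc]; exact h1.smul hc
  · rw [rz_avg_smul, abs_mul, abs_of_nonneg hc, mul_assoc]; gcongr
  · exact rz_mod_lim hq j (hf.tail hq hψ) hf.mem z hρ h1.loc.aestronglyMeasurable (h3 z ρ)

lemma rz_partII {n : ℕ} {q α A β K : ℝ} (hq : 1 < q) {ψ : REu n → ℝ → ℝ} (hψ : RzG ψ α A)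
    (hβ : β < 0) (hK0 : 0 ≤ K) (hK : ∀ r, 1 ≤ r → ψ 0 r ≤ K * r ^ β) :
    ∃ C, 0 ≤ C ∧ ∀ (f : REu n → ℝ) (S : ℝ), RzCamp q ψ f S →
      Tendsto (fun r => ballAvg f 0 r) atTop (nhds 0) → ∀ j : Fin n, ∃ g : REu n → ℝ,
      RzCamp q ψ g (C * S) ∧ |ballAvg g 0 1| ≤ C * S ∧
      (∀ (ε : ℝ), 0 < ε → ∀ x : EuclideanSpace ℝ (Fin n),
            IntegrableOn (fun y => (x j - y j) / dist x y ^ ((n : ℝ) + 1) * f y)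
              {y : EuclideanSpace ℝ (Fin n) | ε ≤ dist x y} volume) ∧
      (∀ (z : REu n) (ρ : ℝ), 0 < ρ →
            Tendsto (fun ε : ℝ => eLpNorm (fun x => rieszTrunc j ε f x - g x)
                (ENNReal.ofReal q) (volume.restrict (ball z ρ)))
              (nhdsWithin 0 (Set.Ioi 0)) (nhds 0)) ∧
      Tendsto (fun r => ballAvg g 0 r) atTop (nhds 0) := by
  obtain ⟨C, hC, H⟩ := rz_global hq hψ
  obtain ⟨C1, hC1, H1⟩ := rz_decay hq hψ.pos hβ hK0 hK
  obtain ⟨C2, hC2, H2⟩ := rz_T_ball hq hψ.pos hβ hK0 hK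
  have hc := rieszConst_nonneg n
  refine ⟨rieszConst n * (C + C2), by positivity, fun f S hf hσ j => ?_⟩
  have hS := hf.nn
  have htl := hf.tail hq hψ
  have hk := rz_k1int j hf.loc (((H1 f S hf hσ 1 le_rfl).2).trans_lt ENNReal.ofReal_lt_top)
  obtain ⟨g, h1, h2, h3⟩ := H j f S hf
  set κ := ∫ y, kerK j 1 (0 - y) * f y with hκ
  have hg1 := h1.sub_const (-κ)
  set g1 := fun y => g y - (-κ) with hg1d
  have heq : ∀ ε, 0 < ε → (fun x => rzT j ε f x - g1 x) = fun x => rzW j ε f x - g x := by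
    intro ε hε
    ext x
    rw [rzT_W j htl hk hε x, hg1d]; ring
  have hlim : ∀ (z : REu n) (ρ : ℝ),
      Tendsto (fun ε => eLpNorm (fun x => rzT j ε f x - g1 x) (ENNReal.ofReal q) (volume.restrict (ball z ρ)))
        (nhdsWithin 0 (Set.Ioi 0)) (nhds 0) := by
    intro z ρ
    refine (h3 z ρ).congr' ?_
    filter_upwards [self_mem_nhdsWithin] with ε hε
    rw [heq ε hε]
  have hb : ∀ r, 1 ≤ r → |ballAvg g1 0 r| ≤ C2 * S * r ^ β := by
    intro r hr
    have hr0 : 0 < r := by linarith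
    have hl : Tendsto (fun ε => eLpNorm (fun x => rzT j ε f x - g1 x) (ENNReal.ofReal q) (volume.restrict (ball 0 r))
        + ENNReal.ofReal (C2 * S * r ^ β * (rzv n * r ^ n) ^ (1 / q))) (nhdsWithin 0 (Set.Ioi 0))
        (nhds (0 + ENNReal.ofReal (C2 * S * r ^ β * (rzv n * r ^ n) ^ (1 / q)))) := (hlim 0 r).add tendsto_const_nhds
    rw [zero_add] at hl
    have hn : eLpNorm g1 (ENNReal.ofReal q) (volume.restrict (ball 0 r)) ≤
        ENNReal.ofReal (C2 * S * r ^ β * (rzv n * r ^ n) ^ (1 / q)) := by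
      refine ge_of_tendsto hl ?_
      filter_upwards [self_mem_nhdsWithin] with ε hε
      have hε : 0 < ε := hε
      have hgm := hg1.loc.aestronglyMeasurable
      have hTm : AEStronglyMeasurable (rzT j ε f) volume := by
        have : rzT j ε f = fun x => rzW j ε f x + κ := by
          ext x; exact rzT_W j htl hk hε x
        rw [this]
        exact (rzW_aesm j ε hf.loc.aestronglyMeasurable).add aestronglyMeasurable_const
      calc eLpNorm g1 (ENNReal.ofReal q) (volume.restrict (ball 0 r))
          = eLpNorm ((fun x => g1 x - rzT j ε f x) + rzT j ε f) (ENNReal.ofReal q) (volume.restrict (ball 0 r)) := by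
            congr 1; ext x; simp
        _ ≤ _ := eLpNorm_add_le (hgm.sub hTm).restrict hTm.restrict (rz_one_le hq)
        _ ≤ _ := by
            refine add_le_add (le_of_eq ?_) (H2 j f S hf htl hσ r hr ε hε)
            rw [← eLpNorm_neg]
            congr 1; ext x; simp
    have := rz_avg_sub hg1.loc hr0 (c := 0) (M := C2 * S * r ^ β) (by positivity) (by
      simpa using rz_holder hq hr0 hg1.loc.aestronglyMeasurable.restrict hn)
    simpa using this
  refine ⟨fun y => rieszConst n * g1 y, ?_, ?_, ?_, ?_, ?_⟩
  · have := hg1.smul hc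
    refine ⟨this.loc, this.mem, by positivity, fun x r hr => (this.bd x r hr).trans (ENNReal.ofReal_le_ofReal ?_)⟩
    have h4 := hψ.pos x r hr
    have hv := rzv_pos n
    rw [← mul_assoc]
    gcongr
    linarith
  · rw [rz_avg_smul, abs_mul, abs_of_nonneg hc]
    have := hb 1 le_rfl
    rw [Real.one_rpow, mul_one] at this
    rw [mul_assoc]
    gcongr
    nlinarith
  · intro ε hε x
    have := (rz_keint j htl hk hε x).integrableOn (s := {y : REu n | ε ≤ dist x y})
    refine this.congr_fun (fun y hy => ?_) (rz_dset x ε)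
    rw [rz_kereq j (ε := ε) hy]
  · intro z ρ hρ
    have h5 := ENNReal.Tendsto.const_mul (a := ‖rieszConst n‖ₑ) (hlim z ρ) (Or.inr enorm_ne_top)
    rw [mul_zero] at h5
    refine h5.congr fun ε => ?_
    rw [← eLpNorm_const_smul]
    congr 1
    ext x
    rw [rz_trunc_eq]
    simp only [Pi.smul_apply, smul_eq_mul]
    ring
  · have h6 : Tendsto (fun r : ℝ => rieszConst n * (C2 * S * r ^ β)) atTop (nhds 0) := by
      have := tendsto_rpow_neg_atTop (y := -β) (by linarith)
      rw [neg_neg] at this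
      simpa using (this.const_mul (C2 * S)).const_mul (rieszConst n)
    refine squeeze_zero_norm' ?_ h6
    filter_upwards [eventually_ge_atTop 1] with r hr
    rw [rz_avg_smul, Real.norm_eq_abs, abs_mul, abs_of_nonneg hc]
    gcongr
    exact hb r hr

lemma rz_campN {n : ℕ} {q : ℝ} (hq : 1 < q) {ψ : REu n → ℝ → ℝ} (hψ : ∀ x r, 0 < r → 0 < ψ x r)
    {f g : REu n → ℝ} {C D : ℝ} (hC : 0 ≤ C) (hD : 2 * C ≤ D) (hf : campSemi q ψ f < ⊤)
    (hg : RzCamp q ψ g (C * (campSemi q ψ f).toReal)) (h : |ballAvg g 0 1| ≤ C * (campSemi q ψ f).toReal) :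
    campSemi q ψ g ≤ ENNReal.ofReal D * campSemi q ψ f ∧
    campNorm q ψ g ≤ ENNReal.ofReal D * campNorm q ψ f := by
  have e : ENNReal.ofReal (C * (campSemi q ψ f).toReal) = ENNReal.ofReal C * campSemi q ψ f := by
    rw [ENNReal.ofReal_mul hC, ENNReal.ofReal_toReal hf.ne]
  have h1 := hg.semi_le hq hψ
  have h2 := ENNReal.ofReal_le_ofReal h
  rw [e] at h1 h2
  constructor
  · refine h1.trans ?_
    gcongr
    linarith
  · unfold campNorm
    calc _ ≤ ENNReal.ofReal C * campSemi q ψ f + ENNReal.ofReal C * campSemi q ψ f := add_le_add h1 h2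
      _ = ENNReal.ofReal (2 * C) * campSemi q ψ f := by
        rw [two_mul, ENNReal.ofReal_add hC hC, add_mul]
      _ ≤ _ := by
        gcongr
        exact le_self_add

/-- For the specific growth function `ψ` of Section 6: (i) the modified
Riesz transforms `R̃_j` are bounded on `𝓛_{q,ψ}` and on `𝓛𝓝_{q,ψ}`; (ii) if
`f ∈ 𝓛𝓝_{q,ψ}` and `σ(f) = 0`, then `R_j f` is well defined, `σ(R_j f) = 0`, and
`‖R_j f‖_{𝓛𝓝_{q,ψ}} ≤ C ‖f‖_{𝓛𝓝_{q,ψ}}`. -/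
theorem riesz_transform_specific_campanato (n : ℕ) (q α δ β : ℝ) (hq : 1 < q)
    (hδ₀ : -(n : ℝ) / q ≤ δ) (hδ₁ : δ < 0) (hα₀ : 0 < α) (hα₁ : α < 1)
    (hβ₀ : -(n : ℝ) / q ≤ β) (hβ₁ : β < 0) :
    ∃ C > 0,
      (∀ f : EuclideanSpace ℝ (Fin n) → ℝ, MemLpLoc q f →
        campNorm q (phiEx n α δ β) f < ⊤ → ∀ j : Fin n,
        ∃ g : EuclideanSpace ℝ (Fin n) → ℝ,
          (∀ (ε : ℝ), 0 < ε → ∀ x : EuclideanSpace ℝ (Fin n),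
            IntegrableOn (fun y =>
                ((x j - y j) / dist x y ^ ((n : ℝ) + 1) -
                  (-(y j)) * (1 - Set.indicator (ball (0 : EuclideanSpace ℝ (Fin n)) 1)
                    (fun _ => (1 : ℝ)) y) / ‖y‖ ^ ((n : ℝ) + 1)) * f y)
              {y : EuclideanSpace ℝ (Fin n) | ε ≤ dist x y} volume) ∧
          (∀ (z : EuclideanSpace ℝ (Fin n)) (ρ : ℝ), 0 < ρ →
            Tendsto (fun ε : ℝ => eLpNorm (fun x => modRieszTrunc j ε f x - g x)
                (ENNReal.ofReal q) (volume.restrict (ball z ρ)))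
              (nhdsWithin 0 (Set.Ioi 0)) (nhds 0)) ∧
          campSemi q (phiEx n α δ β) g ≤
            ENNReal.ofReal C * campSemi q (phiEx n α δ β) f ∧
          campNorm q (phiEx n α δ β) g ≤
            ENNReal.ofReal C * campNorm q (phiEx n α δ β) f) ∧
      (∀ f : EuclideanSpace ℝ (Fin n) → ℝ, MemLpLoc q f →
        campNorm q (phiEx n α δ β) f < ⊤ →
        Tendsto (fun r => ballAvg f 0 r) atTop (nhds 0) → ∀ j : Fin n,
        ∃ g : EuclideanSpace ℝ (Fin n) → ℝ,
          (∀ (ε : ℝ), 0 < ε → ∀ x : EuclideanSpace ℝ (Fin n),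
            IntegrableOn (fun y => (x j - y j) / dist x y ^ ((n : ℝ) + 1) * f y)
              {y : EuclideanSpace ℝ (Fin n) | ε ≤ dist x y} volume) ∧
          (∀ (z : EuclideanSpace ℝ (Fin n)) (ρ : ℝ), 0 < ρ →
            Tendsto (fun ε : ℝ => eLpNorm (fun x => rieszTrunc j ε f x - g x)
                (ENNReal.ofReal q) (volume.restrict (ball z ρ)))
              (nhdsWithin 0 (Set.Ioi 0)) (nhds 0)) ∧
          Tendsto (fun r => ballAvg g 0 r) atTop (nhds 0) ∧
          campNorm q (phiEx n α δ β) g ≤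
            ENNReal.ofReal C * campNorm q (phiEx n α δ β) f) := by
  have hpos : ∀ (x : REu n) (r : ℝ), 0 < r → 0 < phiEx n α δ β x r := fun x r hr => phi_pos x hr
  have hψ : RzG (phiEx n α δ β) α (2 ^ (-δ)) :=
    ⟨hpos, fun x r t hr ht => phi_grow hδ₁ hα₀ hβ₁ x hr ht, by positivity, hα₀, hα₁⟩
  obtain ⟨C, hC, H⟩ := rz_partI hq hψ
  obtain ⟨C', hC', H'⟩ := rz_partII hq hψ hβ₁ (K := 2 ^ (α - β)) (by positivity)
    (fun r hr => phi_zero hα₀ hβ₁ hr)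
  refine ⟨2 * C + 2 * C' + 1, by positivity, fun f hf hN j => ?_, fun f hf hN hσ j => ?_⟩
  · have hs : campSemi q (phiEx n α δ β) f < ⊤ := lt_of_le_of_lt le_self_add hN
    have hcp := rz_toCamp hq hpos hf hs
    obtain ⟨g, h1, h2, h3⟩ := H f _ hcp j
    have h4 := rz_campN hq hpos hC (by linarith : 2 * C ≤ 2 * C + 2 * C' + 1) hs h1 h2
    exact ⟨g, fun ε hε x => rz_mod_int j (hcp.tail hq hψ) hε x, h3, h4.1, h4.2⟩
  · have hs : campSemi q (phiEx n α δ β) f < ⊤ := lt_of_le_of_lt le_self_add hN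
    have hcp := rz_toCamp hq hpos hf hs
    obtain ⟨g, h1, h2, h3, h5, h6⟩ := H' f _ hcp hσ j
    have h4 := rz_campN hq hpos hC' (by linarith : 2 * C' ≤ 2 * C + 2 * C' + 1) hs h1 h2
    exact ⟨g, h3, h5, h6, h4.2⟩


end
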